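/- Let d ≥ 1, let N ⊆ ℝ^{2d} be an open set carrying a free Hamiltonian circle action φ of period 1 generated by a smooth H₁ : N → ℝ, and let U be an open set whose closure is compact and contained in N. Set c := sup_U H₁ − inf_U H₁. Let k be a positive integer with √k > (4π/k)(c + √k). Then every smooth H : ℝ^{2d} → ℝ that is pre-admissible supported in U, is invariant under the induced ℤ_k-action (H(φ(1/k, x)) = H(x) for all x ∈ N), and satisfies max H > 2π(c + √k), possesses a nonconstant periodic orbit of X_H, contained in U, of period strictly less than 1. (This is Theorem 2.1 of the paper in the geometrically bounded, rational ambient manifold (ℝ^{2d}, ω₀), where the hypothesis on overtwisted critical points is not needed.) -/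

import Mathlib

noncomputable section

open Set

/-- Phase space `ℝ^{2d}`, written as pairs `(p, q)` with `p q : Fin d → ℝ`. -/
abbrev Phase (d : ℕ) := (Fin d → ℝ) × (Fin d → ℝ)

/-- The standard symplectic form `ω₀` on `ℝ^{2d}`:
`ω₀(u,v) = ∑ i, (u_i v_{d+i} - u_{d+i} v_i)`. -/
def omega0 {d : ℕ} (u v : Phase d) : ℝ :=
  ∑ i, (u.1 i * v.2 i - u.2 i * v.1 i)

/-- The Hamiltonian vector field `X_H` of `H`, characterized by
`ω₀(X_H(x), v) = DH(x) v` for all `v`. -/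
def hamVF {d : ℕ} (H : Phase d → ℝ) (x : Phase d) : Phase d :=
  (fun i => fderiv ℝ H x (0, Pi.single i 1),
   fun i => - fderiv ℝ H x (Pi.single i 1, 0))

/-- `γ` is a `T`-periodic orbit of `X_H`. -/
def IsPeriodicOrbit {d : ℕ} (H : Phase d → ℝ) (γ : ℝ → Phase d) (T : ℝ) : Prop :=
  (∀ t, HasDerivAt γ (hamVF H (γ t)) t) ∧ (∀ t, γ (t + T) = γ t)

/-- `H` is pre-admissible supported in `U`, with maximum value `m`:
`0 ≤ H ≤ m`, `H ≡ 0` on some nonempty open subset of `U`, and `H ≡ m`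
outside some compact subset of `U`. -/
def PreAdmissible {d : ℕ} (H : Phase d → ℝ) (U : Set (Phase d)) (m : ℝ) : Prop :=
  ContDiff ℝ (⊤ : ℕ∞) H ∧ (∀ x, 0 ≤ H x ∧ H x ≤ m) ∧
  (∃ V : Set (Phase d), IsOpen V ∧ V.Nonempty ∧ V ⊆ U ∧ ∀ x ∈ V, H x = 0) ∧
  (∃ K : Set (Phase d), IsCompact K ∧ K ⊆ U ∧ ∀ x ∉ K, H x = m)

/-- A free Hamiltonian circle action of period 1 on the open set `N`,
generated by `H₁`. -/
def FreeHamCircleAction {d : ℕ} (N : Set (Phase d)) (H₁ : Phase d → ℝ)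
    (φ : ℝ → Phase d → Phase d) : Prop :=
  ContDiffOn ℝ (⊤ : ℕ∞) (fun p : ℝ × Phase d => φ p.1 p.2) (Set.univ ×ˢ N) ∧
  (∀ t, ∀ x ∈ N, φ t x ∈ N) ∧
  (∀ x ∈ N, φ 0 x = x) ∧
  (∀ s t, ∀ x ∈ N, φ s (φ t x) = φ (s + t) x) ∧
  (∀ t, ∀ x ∈ N, φ (t + 1) x = φ t x) ∧
  (∀ t, ∀ x ∈ N, HasDerivAt (fun s => φ s x) (hamVF H₁ (φ t x)) t) ∧
  (∀ t, ∀ x ∈ N, φ t x = x → ∃ j : ℤ, t = (j : ℝ))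

namespace HZ

section Brouwer
open MeasureTheory Metric
open scoped NNReal

lemma poly_det {n : ℕ} (A : EuclideanSpace ℝ (Fin n) →L[ℝ] EuclideanSpace ℝ (Fin n)) :
    ∃ p : Polynomial ℝ, p.degree < ((n + 1 : ℕ) : WithBot ℕ) ∧
      ∀ t : ℝ, p.eval t = (ContinuousLinearMap.id ℝ _ + t • A).det := by
  classical
  let b := (EuclideanSpace.basisFun (Fin n) ℝ).toBasis
  let B := LinearMap.toMatrix b b (A : _ →ₗ[ℝ] _)
  refine ⟨(((Polynomial.X : Polynomial ℝ) • B.map Polynomial.C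
    + (1 : Matrix (Fin n) (Fin n) ℝ).map Polynomial.C)).det, ?_, ?_⟩
  · refine lt_of_le_of_lt Polynomial.degree_le_natDegree ?_
    have := Polynomial.natDegree_det_X_add_C_le B 1
    rw [Fintype.card_fin] at this
    exact_mod_cast Nat.lt_succ_of_le this
  · intro t
    have h1 : (ContinuousLinearMap.id ℝ _ + t • A).det
        = LinearMap.det ((LinearMap.id : EuclideanSpace ℝ (Fin n) →ₗ[ℝ] _) + t • (A : _ →ₗ[ℝ] _)) := rfl
    rw [h1, ← LinearMap.det_toMatrix b, map_add, map_smul, LinearMap.toMatrix_id]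
    rw [← Polynomial.coe_evalRingHom, RingHom.map_det]
    congr 1
    ext i j
    simp [B, Matrix.one_apply, add_comm]
    split_ifs <;> simp [mul_comm]

lemma interp_exists (n : ℕ) (v : Fin (n + 1) → ℝ) (hv : Function.Injective v) :
    ∃ c : Fin (n + 1) → ℝ, ∀ p : Polynomial ℝ, p.degree < ((n + 1 : ℕ) : WithBot ℕ) →
      p.eval 1 = ∑ j, c j * p.eval (v j) := by
  classical
  refine ⟨fun j => (Lagrange.basis Finset.univ v j).eval 1, fun p hp => ?_⟩
  have := Lagrange.eq_interpolate (s := Finset.univ) (v := v) (f := p) (hv.injOn) (by simpa using hp)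
  conv_lhs => rw [this]
  rw [Lagrange.interpolate_apply, Polynomial.eval_finsetSum]
  simp [mul_comm]

/-- small perturbation: total volume. -/
lemma vol_small {n : ℕ} {a : EuclideanSpace ℝ (Fin n)} {R : ℝ} 
    {v : EuclideanSpace ℝ (Fin n) → EuclideanSpace ℝ (Fin n)} {K : ℝ≥0}
    (hv : LipschitzWith K v) (hout : ∀ x, x ∉ ball a R → v x = 0)
    {v' : EuclideanSpace ℝ (Fin n) → EuclideanSpace ℝ (Fin n) →L[ℝ] EuclideanSpace ℝ (Fin n)}
    (hd : ∀ x ∈ ball a R, HasFDerivAt v (v' x) x)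
    {t : ℝ} (ht0 : 0 ≤ t) (htK : t * K < 1)
    (hdet : ∀ x ∈ ball a R, 0 < (ContinuousLinearMap.id ℝ _ + t • v' x).det)
    (hinteg : IntegrableOn (fun x => (ContinuousLinearMap.id ℝ _ + t • v' x).det) (ball a R)) :
    ∫ x in ball a R, (ContinuousLinearMap.id ℝ _ + t • v' x).det = (volume (ball a R)).toReal := by
  set f : EuclideanSpace ℝ (Fin n) → EuclideanSpace ℝ (Fin n) := fun x => x + t • v x with hf
  have happ : ApproximatesLinearOn f
      ((ContinuousLinearEquiv.refl ℝ (EuclideanSpace ℝ (Fin n)) : EuclideanSpace ℝ (Fin n) →L[ℝ] EuclideanSpace ℝ (Fin n))) univ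
      (Real.toNNReal t * K) := by
    rw [ApproximatesLinearOn.approximatesLinearOn_iff_lipschitzOnWith]
    refine LipschitzOnWith.of_dist_le_mul fun x _ y _ => ?_
    have := hv.dist_le_mul x y
    simp only [hf, Pi.sub_apply, ContinuousLinearEquiv.coe_refl, ContinuousLinearMap.coe_id', id,
      add_sub_cancel_left, dist_smul₀, NNReal.coe_mul, Real.coe_toNNReal t ht0, Real.norm_eq_abs,
      abs_of_nonneg ht0]
    rw [mul_assoc]
    exact mul_le_mul_of_nonneg_left this ht0
  have hc : Subsingleton (EuclideanSpace ℝ (Fin n)) ∨ (Real.toNNReal t * K) <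
      ‖((ContinuousLinearEquiv.refl ℝ (EuclideanSpace ℝ (Fin n))).symm : EuclideanSpace ℝ (Fin n) →L[ℝ] EuclideanSpace ℝ (Fin n))‖₊⁻¹ := by
    rcases subsingleton_or_nontrivial (EuclideanSpace ℝ (Fin n)) with h | h
    · exact Or.inl h
    · right
      change _ < ‖ContinuousLinearMap.id ℝ (EuclideanSpace ℝ (Fin n))‖₊⁻¹
      have : ‖ContinuousLinearMap.id ℝ (EuclideanSpace ℝ (Fin n))‖₊ = 1 := by
        ext; simp
      rw [this, inv_one, ← NNReal.coe_lt_coe]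
      simpa [Real.coe_toNNReal t ht0] using htK
  have hinj : Function.Injective f := fun x y hxy =>
    happ.injOn hc (mem_univ x) (mem_univ y) hxy
  have hsurj : Function.Surjective f := happ.surjective hc
  have hfout : ∀ x, x ∉ ball a R → f x = x := fun x hx => by simp [hf, hout x hx]
  have himg : f '' ball a R = ball a R := by
    apply Subset.antisymm
    · rintro _ ⟨x, hx, rfl⟩
      by_contra hy
      have := hinj (hfout _ hy)
      rw [this] at hy
      exact hy hx
    · intro y hy
      obtain ⟨x, rfl⟩ := hsurj y
      refine ⟨x, ?_, rfl⟩
      by_contra hx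
      rw [hfout x hx] at hy
      exact hx hy
  have key := lintegral_abs_det_fderiv_eq_addHaar_image (volume) (s := ball a R) (f := f)
    (f' := fun x => ContinuousLinearMap.id ℝ _ + t • v' x) measurableSet_ball
    (fun x hx => (((hasFDerivAt_id x).add ((hd x hx).const_smul t))).hasFDerivWithinAt) hinj.injOn
  rw [himg] at key
  rw [← key, integral_eq_lintegral_of_nonneg_ae]
  · congr 1
    refine setLIntegral_congr_fun measurableSet_ball fun x hx => ?_
    simp only [abs_of_pos (hdet x hx)]
  · filter_upwards [self_mem_ae_restrict measurableSet_ball] with x hx using (hdet x hx).le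
  · exact hinteg.aestronglyMeasurable

/-- `∫ det (1 + Dv) = vol`. -/
lemma vol_one {n : ℕ} {a : EuclideanSpace ℝ (Fin n)} {R : ℝ} 
    {v : EuclideanSpace ℝ (Fin n) → EuclideanSpace ℝ (Fin n)} {K : ℝ≥0}
    (hv : LipschitzWith K v) (hout : ∀ x, x ∉ ball a R → v x = 0)
    {v' : EuclideanSpace ℝ (Fin n) → EuclideanSpace ℝ (Fin n) →L[ℝ] EuclideanSpace ℝ (Fin n)}
    (hd : ∀ x ∈ ball a R, HasFDerivAt v (v' x) x)
    (hcont : Continuous v') :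
    ∫ x in ball a R, (ContinuousLinearMap.id ℝ _ + v' x).det = (volume (ball a R)).toReal := by
  have hcd : ∀ t : ℝ, Continuous (fun x => (ContinuousLinearMap.id ℝ _ + t • v' x).det) := fun t =>
    ContinuousLinearMap.continuous_det.comp (by fun_prop)
  have hinteg : ∀ t : ℝ,
      IntegrableOn (fun x => (ContinuousLinearMap.id ℝ _ + t • v' x).det) (ball a R) := fun t =>
    ((hcd t).continuousOn.integrableOn_compact (isCompact_closedBall a R)).mono_set
      ball_subset_closedBall
  obtain ⟨C, hC⟩ := (isCompact_closedBall a R).exists_bound_of_continuousOn hcont.continuousOn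
  -- positivity of the determinant near the identity
  have hnear : ∃ δ > 0, ∀ B : EuclideanSpace ℝ (Fin n) →L[ℝ] EuclideanSpace ℝ (Fin n), ‖B‖ < δ →
      0 < (ContinuousLinearMap.id ℝ _ + B).det := by
    have hc0 : Continuous (fun B : EuclideanSpace ℝ (Fin n) →L[ℝ] EuclideanSpace ℝ (Fin n) =>
      (ContinuousLinearMap.id ℝ _ + B).det) := ContinuousLinearMap.continuous_det.comp (by fun_prop)
    have h0 : 0 < (ContinuousLinearMap.id ℝ (EuclideanSpace ℝ (Fin n)) + 0).det := by
      rw [add_zero]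
      have : (ContinuousLinearMap.id ℝ (EuclideanSpace ℝ (Fin n))).det = 1 := LinearMap.det_id
      rw [this]; exact one_pos
    have := (hc0.tendsto 0).eventually (lt_mem_nhds h0)
    rw [Metric.eventually_nhds_iff] at this
    obtain ⟨δ, hδ, h⟩ := this
    exact ⟨δ, hδ, fun B hB => h (by simpa using hB)⟩
  obtain ⟨δ, hδ, hδ'⟩ := hnear
  set ε : ℝ := min (1 / (2 * ((K : ℝ) + 1))) (δ / (2 * (|C| + 1))) with hε
  have hεpos : 0 < ε := by positivity
  set nodes : Fin (n + 1) → ℝ := fun j => ε * ((j : ℕ) : ℝ) / ((n : ℝ) + 1) with hnodes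
  have hninj : Function.Injective nodes := by
    intro i j hij
    simp only [hnodes] at hij
    have h1 : (0:ℝ) < (n : ℝ) + 1 := by positivity
    rw [div_left_inj' h1.ne'] at hij
    have := mul_left_cancel₀ hεpos.ne' hij
    exact Fin.ext (by exact_mod_cast this)
  have hn0 : ∀ j, 0 ≤ nodes j := fun j => by positivity
  have hn1 : ∀ j, nodes j ≤ ε := fun j => by
    have h1 : (0:ℝ) < (n : ℝ) + 1 := by positivity
    have h2 : ((j : ℕ) : ℝ) ≤ (n : ℝ) + 1 := by exact_mod_cast j.2.le
    rw [hnodes]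
    simp only
    rw [div_le_iff₀ h1]
    exact mul_le_mul_of_nonneg_left h2 hεpos.le
  obtain ⟨c, hc⟩ := interp_exists n nodes hninj
  have hvol : ∀ j, ∫ x in ball a R, (ContinuousLinearMap.id ℝ _ + nodes j • v' x).det
      = (volume (ball a R)).toReal := by
    intro j
    refine vol_small hv hout hd (hn0 j) ?_ ?_ (hinteg _)
    · calc nodes j * K ≤ ε * K := mul_le_mul_of_nonneg_right (hn1 j) K.2
        _ ≤ 1 / (2 * ((K : ℝ) + 1)) * K := mul_le_mul_of_nonneg_right (min_le_left _ _) K.2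
        _ < 1 := by
          have : (0:ℝ) ≤ K := K.2
          rw [div_mul_eq_mul_div, div_lt_one (by positivity)]; linarith
    · intro x hx
      apply hδ'
      rw [norm_smul, Real.norm_eq_abs, abs_of_nonneg (hn0 j)]
      have hx' := hC x (ball_subset_closedBall hx)
      have hC0 : ‖v' x‖ ≤ |C| := hx'.trans (le_abs_self C)
      calc nodes j * ‖v' x‖ ≤ (δ / (2 * (|C| + 1))) * |C| :=
            mul_le_mul ((hn1 j).trans (min_le_right _ _)) hC0 (norm_nonneg _) (by positivity)
        _ < δ := by
          have := abs_nonneg C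
          rw [div_mul_eq_mul_div, div_lt_iff₀ (by positivity)]; nlinarith
  have hpt : ∀ x, (ContinuousLinearMap.id ℝ _ + v' x).det
      = ∑ j, c j * (ContinuousLinearMap.id ℝ _ + nodes j • v' x).det := by
    intro x
    obtain ⟨p, hp, hpe⟩ := poly_det (v' x)
    have := hc p hp
    simp only [hpe, one_smul] at this
    exact this
  have hsum : ∑ j, c j = 1 := by
    have := hc 1 (by rw [Polynomial.degree_one]; exact_mod_cast Nat.succ_pos n)
    simpa using this.symm
  simp_rw [hpt]
  rw [integral_finsetSum _ (fun j _ => (hinteg (nodes j)).const_mul (c j))]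
  simp_rw [integral_const_mul, hvol, ← Finset.sum_mul, hsum, one_mul]

lemma brouwer_smooth {n : ℕ} {u : EuclideanSpace ℝ (Fin n) → EuclideanSpace ℝ (Fin n)}
    (hu : ContDiff ℝ 2 u) {R₀ : ℝ} (hsupp : ∀ x, R₀ ≤ ‖x‖ → u x = 0)
    (a : EuclideanSpace ℝ (Fin n)) (ha : ∀ x, x + u x ≠ a) : False := by
  set R : ℝ := |R₀| + ‖a‖ + 1 with hR
  have hRpos : 0 < R := by positivity
  have hfar : ∀ x, R ≤ ‖x - a‖ → u x = 0 := by
    intro x hx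
    apply hsupp
    have := norm_sub_le x a
    have := le_abs_self R₀
    linarith
  set g : EuclideanSpace ℝ (Fin n) → EuclideanSpace ℝ (Fin n) := fun x => x + u x - a with hg
  have hg0 : ∀ x, g x ≠ 0 := fun x => sub_ne_zero.2 (ha x)
  have hgs : ContDiff ℝ 2 g := (contDiff_id.add hu).sub contDiff_const
  set r : EuclideanSpace ℝ (Fin n) → EuclideanSpace ℝ (Fin n) := fun x => (R * ‖g x‖⁻¹) • g x with hr
  have hrs : ContDiff ℝ 2 r := by
    have hi : ContDiff ℝ 2 (fun x => ‖g x‖⁻¹) := 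
      ContDiff.inv (𝕜 := ℝ) (𝕜' := ℝ) (hgs.norm ℝ hg0) (fun x => norm_ne_zero_iff.2 (hg0 x))
    exact ContDiff.smul (contDiff_const.mul hi) hgs
  have hrn : ∀ x, ‖r x‖ = R := by
    intro x
    have := norm_pos_iff.2 (hg0 x)
    rw [hr]; simp only [norm_smul, norm_mul, norm_inv, norm_norm, Real.norm_eq_abs, abs_of_pos hRpos, abs_of_pos this]
    field_simp
  -- displacement
  set w : EuclideanSpace ℝ (Fin n) → EuclideanSpace ℝ (Fin n) := fun x => r x - (x - a) with hw
  have hws : ContDiff ℝ 2 w := hrs.sub (contDiff_id.sub contDiff_const)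
  have hwsph : ∀ x, ‖x - a‖ = R → w x = 0 := by
    intro x hx
    have h1 : g x = x - a := by simp [hg, hfar x hx.ge]
    simp [hw, hr, h1, hx, hRpos.ne']
  classical
  set v : EuclideanSpace ℝ (Fin n) → EuclideanSpace ℝ (Fin n) :=
    fun x => if x ∈ ball a R then w x else 0 with hv
  obtain ⟨K, hK⟩ := (hws.contDiffOn (s := closedBall a R)).exists_lipschitzOnWith (by norm_num)
    (convex_closedBall a R) (isCompact_closedBall a R)
  have hvcb : ∀ x ∈ closedBall a R, v x = w x := by
    intro x hx
    simp only [hv]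
    split_ifs with h
    · rfl
    · rw [hwsph]
      rw [mem_closedBall, dist_eq_norm] at hx
      rw [mem_ball, dist_eq_norm, not_lt] at h
      exact le_antisymm hx h
  have hvcross : ∀ x ∈ ball a R, ∀ y, y ∉ ball a R → dist (v x) (v y) ≤ K * dist x y := by
    intro x hx y hy
    have hcts : ContinuousOn (fun s : ℝ => dist (AffineMap.lineMap x y s) a) (Icc 0 1) := by
      apply Continuous.continuousOn
      have : Continuous (fun s : ℝ => (AffineMap.lineMap x y s : EuclideanSpace ℝ (Fin n))) :=
        AffineMap.lineMap_continuous
      fun_prop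
    have hmem : R ∈ Icc (dist (AffineMap.lineMap x y (0:ℝ)) a) (dist (AffineMap.lineMap x y (1:ℝ)) a) := by
      rw [AffineMap.lineMap_apply_zero, AffineMap.lineMap_apply_one]
      rw [mem_ball] at hx hy
      exact ⟨hx.le, not_lt.1 hy⟩
    obtain ⟨s, hs, hsR⟩ := intermediate_value_Icc (zero_le_one) hcts hmem
    simp only at hsR
    have hvy : v y = 0 := by simp only [hv, if_neg hy]
    have hz0 : w (AffineMap.lineMap x y s) = 0 := hwsph _ (by rw [← dist_eq_norm]; exact hsR)
    rw [hvcb x (ball_subset_closedBall hx), hvy, ← hz0]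
    refine (hK.dist_le_mul x (ball_subset_closedBall hx) _ (mem_closedBall.2 hsR.le)).trans ?_
    refine mul_le_mul_of_nonneg_left ?_ K.2
    rw [dist_left_lineMap, Real.norm_eq_abs, abs_of_nonneg hs.1]
    exact mul_le_of_le_one_left dist_nonneg hs.2
  have hvL : LipschitzWith K v := by
    refine LipschitzWith.of_dist_le_mul fun x y => ?_
    by_cases hx : x ∈ ball a R <;> by_cases hy : y ∈ ball a R
    · rw [hvcb x (ball_subset_closedBall hx), hvcb y (ball_subset_closedBall hy)]
      exact hK.dist_le_mul x (ball_subset_closedBall hx) _ (ball_subset_closedBall hy)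
    · exact hvcross x hx y hy
    · rw [dist_comm, dist_comm x]; exact hvcross y hy x hx
    · simp only [hv, hx, hy, if_false, dist_self]; positivity
  have hwd : Differentiable ℝ w := hws.differentiable (by norm_num)
  have key := vol_one (a := a) (R := R) hvL (fun x hx => by simp only [hv, if_neg hx]) (v' := fderiv ℝ w)
    (fun x hx => by
      refine (hwd x).hasFDerivAt.congr_of_eventuallyEq ?_
      filter_upwards [isOpen_ball.mem_nhds hx] with y hy
      simp only [hv, if_pos hy]) (hws.continuous_fderiv (by norm_num))
  have hdet0 : ∀ x, (ContinuousLinearMap.id ℝ _ + fderiv ℝ w x).det = 0 := by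
    intro x
    have hrd : HasFDerivAt r (ContinuousLinearMap.id ℝ _ + fderiv ℝ w x) x := by
      have h1 := (hasFDerivAt_id x).add (hwd x).hasFDerivAt
      have h2 := h1.sub_const a
      refine h2.congr_of_eventuallyEq (Filter.Eventually.of_forall fun y => ?_)
      simp [hw]
      abel
    by_contra hne
    set D := ContinuousLinearMap.id ℝ _ + fderiv ℝ w x
    have hconst : HasFDerivAt (fun y => ‖r y‖ ^ 2)
        (0 : EuclideanSpace ℝ (Fin n) →L[ℝ] ℝ) x := by
      simp_rw [hrn]; exact hasFDerivAt_const _ _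
    have h2 := hrd.norm_sq
    have h3 := h2.unique hconst
    let e := LinearMap.equivOfDetNeZero (D : EuclideanSpace ℝ (Fin n) →ₗ[ℝ] _) hne
    have h4 : D (e.symm (r x)) = r x := e.apply_symm_apply (r x)
    have h5 := congrArg (fun L => L (e.symm (r x))) h3
    simp [h4] at h5
    have := hrn x
    rw [h5] at this
    simp at this
    linarith
  simp_rw [hdet0, integral_zero] at key
  have hpos : 0 < (volume (ball a R)).toReal :=
    ENNReal.toReal_pos (measure_ball_pos volume a hRpos).ne' measure_ball_lt_top.ne
  linarith

/-- Lemma B: a continuous self-map which is the identity outside a bounded set is onto. -/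
theorem surj_of_id_outside_euclid {n : ℕ} {f : EuclideanSpace ℝ (Fin n) → EuclideanSpace ℝ (Fin n)}
    (hf : Continuous f) {R : ℝ} (hout : ∀ x, R ≤ ‖x‖ → f x = x) :
    Function.Surjective f := by
  intro a
  by_contra hne
  push Not at hne
  -- distance from `a`
  have hpos : ∃ ε > 0, ∀ x, ε ≤ dist (f x) a := by
    set R' := |R| + ‖a‖ + 1
    have hne' : (closedBall (0 : EuclideanSpace ℝ (Fin n)) R').Nonempty := ⟨0, by
      simp; positivity⟩
    obtain ⟨x0, hx0, hmin⟩ := (isCompact_closedBall (0 : EuclideanSpace ℝ (Fin n)) R').exists_isMinOn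
      hne' (f := fun x => dist (f x) a) (by fun_prop)
    refine ⟨min 1 (dist (f x0) a), lt_min one_pos (dist_pos.2 (hne x0)), fun x => ?_⟩
    by_cases hx : x ∈ closedBall (0 : EuclideanSpace ℝ (Fin n)) R'
    · exact (min_le_right _ _).trans (hmin hx)
    · refine (min_le_left _ _).trans ?_
      rw [mem_closedBall, dist_zero_right, not_le] at hx
      have h1 : R ≤ ‖x‖ := by
        have := le_abs_self R; have := norm_nonneg a; simp only [R'] at hx; linarith
      rw [hout x h1, dist_eq_norm]
      have h2 := norm_sub_norm_le x a
      have := abs_nonneg R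
      simp only [R'] at hx; linarith
  obtain ⟨ε, hε, hdist⟩ := hpos
  have hu : Continuous (fun x => f x - x) := hf.sub continuous_id
  obtain ⟨u, hus, hud, husup⟩ := hu.exists_contDiff_approx 2 (ε := fun _ => ε) continuous_const
    (fun _ => hε)
  refine brouwer_smooth (u := u) (by exact_mod_cast hus) (R₀ := R) ?_ a ?_
  · intro x hx
    by_contra h
    have := husup (Function.mem_support.2 h)
    rw [Function.mem_support, hout x hx, sub_self] at this
    exact this rfl
  · intro x hx
    have h1 := hud x
    have h2 := hdist x
    have : dist (u x) (f x - x) = dist a (f x) := by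
      rw [dist_eq_norm, dist_eq_norm, ← hx]; congr 1; abel
    rw [this, dist_comm] at h1
    linarith

theorem surj_of_id_outside {W : Type*} [NormedAddCommGroup W] [NormedSpace ℝ W]
    [FiniteDimensional ℝ W] {f : W → W} (hf : Continuous f) {R : ℝ}
    (hout : ∀ x, R ≤ ‖x‖ → f x = x) : Function.Surjective f := by
  let e := toEuclidean (E := W)
  have hc : Continuous (fun x => e (f (e.symm x))) := by fun_prop
  have hs := surj_of_id_outside_euclid hc (R := ‖(e : W →L[ℝ] EuclideanSpace ℝ (Fin (Module.finrank ℝ W)))‖ * |R|) (by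
    intro x hx
    by_cases h : R ≤ ‖e.symm x‖
    · simp [hout _ h]
    · push Not at h
      have h1 : ‖x‖ ≤ ‖(e : W →L[ℝ] EuclideanSpace ℝ (Fin (Module.finrank ℝ W)))‖ * ‖e.symm x‖ := by
        have := (e : W →L[ℝ] EuclideanSpace ℝ (Fin (Module.finrank ℝ W))).le_opNorm (e.symm x)
        simpa using this
      have h2 : ‖e.symm x‖ < |R| := h.trans_le (le_abs_self R)
      have h3 := (norm_nonneg (e : W →L[ℝ] EuclideanSpace ℝ (Fin (Module.finrank ℝ W))))
      rcases h3.eq_or_lt with h4 | h4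
      · rw [← h4, zero_mul] at h1
        have hx0 : x = 0 := norm_le_zero_iff.1 h1
        have : ∀ w : W, e w = 0 := fun w => by
          have := (e : W →L[ℝ] EuclideanSpace ℝ (Fin (Module.finrank ℝ W))).le_opNorm w
          rw [← h4, zero_mul] at this
          exact norm_le_zero_iff.1 this
        rw [this, hx0]
      · have := mul_lt_mul_of_pos_left h2 h4
        linarith)
  intro y
  obtain ⟨x, hx⟩ := hs (e y)
  exact ⟨e.symm x, e.injective hx⟩

end Brouwer
end HZ

namespace HZ
set_option linter.unusedSectionVars false

section Fourier
open MeasureTheory intervalIntegral Complex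
open scoped ComplexConjugate

/-- the character `e^{2πikt}` -/
def ee (k : ℤ) (t : ℝ) : ℂ := Complex.exp (((2 * Real.pi * k * t : ℝ) : ℂ) * I)

lemma norm_ee (k : ℤ) (t : ℝ) : ‖ee k t‖ = 1 := Complex.norm_exp_ofReal_mul_I _

@[fun_prop]
lemma continuous_ee (k : ℤ) : Continuous (ee k) := by unfold ee; fun_prop

lemma ee_zero (t : ℝ) : ee 0 t = 1 := by simp [ee]

lemma ee_at_zero (k : ℤ) : ee k 0 = 1 := by simp [ee]

lemma ee_mul (j k : ℤ) (t : ℝ) : ee j t * ee k t = ee (j + k) t := by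
  rw [ee, ee, ee, ← Complex.exp_add]; congr 1; push_cast; ring

lemma conj_ee (k : ℤ) (t : ℝ) : conj (ee k t) = ee (-k) t := by
  rw [ee, ee, ← Complex.exp_conj, map_mul, Complex.conj_ofReal, Complex.conj_I]; congr 1
  push_cast; ring

lemma ee_add_one (k : ℤ) (t : ℝ) : ee k (t + 1) = ee k t := by
  rw [ee, ee, Complex.exp_eq_exp_iff_exists_int]
  exact ⟨k, by push_cast; ring⟩

lemma hasDerivAt_ee (k : ℤ) (t : ℝ) : HasDerivAt (ee k) (((2 * Real.pi * k : ℝ) : ℂ) * I * ee k t) t := by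
  have h1 : HasDerivAt (fun t : ℝ => (((2 * Real.pi * k * t : ℝ) : ℂ) * I))
      (((2 * Real.pi * k : ℝ) : ℂ) * I) t := by
    have : HasDerivAt (fun t : ℝ => 2 * Real.pi * k * t) (2 * Real.pi * k) t := by
      simpa using (hasDerivAt_id t).const_mul (2 * Real.pi * k)
    exact (this.ofReal_comp).mul_const I
  have := h1.cexp
  rw [mul_comm (cexp _)] at this
  exact this

lemma integral_ee (k : ℤ) : ∫ t in (0:ℝ)..1, ee k t = if k = 0 then 1 else 0 := by
  split_ifs with h
  · subst h; simp [ee_zero]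
  · have hne : (((2 * Real.pi * k : ℝ) : ℂ) * I) ≠ 0 := by
      simp [h, Real.pi_ne_zero]
    have h1 := integral_eq_sub_of_hasDerivAt (a := 0) (b := 1) (fun t _ => hasDerivAt_ee k t)
      (by apply Continuous.intervalIntegrable; fun_prop)
    rw [intervalIntegral.integral_const_mul] at h1
    have h2 : ee k 1 = ee k 0 := by simpa using ee_add_one k 0
    rw [h2, sub_self] at h1
    exact (mul_eq_zero.1 h1).resolve_left hne

variable {E : Type*} [NormedAddCommGroup E] [InnerProductSpace ℂ E] [CompleteSpace E]

/-- trigonometric polynomial -/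
def ev (S : Finset ℤ) (X : ℤ → E) (t : ℝ) : E := ∑ k ∈ S, ee k t • X k

/-- Fourier coefficient -/
def coef (r : ℝ → E) (k : ℤ) : E := ∫ t in (0:ℝ)..1, ee (-k) t • r t

lemma continuous_ev (S : Finset ℤ) (X : ℤ → E) : Continuous (ev S X) := by
  unfold ev; fun_prop

lemma continuous_ev2 (S : Finset ℤ) : Continuous (fun p : (ℤ → E) × ℝ => ev S p.1 p.2) := by
  unfold ev; fun_prop

lemma ev_add (S : Finset ℤ) (X Y : ℤ → E) (t : ℝ) : ev S (X + Y) t = ev S X t + ev S Y t := by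
  simp [ev, Finset.sum_add_distrib]

lemma ev_add_one (S : Finset ℤ) (X : ℤ → E) (t : ℝ) : ev S X (t + 1) = ev S X t := by
  simp [ev, ee_add_one]

lemma inner_ev {r : ℝ → E} (hr : Continuous r) (S : Finset ℤ) (Y : ℤ → E) :
    ∫ t in (0:ℝ)..1, inner ℂ (r t) (ev S Y t) = ∑ k ∈ S, inner ℂ (coef r k) (Y k) := by
  have h1 : ∀ t, inner ℂ (r t) (ev S Y t) = ∑ k ∈ S, inner ℂ (ee (-k) t • r t) (Y k) := by
    intro t
    simp only [ev, inner_sum, inner_smul_right, inner_smul_left, conj_ee, neg_neg]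
  simp_rw [h1]
  rw [intervalIntegral.integral_finsetSum (fun k _ => by
    apply Continuous.intervalIntegrable; fun_prop)]
  refine Finset.sum_congr rfl fun k _ => ?_
  have hi : IntervalIntegrable (fun t => ee (-k) t • r t) volume 0 1 := by
    apply Continuous.intervalIntegrable; fun_prop
  rw [coef, intervalIntegral.integral_of_le zero_le_one, intervalIntegral.integral_of_le zero_le_one]
  have h2 : ∀ t, inner ℂ (ee (-k) t • r t) (Y k) = conj (inner ℂ (Y k) (ee (-k) t • r t)) :=
    fun t => (inner_conj_symm _ _).symm
  simp_rw [h2]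
  rw [integral_conj, integral_inner hi.1, inner_conj_symm]

lemma coef_ev {S : Finset ℤ} (X : ℤ → E) {k : ℤ} (hk : k ∈ S) : coef (ev S X) k = X k := by
  unfold coef ev
  simp_rw [Finset.smul_sum, smul_smul, ee_mul]
  rw [intervalIntegral.integral_finsetSum (fun k _ => by
    apply Continuous.intervalIntegrable; fun_prop)]
  simp_rw [intervalIntegral.integral_smul_const, integral_ee]
  rw [Finset.sum_eq_single k]
  · simp
  · intro j _ hj
    rw [if_neg (by omega), zero_smul]
  · exact fun h => (h hk).elim

lemma re_integral {f : ℝ → ℂ} (hf : Continuous f) :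
    ∫ t in (0:ℝ)..1, (f t).re = (∫ t in (0:ℝ)..1, f t).re := by
  have := Complex.reCLM.intervalIntegral_comp_comm (hf.intervalIntegrable (μ := volume) 0 1)
  simpa using this

lemma re_inner_ev {r : ℝ → E} (hr : Continuous r) (S : Finset ℤ) (Y : ℤ → E) :
    ∫ t in (0:ℝ)..1, (inner ℂ (r t) (ev S Y t)).re = ∑ k ∈ S, (inner ℂ (coef r k) (Y k)).re := by
  have hc := continuous_ev S Y
  rw [re_integral (by fun_prop), inner_ev hr, Complex.re_sum]

lemma re_inner_self_ (x : E) : (inner ℂ x x).re = ‖x‖ ^ 2 := by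
  have := inner_self_eq_norm_sq (𝕜 := ℂ) x
  simpa using this

lemma parseval (S : Finset ℤ) (X : ℤ → E) :
    ∫ t in (0:ℝ)..1, ‖ev S X t‖ ^ 2 = ∑ k ∈ S, ‖X k‖ ^ 2 := by
  have := re_inner_ev (continuous_ev S X) S X
  simp_rw [re_inner_self_] at this
  rw [this]
  refine Finset.sum_congr rfl fun k hk => ?_
  rw [coef_ev X hk, re_inner_self_]

lemma norm_sub_sq_c (x y : E) : ‖x - y‖ ^ 2 = ‖x‖ ^ 2 - 2 * (inner ℂ x y).re + ‖y‖ ^ 2 := by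
  have := norm_sub_sq (𝕜 := ℂ) x y
  simpa using this

lemma norm_add_sq_c (x y : E) : ‖x + y‖ ^ 2 = ‖x‖ ^ 2 + 2 * (inner ℂ x y).re + ‖y‖ ^ 2 := by
  have := norm_add_sq (𝕜 := ℂ) x y
  simpa using this

lemma bessel {r : ℝ → E} (hr : Continuous r) (S : Finset ℤ) :
    ∑ k ∈ S, ‖coef r k‖ ^ 2 ≤ ∫ t in (0:ℝ)..1, ‖r t‖ ^ 2 := by
  have hc := continuous_ev S (coef r)
  have h0 : 0 ≤ ∫ t in (0:ℝ)..1, ‖r t - ev S (coef r) t‖ ^ 2 :=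
    intervalIntegral.integral_nonneg zero_le_one (fun t _ => by positivity)
  simp_rw [norm_sub_sq_c] at h0
  rw [intervalIntegral.integral_add, intervalIntegral.integral_sub,
    intervalIntegral.integral_const_mul, re_inner_ev hr, parseval] at h0
  · simp_rw [re_inner_self_] at h0
    linarith
  all_goals apply Continuous.intervalIntegrable
  · fun_prop
  · exact continuous_const.mul (Complex.continuous_re.comp (by fun_prop))
  · exact (by fun_prop : Continuous fun t => ‖r t‖ ^ 2).sub (continuous_const.mul (Complex.continuous_re.comp (by fun_prop)))
  · fun_prop

end Fourier
end HZ

namespace HZ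
set_option linter.unusedSectionVars false

section LFour
open MeasureTheory intervalIntegral Complex
open scoped ComplexConjugate
variable {E : Type*} [NormedAddCommGroup E] [InnerProductSpace ℂ E] [CompleteSpace E]

lemma count_le (T : Finset ℤ) (hT : ∀ k ∈ T, 1 ≤ k) (m : ℤ) (hm : 2 ≤ m) :
    ∑ q ∈ T ×ˢ T, (if q.1 + q.2 = m then (1 / ((q.1 : ℝ) * q.2)) else 0) ≤ 1 := by
  rw [← Finset.sum_filter]
  set Q := (T ×ˢ T).filter (fun q => q.1 + q.2 = m) with hQ
  have hcard : (Q.card : ℝ) ≤ (m : ℝ) - 1 := by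
    have h1 : Q.card ≤ (Finset.Icc 1 (m - 1)).card := by
      apply Finset.card_le_card_of_injOn (fun q => q.1)
      · intro q hq
        simp only [hQ, Finset.coe_filter, Finset.mem_product, mem_ofPred_eq] at hq
        have := hT _ hq.1.1
        have := hT _ hq.1.2
        simp only [Finset.coe_Icc, mem_Icc]
        omega
      · intro q hq q' hq' h
        simp only [hQ, Finset.coe_filter, Finset.mem_product, mem_ofPred_eq] at hq hq'
        ext
        · exact h
        · simp only at h; omega
    rw [Int.card_Icc] at h1
    have h2 : ((m - 1 + 1 - 1).toNat : ℤ) = m - 1 := by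
      rw [Int.toNat_of_nonneg] <;> omega
    have h3 : (Q.card : ℤ) ≤ m - 1 := by rw [← h2]; exact_mod_cast h1
    exact_mod_cast h3
  have hm1 : (0 : ℝ) < (m : ℝ) - 1 := by
    have : (2 : ℝ) ≤ m := by exact_mod_cast hm
    linarith
  have h2 : ∑ q ∈ Q, 1 / ((q.1 : ℝ) * q.2) ≤ ∑ q ∈ Q, 1 / ((m : ℝ) - 1) := by
    apply Finset.sum_le_sum
    intro q hq
    simp only [hQ, Finset.mem_filter, Finset.mem_product] at hq
    have a1 : (1 : ℝ) ≤ q.1 := by exact_mod_cast hT _ hq.1.1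
    have a2 : (1 : ℝ) ≤ q.2 := by exact_mod_cast hT _ hq.1.2
    have a3 : (m : ℝ) = q.1 + q.2 := by exact_mod_cast hq.2.symm
    apply one_div_le_one_div_of_le hm1
    rw [a3]; nlinarith
  refine h2.trans ?_
  rw [Finset.sum_const, nsmul_eq_mul, mul_one_div]
  exact (div_le_one hm1).2 hcard

lemma four_expand (T : Finset ℤ) (X : ℤ → E) (t : ℝ) :
    ((‖ev T X t‖ ^ 4 : ℝ) : ℂ) = ∑ p ∈ T ×ˢ T, ∑ q ∈ T ×ˢ T,
      ee (q.1 + q.2 - p.1 - p.2) t * (inner ℂ (X p.1) (X q.1) * inner ℂ (X p.2) (X q.2)) := by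
  have h1 : ((‖ev T X t‖ ^ 2 : ℝ) : ℂ) = ∑ j ∈ T, ∑ l ∈ T, ee (l - j) t * inner ℂ (X j) (X l) := by
    have := inner_self_eq_norm_sq_to_K (𝕜 := ℂ) (ev T X t)
    have h2 : ((‖ev T X t‖ ^ 2 : ℝ) : ℂ) = inner ℂ (ev T X t) (ev T X t) := by
      rw [this]; push_cast; rfl
    rw [h2, ev, sum_inner]
    refine Finset.sum_congr rfl fun j _ => ?_
    rw [inner_sum]
    refine Finset.sum_congr rfl fun l _ => ?_
    rw [inner_smul_left, inner_smul_right, conj_ee, ← mul_assoc, ee_mul]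
    congr 2; ring
  have h2 : ((‖ev T X t‖ ^ 4 : ℝ) : ℂ) = ((‖ev T X t‖ ^ 2 : ℝ) : ℂ) * ((‖ev T X t‖ ^ 2 : ℝ) : ℂ) := by
    push_cast; ring
  rw [h2, h1, Finset.sum_mul_sum, Finset.sum_product]
  refine Finset.sum_congr rfl fun j _ => Finset.sum_congr rfl fun p _ => ?_
  rw [Finset.sum_mul_sum, Finset.sum_product]
  refine Finset.sum_congr rfl fun l _ => Finset.sum_congr rfl fun q _ => ?_
  have : ee (l + q - j - p) t = ee (l - j) t * ee (q - p) t := by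
    rw [ee_mul]; congr 1; ring
  simp only [this]; ring

lemma L_four (T : Finset ℤ) (hT : ∀ k ∈ T, 1 ≤ k) (X : ℤ → E) :
    ∫ t in (0:ℝ)..1, ‖ev T X t‖ ^ 4 ≤ (∑ k ∈ T, (k : ℝ) * ‖X k‖ ^ 2) ^ 2 := by
  have h1 : ((∫ t in (0:ℝ)..1, ‖ev T X t‖ ^ 4 : ℝ) : ℂ) = ∑ p ∈ T ×ˢ T, ∑ q ∈ T ×ˢ T,
      (if q.1 + q.2 = p.1 + p.2 then 1 else 0) *
        (inner ℂ (X p.1) (X q.1) * inner ℂ (X p.2) (X q.2)) := by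
    rw [← intervalIntegral.integral_ofReal]
    simp_rw [four_expand]
    rw [intervalIntegral.integral_finsetSum (fun k _ => by
      apply Continuous.intervalIntegrable; fun_prop)]
    refine Finset.sum_congr rfl fun p _ => ?_
    rw [intervalIntegral.integral_finsetSum (fun k _ => by
      apply Continuous.intervalIntegrable; fun_prop)]
    refine Finset.sum_congr rfl fun q _ => ?_
    rw [intervalIntegral.integral_mul_const, integral_ee]
    congr 1
    have : q.1 + q.2 - p.1 - p.2 = 0 ↔ q.1 + q.2 = p.1 + p.2 := by omega
    simp only [this]
  set w : ℤ × ℤ → ℝ := fun p => (p.1 : ℝ) * p.2 with hw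
  set A : ℤ × ℤ → ℝ := fun p => ‖X p.1‖ * ‖X p.2‖ with hA
  have h2 : ∫ t in (0:ℝ)..1, ‖ev T X t‖ ^ 4 ≤ ∑ p ∈ T ×ˢ T, ∑ q ∈ T ×ˢ T,
      (if q.1 + q.2 = p.1 + p.2 then A p * A q else 0) := by
    refine (le_abs_self _).trans ?_
    rw [← Real.norm_eq_abs, ← Complex.norm_real, h1]
    refine (norm_sum_le _ _).trans (Finset.sum_le_sum fun p _ => ?_)
    refine (norm_sum_le _ _).trans (Finset.sum_le_sum fun q _ => ?_)
    split_ifs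
    · rw [one_mul, norm_mul]
      calc _ ≤ (‖X p.1‖ * ‖X q.1‖) * (‖X p.2‖ * ‖X q.2‖) := by
            gcongr <;> exact norm_inner_le_norm _ _
        _ = _ := by simp only [hA]; ring
    · simp
  have hwpos : ∀ p ∈ T ×ˢ T, 0 < w p := by
    intro p hp
    rw [Finset.mem_product] at hp
    have a1 : (1 : ℝ) ≤ p.1 := by exact_mod_cast hT _ hp.1
    have a2 : (1 : ℝ) ≤ p.2 := by exact_mod_cast hT _ hp.2
    simp only [hw]; positivity
  have h3 : ∀ p ∈ T ×ˢ T, ∀ q ∈ T ×ˢ T, (if q.1 + q.2 = p.1 + p.2 then A p * A q else 0) ≤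
      1 / 2 * (w p * A p ^ 2 * (if q.1 + q.2 = p.1 + p.2 then 1 / w q else 0)) +
      1 / 2 * (w q * A q ^ 2 * (if p.1 + p.2 = q.1 + q.2 then 1 / w p else 0)) := by
    intro p hp q hq
    by_cases h : q.1 + q.2 = p.1 + p.2
    · rw [if_pos h, if_pos h, if_pos h.symm]
      have hp := hwpos p hp
      have hq := hwpos q hq
      have : 0 ≤ (w p * A p - w q * A q) ^ 2 / (w p * w q) := by positivity
      have e : (w p * A p - w q * A q) ^ 2 / (w p * w q) =
        w p * A p ^ 2 * (1 / w q) + w q * A q ^ 2 * (1 / w p) - 2 * (A p * A q) := by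
        field_simp; ring
      linarith
    · rw [if_neg h, if_neg h, if_neg (fun h' => h h'.symm)]; simp
  have h4 : ∑ p ∈ T ×ˢ T, ∑ q ∈ T ×ˢ T,
      w p * A p ^ 2 * (if q.1 + q.2 = p.1 + p.2 then 1 / w q else 0) ≤
      ∑ p ∈ T ×ˢ T, w p * A p ^ 2 := by
    refine Finset.sum_le_sum fun p hp => ?_
    rw [← Finset.mul_sum]
    refine mul_le_of_le_one_right (mul_nonneg (hwpos p hp).le (sq_nonneg _)) ?_
    rw [Finset.mem_product] at hp
    exact count_le T hT _ (by have := hT _ hp.1; have := hT _ hp.2; omega)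
  have h5 : ∑ p ∈ T ×ˢ T, ∑ q ∈ T ×ˢ T,
      (if q.1 + q.2 = p.1 + p.2 then A p * A q else 0) ≤ ∑ p ∈ T ×ˢ T, w p * A p ^ 2 := by
    refine (Finset.sum_le_sum fun p hp => Finset.sum_le_sum fun q hq => h3 p hp q hq).trans ?_
    simp_rw [Finset.sum_add_distrib, ← Finset.mul_sum _ _ (1/2 : ℝ)]
    rw [Finset.sum_comm (f := fun p q => w q * A q ^ 2 * (if p.1 + p.2 = q.1 + q.2 then 1 / w p else 0))]
    linarith
  refine (h2.trans h5).trans (le_of_eq ?_)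
  rw [sq, Finset.sum_mul_sum, Finset.sum_product]
  refine Finset.sum_congr rfl fun j _ => Finset.sum_congr rfl fun p _ => ?_
  simp only [hw, hA]; ring

end LFour
end HZ

namespace HZ
set_option linter.unusedSectionVars false

section Galerkin
open MeasureTheory intervalIntegral Complex
open scoped ComplexConjugate
variable {E : Type*} [NormedAddCommGroup E] [InnerProductSpace ℂ E] [CompleteSpace E]

/-- hypotheses of the abstract existence theorem -/
structure Good (F : E → ℝ) (g : E → E) (A B : E →L[ℂ] E) (L C κ b1 : ℝ) (e0 : E) : Prop where
  Fc : Continuous F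
  gc : Continuous g
  F0 : ∀ w, 0 ≤ F w
  desc : ∀ a v, F a + (inner ℂ (g a) v).re - L / 2 * ‖v‖ ^ 2 ≤ F (a + v)
  quart : ∀ w, F w ≤ C * ‖w‖ ^ 4
  Cpos : 0 < C
  Lpos : 0 ≤ L
  low : ∀ w, (inner ℂ (B w) w).re - C ≤ F w
  Bpos : ∀ w, b1 * ‖w‖ ^ 2 ≤ (inner ℂ (B w) w).re
  b1pos : 0 < b1
  e0n : ‖e0‖ = 1
  Be0 : Real.pi < (inner ℂ (B e0) e0).re
  glin : ∀ w, ‖g w - (2 : ℂ) • A w‖ ≤ C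
  nonres : ∀ (k : ℤ) (w : E), (1 + |(k : ℝ)|) * ‖w‖ ≤
    κ * ‖((2 * Real.pi * k : ℝ) : ℂ) • w - (2 : ℂ) • A w‖
  κpos : 0 < κ

/-- action functional on trigonometric polynomials -/
def Phi (S : Finset ℤ) (F : E → ℝ) (X : ℤ → E) : ℝ :=
  Real.pi * ∑ k ∈ S, (k : ℝ) * ‖X k‖ ^ 2 - ∫ t in (0:ℝ)..1, F (ev S X t)

/-- its gradient -/
def GG (S : Finset ℤ) (g : E → E) (X : ℤ → E) (k : ℤ) : E :=
  ((2 * Real.pi * k : ℝ) : ℂ) • X k - coef (fun t => g (ev S X t)) k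

lemma continuous_Phi (S : Finset ℤ) {F : E → ℝ} (hF : Continuous F) :
    Continuous (Phi S F) := by
  unfold Phi
  refine Continuous.sub (by fun_prop) ?_
  refine intervalIntegral.continuous_parametric_intervalIntegral_of_continuous' ?_ _ _
  exact hF.comp (continuous_ev2 S)

lemma continuous_GG (S : Finset ℤ) {g : E → E} (hg : Continuous g) (k : ℤ) :
    Continuous (fun X => GG S g X k) := by
  unfold GG coef
  refine Continuous.sub (by fun_prop) ?_
  refine intervalIntegral.continuous_parametric_intervalIntegral_of_continuous' ?_ _ _
  exact ((continuous_ee (-k)).comp continuous_snd).smul (hg.comp (continuous_ev2 S))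

lemma re_smul_inner (a : ℝ) (x y : E) : (inner ℂ ((a : ℂ) • x) y).re = a * (inner ℂ x y).re := by
  rw [inner_smul_left, Complex.conj_ofReal, Complex.re_ofReal_mul]

lemma re_inner_smul (a : ℝ) (x y : E) : (inner ℂ x ((a : ℂ) • y)).re = a * (inner ℂ x y).re := by
  rw [inner_smul_right, Complex.re_ofReal_mul]

lemma cont_re_inner {f h : ℝ → E} (hf : Continuous f) (hh : Continuous h) :
    Continuous (fun t => (inner ℂ (f t) (h t)).re) :=
  Complex.continuous_re.comp (by fun_prop)

variable {F : E → ℝ} {g : E → E} {A B : E →L[ℂ] E} {L C κ b1 : ℝ} {e0 : E}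

lemma descent (hG : Good F g A B L C κ b1 e0) {S : Finset ℤ} {n : ℕ}
    (hS : ∀ k ∈ S, |(k : ℝ)| ≤ n) (X Y : ℤ → E) :
    Phi S F (X + Y) ≤ Phi S F X + ∑ k ∈ S, (inner ℂ (GG S g X k) (Y k)).re
      + (2 * Real.pi * n + L) / 2 * ∑ k ∈ S, ‖Y k‖ ^ 2 := by
  have hX := continuous_ev S X
  have hY := continuous_ev S Y
  have hFc := hG.Fc
  have hgc := hG.gc
  have c1 : Continuous fun t => (inner ℂ (g (ev S X t)) (ev S Y t)).re :=
    cont_re_inner (by fun_prop) hY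
  have h1 : ∫ t in (0:ℝ)..1, (F (ev S X t) + (inner ℂ (g (ev S X t)) (ev S Y t)).re
      - L / 2 * ‖ev S Y t‖ ^ 2) ≤ ∫ t in (0:ℝ)..1, F (ev S (X + Y) t) := by
    apply intervalIntegral.integral_mono_on zero_le_one
    · apply Continuous.intervalIntegrable; fun_prop
    · apply Continuous.intervalIntegrable
      exact hFc.comp (continuous_ev S _)
    · intro t _
      rw [ev_add]; exact hG.desc _ _
  rw [intervalIntegral.integral_sub, intervalIntegral.integral_add,
    intervalIntegral.integral_const_mul, re_inner_ev (r := fun t => g (ev S X t)) (by fun_prop),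
    parseval] at h1
  rotate_left
  iterate 4 (apply Continuous.intervalIntegrable; fun_prop)
  have h2 : ∀ k ∈ S, Real.pi * ((k : ℝ) * ‖(X + Y) k‖ ^ 2) ≤ Real.pi * ((k : ℝ) * ‖X k‖ ^ 2)
      + (inner ℂ (((2 * Real.pi * k : ℝ) : ℂ) • X k) (Y k)).re + Real.pi * n * ‖Y k‖ ^ 2 := by
    intro k hk
    rw [Pi.add_apply, norm_add_sq_c, re_smul_inner]
    have h3 : (k : ℝ) ≤ n := (le_abs_self _).trans (hS k hk)
    have h4 : Real.pi * ((k : ℝ) * ‖Y k‖ ^ 2) ≤ Real.pi * (n * ‖Y k‖ ^ 2) := by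
      have := Real.pi_pos; gcongr
    linarith
  have h3 := Finset.sum_le_sum h2
  simp_rw [Finset.sum_add_distrib, ← Finset.mul_sum] at h3
  unfold Phi
  simp_rw [GG, inner_sub_left, Complex.sub_re, Finset.sum_sub_distrib]
  linarith

/-- cutoff -/
def cl (β s : ℝ) : ℝ := max 0 (min 1 (s / β))

lemma cl_nonneg (β s : ℝ) : 0 ≤ cl β s := le_max_left _ _
lemma cl_le_one (β s : ℝ) : cl β s ≤ 1 := max_le zero_le_one (min_le_left _ _)
lemma cl_eq_zero {β s : ℝ} (hβ : 0 < β) (hs : s ≤ 0) : cl β s = 0 :=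
  max_eq_left ((min_le_right _ _).trans (div_nonpos_of_nonpos_of_nonneg hs hβ.le))
lemma cl_eq_one {β s : ℝ} (hβ : 0 < β) (hs : β ≤ s) : cl β s = 1 := by
  unfold cl
  rw [min_eq_left ((one_le_div hβ).2 hs), max_eq_right zero_le_one]

/-- one descent step -/
def stp (S : Finset ℤ) (F : E → ℝ) (g : E → E) (h β : ℝ) (X : ℤ → E) : ℤ → E :=
  X + fun k => ((-(h * cl β (Phi S F X)) : ℝ) : ℂ) • GG S g X k

lemma continuous_stp (hG : Good F g A B L C κ b1 e0) (S : Finset ℤ) (h β : ℝ) :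
    Continuous (stp S F g h β) := by
  unfold stp
  have h1 := continuous_Phi S hG.Fc
  refine continuous_id.add (continuous_pi fun k => ?_)
  have h2 := continuous_GG S hG.gc k
  refine Continuous.smul (Complex.continuous_ofReal.comp ?_) h2
  unfold cl
  fun_prop

lemma stp_eq {S : Finset ℤ} {h β : ℝ} (hβ : 0 < β) {X : ℤ → E} (hX : Phi S F X ≤ 0) :
    stp S F g h β X = X := by
  unfold stp
  rw [cl_eq_zero hβ hX]
  ext k; simp

lemma stp_dec (hG : Good F g A B L C κ b1 e0) {S : Finset ℤ} {n : ℕ}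
    (hS : ∀ k ∈ S, |(k : ℝ)| ≤ n) {h β : ℝ} (h0 : 0 < h) (hh : h * (2 * Real.pi * n + L) ≤ 1)
    (X : ℤ → E) :
    Phi S F (stp S F g h β X) ≤ Phi S F X - h * cl β (Phi S F X) / 2 * ∑ k ∈ S, ‖GG S g X k‖ ^ 2 := by
  unfold stp
  refine (descent hG hS X _).trans ?_
  set c := cl β (Phi S F X)
  have hc0 : 0 ≤ c := cl_nonneg _ _
  have hc1 : c ≤ 1 := cl_le_one _ _
  simp_rw [re_inner_smul, re_inner_self_, ← Finset.mul_sum, norm_smul, mul_pow, ← Finset.mul_sum]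
  set Q := ∑ k ∈ S, ‖GG S g X k‖ ^ 2
  have hQ : 0 ≤ Q := Finset.sum_nonneg fun k _ => by positivity
  rw [Complex.norm_real, Real.norm_eq_abs, sq_abs]
  have h1 : (2 * Real.pi * n + L) / 2 * ((-(h * c)) ^ 2 * Q)
      = (h * (2 * Real.pi * n + L)) * (h * c * c * Q) / 2 := by ring
  have h2 : 0 ≤ h * c * c * Q := by positivity
  have h3 : h * c * c * Q ≤ h * c * 1 * Q := by gcongr
  rw [h1]
  nlinarith

end Galerkin
end HZ

namespace HZ
set_option linter.unusedSectionVars false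

section Minimax
open MeasureTheory intervalIntegral Complex
open scoped ComplexConjugate
variable {E : Type*} [NormedAddCommGroup E] [InnerProductSpace ℂ E] [CompleteSpace E]

/-- frequencies up to `n` -/
def SS (n : ℕ) : Finset ℤ := Finset.Icc (-(n : ℤ)) n

lemma SS_abs {n : ℕ} : ∀ k ∈ SS n, |(k : ℝ)| ≤ n := by
  intro k hk
  rw [SS, Finset.mem_Icc] at hk
  rw [abs_le]
  exact ⟨by exact_mod_cast hk.1, by exact_mod_cast hk.2⟩

lemma sum_SS {M : Type*} [AddCommMonoid M] (n : ℕ) (f : ℤ → M) :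
    ∑ k ∈ SS n, f k = ∑ j : Fin (n + 1), f (-((j : ℕ) : ℤ)) + ∑ k ∈ Finset.Icc (1 : ℤ) n, f k := by
  have h1 : SS n = Finset.Icc (-(n : ℤ)) 0 ∪ Finset.Icc 1 n := by
    ext k; simp only [SS, Finset.mem_Icc, Finset.mem_union]; omega
  rw [h1, Finset.sum_union]
  · congr 1
    rw [Fin.sum_univ_eq_sum_range (fun j => f (-(j : ℤ))) (n + 1)]
    symm
    refine Finset.sum_bij (fun j _ => -(j : ℤ)) ?_ ?_ ?_ ?_
    · intro j hj; simp only [Finset.mem_range, Finset.mem_Icc] at *; omega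
    · intro a _ b _ h; omega
    · intro k hk
      simp only [Finset.mem_Icc] at hk
      exact ⟨(-k).toNat, by simp only [Finset.mem_range]; omega, by omega⟩
    · intro j _; rfl
  · rw [Finset.disjoint_left]; intro k; simp only [Finset.mem_Icc]; omega

/-- the linking half space -/
def emb (n : ℕ) (e0 : E) (w : (Fin (n + 1) → E) × ℝ) (k : ℤ) : E :=
  if k ≤ 0 then w.1 (Fin.ofNat (n + 1) (-k).toNat) else if k = 1 then ((max w.2 0 : ℝ) : ℂ) • e0 else 0

lemma emb_neg (n : ℕ) (e0 : E) (w : (Fin (n + 1) → E) × ℝ) (j : Fin (n + 1)) :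
    emb n e0 w (-((j : ℕ) : ℤ)) = w.1 j := by
  unfold emb
  rw [if_pos (by omega)]
  have : Fin.ofNat (n + 1) (-(-((j : ℕ) : ℤ))).toNat = j := by
    ext; simp
  rw [this]

lemma emb_pos (n : ℕ) (e0 : E) (w : (Fin (n + 1) → E) × ℝ) {k : ℤ} (hk : 1 ≤ k) :
    emb n e0 w k = if k = 1 then ((max w.2 0 : ℝ) : ℂ) • e0 else 0 := by
  unfold emb
  rw [if_neg (by omega)]

lemma continuous_emb (n : ℕ) (e0 : E) : Continuous (emb n e0) := by
  refine continuous_pi fun k => ?_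
  unfold emb
  split_ifs
  · fun_prop
  · fun_prop
  · fun_prop

lemma sum_emb (n : ℕ) (hn : 1 ≤ n) {e0 : E} (w : (Fin (n + 1) → E) × ℝ) (f : ℤ → E → ℝ)
    (hf : ∀ k, f k 0 = 0) :
    ∑ k ∈ SS n, f k (emb n e0 w k) = ∑ j : Fin (n + 1), f (-((j : ℕ) : ℤ)) (w.1 j)
      + f 1 (((max w.2 0 : ℝ) : ℂ) • e0) := by
  rw [sum_SS]
  congr 1
  · exact Finset.sum_congr rfl fun j _ => by rw [emb_neg]
  · rw [Finset.sum_eq_single 1]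
    · rw [emb_pos n e0 w le_rfl, if_pos rfl]
    · intro k hk hk1
      rw [Finset.mem_Icc] at hk
      rw [emb_pos n e0 w hk.1, if_neg hk1, hf]
    · intro h
      exfalso; apply h; rw [Finset.mem_Icc]; omega

variable {F : E → ℝ} {g : E → E} {A B : E →L[ℂ] E} {L C κ b1 : ℝ} {e0 : E}

lemma ev_map (S : Finset ℤ) (X : ℤ → E) (t : ℝ) (B : E →L[ℂ] E) :
    B (ev S X t) = ev S (fun k => B (X k)) t := by
  simp [ev]

lemma int_quad (S : Finset ℤ) (X : ℤ → E) (B : E →L[ℂ] E) :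
    ∫ t in (0:ℝ)..1, (inner ℂ (B (ev S X t)) (ev S X t)).re
      = ∑ k ∈ S, (inner ℂ (B (X k)) (X k)).re := by
  simp_rw [ev_map]
  rw [re_inner_ev (continuous_ev S _)]
  refine Finset.sum_congr rfl fun k hk => ?_
  rw [coef_ev _ hk]

lemma phi_emb_le (hG : Good F g A B L C κ b1 e0) {n : ℕ} (hn : 1 ≤ n) (w : (Fin (n + 1) → E) × ℝ) :
    Phi (SS n) F (emb n e0 w) ≤ C - b1 * ∑ j, ‖w.1 j‖ ^ 2
      - ((inner ℂ (B e0) e0).re - Real.pi) * (max w.2 0) ^ 2 := by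
  have hFc := hG.Fc
  set X := emb n e0 w with hX
  have hc := continuous_ev (SS n) X
  have h1 : ∫ t in (0:ℝ)..1, ((inner ℂ (B (ev (SS n) X t)) (ev (SS n) X t)).re - C)
      ≤ ∫ t in (0:ℝ)..1, F (ev (SS n) X t) := by
    apply intervalIntegral.integral_mono_on zero_le_one
    · apply Continuous.intervalIntegrable
      exact (cont_re_inner (by fun_prop) hc).sub continuous_const
    · apply Continuous.intervalIntegrable
      fun_prop
    · intro t _; exact hG.low _
  rw [intervalIntegral.integral_sub
    ((cont_re_inner (by fun_prop) hc).intervalIntegrable _ _) (by simp), int_quad] at h1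
  rw [hX, sum_emb n hn w (fun k x => (inner ℂ (B x) x).re) (by simp), ← hX] at h1
  have h2 : ∑ k ∈ SS n, (k : ℝ) * ‖X k‖ ^ 2 ≤ (max w.2 0) ^ 2 := by
    rw [hX, sum_emb n hn w (fun k x => (k : ℝ) * ‖x‖ ^ 2) (by simp)]
    have : ∑ j : Fin (n + 1), ((-((j : ℕ) : ℤ) : ℤ) : ℝ) * ‖w.1 j‖ ^ 2 ≤ 0 := by
      apply Finset.sum_nonpos
      intro j _
      apply mul_nonpos_of_nonpos_of_nonneg
      · push_cast; simp
      · positivity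
    rw [norm_smul, hG.e0n, Complex.norm_real, Real.norm_eq_abs]
    simp only [Int.cast_one, one_mul, mul_one, sq_abs]
    linarith
  have h3 : b1 * ∑ j, ‖w.1 j‖ ^ 2 ≤ ∑ j : Fin (n + 1), (inner ℂ (B (w.1 j)) (w.1 j)).re := by
    rw [Finset.mul_sum]; exact Finset.sum_le_sum fun j _ => hG.Bpos _
  have h4 : (inner ℂ (B (((max w.2 0 : ℝ) : ℂ) • e0)) (((max w.2 0 : ℝ) : ℂ) • e0)).re
      = (max w.2 0) ^ 2 * (inner ℂ (B e0) e0).re := by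
    rw [map_smul, re_smul_inner, re_inner_smul]; ring
  rw [h4] at h1
  simp only [intervalIntegral.integral_const, sub_zero, one_smul] at h1
  unfold Phi
  have h5 := mul_le_mul_of_nonneg_left h2 Real.pi_pos.le
  linarith

lemma phi_emb_nonpos (hG : Good F g A B L C κ b1 e0) {n : ℕ} (hn : 1 ≤ n) (w : (Fin (n + 1) → E) × ℝ)
    (hw : w.2 ≤ 0) : Phi (SS n) F (emb n e0 w) ≤ 0 := by
  unfold Phi
  rw [sum_emb n hn w (fun k x => (k : ℝ) * ‖x‖ ^ 2) (by simp)]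
  have h1 : ∑ j : Fin (n + 1), ((-((j : ℕ) : ℤ) : ℤ) : ℝ) * ‖w.1 j‖ ^ 2 ≤ 0 := by
    apply Finset.sum_nonpos
    intro j _
    apply mul_nonpos_of_nonpos_of_nonneg
    · push_cast; simp
    · positivity
  have h2 : 0 ≤ ∫ t in (0:ℝ)..1, F (ev (SS n) (emb n e0 w) t) :=
    intervalIntegral.integral_nonneg zero_le_one fun t _ => hG.F0 _
  rw [max_eq_right hw]
  simp only [Complex.ofReal_zero, zero_smul, norm_zero]
  have := Real.pi_pos
  nlinarith

lemma phi_gamma (hG : Good F g A B L C κ b1 e0) {n : ℕ} {Y : ℤ → E}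
    (hY : ∀ j : Fin (n + 1), Y (-((j : ℕ) : ℤ)) = 0) {A : ℝ}
    (hA : ∑ k ∈ Finset.Icc (1 : ℤ) n, (k : ℝ) * ‖Y k‖ ^ 2 = A) :
    Real.pi * A - C * A ^ 2 ≤ Phi (SS n) F Y := by
  have hev : ∀ t, ev (SS n) Y t = ev (Finset.Icc (1 : ℤ) n) Y t := by
    intro t
    unfold ev
    rw [sum_SS]
    simp [hY]
  have h1 := L_four (Finset.Icc (1 : ℤ) n) (fun k hk => (Finset.mem_Icc.1 hk).1) Y
  rw [hA] at h1
  have hFc := hG.Fc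
  have hc := continuous_ev (Finset.Icc (1 : ℤ) n) Y
  have h2 : ∫ t in (0:ℝ)..1, F (ev (Finset.Icc (1 : ℤ) n) Y t) ≤
      ∫ t in (0:ℝ)..1, C * ‖ev (Finset.Icc (1 : ℤ) n) Y t‖ ^ 4 := by
    apply intervalIntegral.integral_mono_on zero_le_one
    · apply Continuous.intervalIntegrable; fun_prop
    · apply Continuous.intervalIntegrable; fun_prop
    · intro t _; exact hG.quart _
  rw [intervalIntegral.integral_const_mul] at h2
  have h3 := mul_le_mul_of_nonneg_left h1 hG.Cpos.le
  unfold Phi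
  simp_rw [hev]
  rw [sum_SS, hA]
  simp only [hY, norm_zero]
  simp only [ne_eq, OfNat.ofNat_ne_zero, not_false_eq_true, zero_pow, mul_zero, Finset.sum_const_zero, zero_add]
  linarith

theorem galerkin [FiniteDimensional ℂ E] (hG : Good F g A B L C κ b1 e0) :
    ∃ β > 0, ∀ n : ℕ, 1 ≤ n → ∀ ε > 0, ∃ X : ℤ → E, β ≤ Phi (SS n) F X ∧
      ∑ k ∈ SS n, ‖GG (SS n) g X k‖ ^ 2 ≤ ε := by
  have hπ := Real.pi_pos
  have hC := hG.Cpos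
  set A : ℝ := Real.pi / (2 * C) with hA
  set β : ℝ := Real.pi * A - C * A ^ 2 with hβ
  have hβe : β = Real.pi ^ 2 / (4 * C) := by rw [hβ, hA]; field_simp; ring
  have hβ0 : 0 < β := by rw [hβe]; positivity
  have hA0 : 0 < A := by positivity
  refine ⟨β, hβ0, fun n hn ε hε => ?_⟩
  by_contra hcon
  push Not at hcon
  set Λ : ℝ := 2 * Real.pi * n + L + 1 with hΛ
  have hΛ0 : 0 < Λ := by have := hG.Lpos; positivity
  set h : ℝ := 1 / Λ with hh
  have h0 : 0 < h := by positivity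
  have hh1 : h * (2 * Real.pi * n + L) ≤ 1 := by
    rw [hh, one_div, inv_mul_le_iff₀ hΛ0]; linarith
  -- number of steps
  obtain ⟨N, hN⟩ := exists_nat_gt (C / (h / 2 * ε))
  have hN' : C < N * (h / 2 * ε) := (div_lt_iff₀ (by positivity)).1 hN
  set σ := stp (SS n) F g h β with hσ
  have hσc : Continuous σ := continuous_stp hG _ _ _
  have hηc : Continuous (σ^[N]) := hσc.iterate N
  have hηid : ∀ X, Phi (SS n) F X ≤ 0 → σ^[N] X = X := fun X hX =>
    Function.iterate_fixed (stp_eq hβ0 hX) N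
  have hdec : ∀ X, Phi (SS n) F (σ X) ≤ Phi (SS n) F X := fun X => by
    refine (stp_dec hG SS_abs h0 hh1 X).trans ?_
    have := cl_nonneg β (Phi (SS n) F X)
    have : 0 ≤ h * cl β (Phi (SS n) F X) / 2 * ∑ k ∈ SS n, ‖GG (SS n) g X k‖ ^ 2 :=
      mul_nonneg (by positivity) (Finset.sum_nonneg fun k _ => by positivity)
    linarith
  have hkey : ∀ m : ℕ, ∀ X, β ≤ Phi (SS n) F (σ^[m] X) →
      Phi (SS n) F (σ^[m] X) ≤ Phi (SS n) F X - m * (h / 2 * ε) := by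
    intro m
    induction m with
    | zero => intro X _; simp
    | succ m ih =>
      intro X hX
      rw [Function.iterate_succ_apply'] at hX ⊢
      have h1 := hX.trans (hdec _)
      have h2 := ih X h1
      have h3 := stp_dec hG SS_abs h0 hh1 (β := β) (σ^[m] X)
      rw [cl_eq_one hβ0 h1] at h3
      have h4 := hcon _ h1
      have h5 : h * 1 / 2 * ε ≤ h * 1 / 2 * ∑ k ∈ SS n, ‖GG (SS n) g (σ^[m] X) k‖ ^ 2 := by gcongr
      push_cast
      linarith
  set f : (Fin (n + 1) → E) × ℝ → (Fin (n + 1) → E) × ℝ := fun w =>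
    (fun j => σ^[N] (emb n e0 w) (-((j : ℕ) : ℤ)),
      Real.sqrt (∑ k ∈ Finset.Icc (1 : ℤ) n, (k : ℝ) * ‖σ^[N] (emb n e0 w) k‖ ^ 2) + min w.2 0) with hf
  have hec := continuous_emb n e0
  have hfc : Continuous f := by
    have hk : ∀ k, Continuous (fun w => σ^[N] (emb n e0 w) k) := fun k =>
      (continuous_apply k).comp (hηc.comp hec)
    refine Continuous.prodMk (continuous_pi fun j => hk _) ?_
    refine Continuous.add (Real.continuous_sqrt.comp ?_) (by fun_prop)
    exact continuous_finsetSum _ fun k _ => continuous_const.mul ((hk k).norm.pow 2)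
  have hfid : ∀ w, Phi (SS n) F (emb n e0 w) ≤ 0 → f w = w := by
    intro w hw
    simp only [hf, hηid _ hw, emb_neg]
    ext1
    · rfl
    · simp only
      rw [Finset.sum_eq_single 1]
      · rw [emb_pos n e0 w le_rfl, if_pos rfl, norm_smul, hG.e0n, Complex.norm_real, mul_one,
          Int.cast_one, one_mul, Real.sqrt_sq (norm_nonneg _), Real.norm_of_nonneg (le_max_right _ _)]
        rcases le_total w.2 0 with h | h
        · simp [h]
        · simp [h]
      · intro k hk hk1
        rw [Finset.mem_Icc] at hk
        rw [emb_pos n e0 w hk.1, if_neg hk1]; simp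
      · intro h
        exfalso; apply h; rw [Finset.mem_Icc]; omega
  set b0 := (inner ℂ (B e0) e0).re - Real.pi with hb0
  have hb00 : 0 < b0 := sub_pos.2 hG.Be0
  have hb1 := hG.b1pos
  obtain ⟨w, hw⟩ := surj_of_id_outside hfc (R := Real.sqrt (C / min b1 b0)) (by
    intro w hw
    apply hfid
    rcases le_or_gt w.2 0 with hs | hs
    · exact phi_emb_nonpos hG hn w hs
    refine (phi_emb_le hG hn w).trans ?_
    rw [max_eq_left hs.le, ← hb0]
    have hm : 0 < min b1 b0 := lt_min hb1 hb00
    have h1 : C / min b1 b0 ≤ ‖w‖ ^ 2 := by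
      rw [Real.sqrt_le_left (norm_nonneg _)] at hw; exact hw
    have h2 : ‖w‖ ^ 2 ≤ ∑ j, ‖w.1 j‖ ^ 2 + w.2 ^ 2 := by
      have hsn : 0 ≤ ∑ j, ‖w.1 j‖ ^ 2 := Finset.sum_nonneg fun j _ => by positivity
      rw [Prod.norm_def]
      rcases max_choice ‖w.1‖ ‖w.2‖ with h | h
      · rw [h]
        obtain ⟨j, hj⟩ : ∃ j, ‖w.1‖ ≤ ‖w.1 j‖ := by
          by_contra hcon
          push Not at hcon
          have := (pi_norm_lt_iff (x := w.1) (r := ‖w.1‖) (lt_of_le_of_lt (norm_nonneg _) (hcon 0))).2 hcon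
          exact lt_irrefl _ this
        have h3 : ‖w.1 j‖ ^ 2 ≤ ∑ j, ‖w.1 j‖ ^ 2 :=
          Finset.single_le_sum (f := fun j => ‖w.1 j‖ ^ 2) (fun j _ => by positivity) (Finset.mem_univ j)
        have h4 : ‖w.1‖ ^ 2 ≤ ‖w.1 j‖ ^ 2 := by gcongr
        nlinarith [sq_nonneg w.2]
      · rw [h, Real.norm_eq_abs, sq_abs]; linarith
    rw [div_le_iff₀ hm] at h1
    have hsn : 0 ≤ ∑ j, ‖w.1 j‖ ^ 2 := Finset.sum_nonneg fun j _ => by positivity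
    have h5 : min b1 b0 * ∑ j, ‖w.1 j‖ ^ 2 ≤ b1 * ∑ j, ‖w.1 j‖ ^ 2 := by
      gcongr; exact min_le_left _ _
    have h6 : min b1 b0 * w.2 ^ 2 ≤ b0 * w.2 ^ 2 := by
      gcongr; exact min_le_right _ _
    have h7 := mul_le_mul_of_nonneg_left h2 hm.le
    linarith) (0, Real.sqrt A)
  have hs : 0 < w.2 := by
    by_contra hs
    push Not at hs
    rw [hfid w (phi_emb_nonpos hG hn w hs)] at hw
    rw [hw] at hs
    exact absurd (Real.sqrt_pos.2 hA0) (not_lt.2 hs)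
  simp only [hf, Prod.mk.injEq] at hw
  obtain ⟨hw1, hw2⟩ := hw
  rw [min_eq_right hs.le, add_zero, Real.sqrt_inj (Finset.sum_nonneg fun k hk => by
    have : (0 : ℝ) ≤ k := by exact_mod_cast le_trans zero_le_one (Finset.mem_Icc.1 hk).1
    positivity) hA0.le] at hw2
  have hγ := phi_gamma hG (fun j => congrFun hw1 j) hw2
  have h1 := hkey N _ hγ
  have h2 := phi_emb_le hG hn w
  have h3 : 0 ≤ b1 * ∑ j, ‖w.1 j‖ ^ 2 := mul_nonneg hb1.le (Finset.sum_nonneg fun j _ => by positivity)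
  have h4 : 0 ≤ b0 * (max w.2 0) ^ 2 := by positivity
  linarith

end Minimax
end HZ

namespace HZ
set_option linter.unusedSectionVars false

section Limit
open MeasureTheory intervalIntegral Complex Filter Topology
open scoped ComplexConjugate
variable {E : Type*} [NormedAddCommGroup E] [InnerProductSpace ℂ E] [CompleteSpace E]

lemma fourier_unique_C {y : ℝ → ℂ} (hy : Continuous y) (hp : ∀ t, y (t + 1) = y t)
    (h : ∀ k, coef y k = 0) : ∀ t, y t = 0 := by
  have hper : Function.Periodic y 1 := hp
  let f : C(AddCircle (1 : ℝ), ℂ) := ⟨hper.lift, by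
    apply continuous_coinduced_dom.mpr
    exact hy⟩
  have hc : ∀ k, fourierCoeff f k = 0 := by
    intro k
    rw [fourierCoeff_eq_intervalIntegral _ _ 0, zero_add, one_div, inv_one, one_smul]
    rw [← h k, coef]
    refine intervalIntegral.integral_congr fun t _ => ?_
    have h1 : (fourier (-k) : AddCircle (1 : ℝ) → ℂ) (t : AddCircle (1 : ℝ)) = ee (-k) t := by
      rw [fourier_coe_apply, ee]; congr 1; push_cast; ring
    have h2 : f (t : AddCircle (1 : ℝ)) = y t := hper.lift_coe t
    simp only [h1, h2]
  have hs : Summable (fourierCoeff f) := by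
    rw [show fourierCoeff f = fun _ => (0 : ℂ) from funext hc]; exact summable_zero
  intro t
  have h1 := has_pointwise_sum_fourier_series_of_summable hs (t : AddCircle (1 : ℝ))
  simp only [hc, zero_smul] at h1
  have h2 : f (t : AddCircle (1 : ℝ)) = y t := hper.lift_coe t
  rw [← h2]
  exact h1.unique hasSum_zero

lemma fourier_unique {y : ℝ → E} (hy : Continuous y) (hp : ∀ t, y (t + 1) = y t)
    (h : ∀ k, coef y k = 0) : ∀ t, y t = 0 := by
  intro t
  have key : ∀ v : E, inner ℂ v (y t) = 0 := by
    intro v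
    refine fourier_unique_C (y := fun t => inner ℂ v (y t)) (by fun_prop) (fun t => by simp only [hp]) ?_ t
    intro k
    unfold coef
    have h1 : ∀ t, ee (-k) t • inner ℂ v (y t) = inner ℂ v (ee (-k) t • y t) := fun t => by
      rw [inner_smul_right, smul_eq_mul]
    simp_rw [h1]
    have hi : IntervalIntegrable (fun t => ee (-k) t • y t) volume 0 1 := by
      apply Continuous.intervalIntegrable; fun_prop
    rw [intervalIntegral.integral_of_le zero_le_one, integral_inner hi.1]
    have := h k
    rw [coef, intervalIntegral.integral_of_le zero_le_one] at this
    rw [this, inner_zero_right]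
  exact inner_self_eq_zero.1 (key (y t))

lemma coef_sub {x z : ℝ → E} (hx : Continuous x) (hz : Continuous z) (k : ℤ) :
    coef (fun t => x t - z t) k = coef x k - coef z k := by
  unfold coef
  simp_rw [smul_sub]
  apply intervalIntegral.integral_sub <;> apply Continuous.intervalIntegrable <;> fun_prop

lemma coef_const (c : E) (k : ℤ) : coef (fun _ => c) k = if k = 0 then c else 0 := by
  unfold coef
  rw [intervalIntegral.integral_smul_const, integral_ee]
  simp only [neg_eq_zero]
  split_ifs <;> simp

/-- the Fourier side equation gives the ODE -/
lemma ode_of_coef {x γ : ℝ → E} (hx : Continuous x) (hp : ∀ t, x (t + 1) = x t)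
    (hγ : Continuous γ) (hγp : ∀ t, γ (t + 1) = γ t)
    (h : ∀ k : ℤ, ((2 * Real.pi * k : ℝ) : ℂ) • coef x k = coef γ k) :
    ∀ t, HasDerivAt x (I • γ t) t := by
  set z : ℝ → E := fun t => ∫ s in (0:ℝ)..t, I • γ s with hz
  have hzd : ∀ t, HasDerivAt z (I • γ t) t := by
    intro t
    have hc : Continuous (fun s => I • γ s) := by fun_prop
    exact intervalIntegral.integral_hasDerivAt_right (hc.intervalIntegrable _ _)
      (hc.stronglyMeasurableAtFilter _ _) hc.continuousAt
  have hzc : Continuous z := continuous_iff_continuousAt.2 fun t => (hzd t).continuousAt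
  have h0 : ∫ s in (0:ℝ)..1, I • γ s = 0 := by
    have := h 0
    simp only [Int.cast_zero, mul_zero, Complex.ofReal_zero, zero_smul, coef, neg_zero, ee_zero,
      one_smul] at this
    rw [intervalIntegral.integral_smul, ← this, smul_zero]
  have hzp : ∀ t, z (t + 1) = z t := by
    intro t
    have hc : Continuous (fun s => I • γ s) := by fun_prop
    have h1 : z (t + 1) - z t = ∫ s in t..(t + 1), I • γ s := by
      simp only [hz]
      rw [intervalIntegral.integral_interval_sub_left] <;> exact hc.intervalIntegrable _ _
    have h2 : Function.Periodic (fun s => I • γ s) 1 := fun s => by simp only [hγp]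
    rw [h2.intervalIntegral_add_eq t 0, zero_add, h0] at h1
    exact sub_eq_zero.1 h1
  have hzk : ∀ k : ℤ, k ≠ 0 → coef z k = coef x k := by
    intro k hk
    have hd : ∀ t, HasDerivAt (fun t => ee (-k) t • z t)
        (ee (-k) t • (I • γ t) + (((2 * Real.pi * (-k : ℤ) : ℝ) : ℂ) * I * ee (-k) t) • z t) t :=
      fun t => (hasDerivAt_ee (-k) t).smul (hzd t)
    have h1 := integral_eq_sub_of_hasDerivAt (a := 0) (b := 1) (fun t _ => hd t)
      (by apply Continuous.intervalIntegrable; fun_prop)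
    have h2 : ee (-k) 1 • z 1 - ee (-k) 0 • z 0 = 0 := by
      have a1 : ee (-k) 1 = ee (-k) 0 := by simpa using ee_add_one (-k) 0
      have a2 : z 1 = z 0 := by simpa using hzp 0
      rw [a1, a2, sub_self]
    rw [h2, intervalIntegral.integral_add (by apply Continuous.intervalIntegrable; fun_prop)
      (by apply Continuous.intervalIntegrable; fun_prop)] at h1
    have h3 : ∀ t, ee (-k) t • (I • γ t) = I • (ee (-k) t • γ t) := fun t => smul_comm _ _ _
    have h4 : ∀ t, (((2 * Real.pi * (-k : ℤ) : ℝ) : ℂ) * I * ee (-k) t) • z t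
      = (((2 * Real.pi * (-k : ℤ) : ℝ) : ℂ) * I) • (ee (-k) t • z t) := fun t => mul_smul _ _ _
    simp_rw [h3, h4] at h1
    rw [intervalIntegral.integral_smul, intervalIntegral.integral_smul] at h1
    change I • coef γ k + (((2 * Real.pi * (-k : ℤ) : ℝ) : ℂ) * I) • coef z k = 0 at h1
    rw [← h k] at h1
    have h5 : (((2 * Real.pi * k : ℝ) : ℂ) * I) • (coef z k - coef x k) = 0 := by
      rw [smul_sub, sub_eq_zero, eq_comm, ← sub_eq_zero, ← h1, smul_smul]
      push_cast
      rw [sub_eq_add_neg, ← neg_smul]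
      congr 2 <;> ring
    have hne : (((2 * Real.pi * k : ℝ) : ℂ) * I) ≠ 0 := by simp [hk, Real.pi_ne_zero]
    exact sub_eq_zero.1 ((smul_eq_zero.1 h5).resolve_left hne)
  set c := coef (fun t => x t - z t) 0 with hc
  have hall := fourier_unique (y := fun t => (x t - z t) - c) (by fun_prop)
    (fun t => by simp only [hp, hzp]) (fun k => by
      rw [coef_sub (x := fun t => x t - z t) (by fun_prop) continuous_const, coef_const]
      by_cases hk : k = 0
      · subst hk; rw [if_pos rfl, hc, sub_self]
      · rw [if_neg hk, coef_sub hx hzc, hzk k hk]; simp)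
  intro t
  have hxz : x = fun t => z t + c := by
    funext t
    have := hall t
    rw [sub_eq_zero] at this
    rw [← this]; abel
  rw [hxz]
  exact (hzd t).add_const c

/-- weights -/
def rho (k : ℤ) : ℝ := 1 / (1 + |(k : ℝ)|) ^ 2

lemma rho_pos (k : ℤ) : 0 < rho k := by unfold rho; positivity

lemma summable_rho : Summable rho := by
  have h1 : Summable (fun k : ℤ => 1 / (k : ℝ) ^ 2) := Real.summable_one_div_int_pow.2 (by norm_num)
  have h2 : Summable (fun k : ℤ => (1 / (k : ℝ) ^ 2) + if k = 0 then 1 else 0) := by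
    refine h1.add ?_
    exact summable_of_ne_finset_zero (s := {0}) (fun k hk => by simp at hk; simp [hk])
  refine Summable.of_nonneg_of_le (fun k => (rho_pos k).le) (fun k => ?_) h2
  unfold rho
  by_cases hk : k = 0
  · subst hk; simp
  · rw [if_neg hk, add_zero]
    have : 0 < |(k : ℝ)| := by simpa using hk
    rw [← sq_abs (k : ℝ)]
    apply one_div_le_one_div_of_le (by positivity)
    gcongr; linarith

lemma amgm {a ε : ℝ} (hε : 0 < ε) (k : ℤ) :
    a ≤ ε * ((1 + |(k : ℝ)|) ^ 2 * a ^ 2) + ε⁻¹ * rho k := by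
  unfold rho
  set m := (1 + |(k : ℝ)|)
  have hm : 0 < m := by positivity
  have : 0 ≤ ε⁻¹ * (1 / m - ε * (m * a)) ^ 2 := by positivity
  have e : ε⁻¹ * (1 / m - ε * (m * a)) ^ 2 = ε * (m ^ 2 * a ^ 2) + ε⁻¹ * (1 / m ^ 2) - 2 * a := by
    field_simp; ring
  have h2 : 0 ≤ ε * (m ^ 2 * a ^ 2) + ε⁻¹ * (1 / m ^ 2) := by positivity
  linarith

lemma sum_bound {a : ℤ → ℝ} {D : ℝ} (ha : ∀ k, 0 ≤ a k)
    (h : ∀ T : Finset ℤ, ∑ k ∈ T, (1 + |(k : ℝ)|) ^ 2 * a k ^ 2 ≤ D) :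
    Summable a ∧ ∑' k, a k ≤ D + ∑' k, rho k := by
  have hb : ∀ T : Finset ℤ, ∑ k ∈ T, a k ≤ D + ∑' k, rho k := by
    intro T
    calc ∑ k ∈ T, a k ≤ ∑ k ∈ T, ((1 + |(k : ℝ)|) ^ 2 * a k ^ 2 + rho k) :=
          Finset.sum_le_sum fun k _ => by simpa using amgm (a := a k) one_pos k
      _ ≤ _ := by
        rw [Finset.sum_add_distrib]
        exact add_le_add (h T) (summable_rho.sum_le_tsum _ fun k _ => (rho_pos k).le)
  exact ⟨summable_of_sum_le ha hb, Real.tsum_le_of_sum_le ha hb⟩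

lemma tsum_tendsto_zero {a : ℕ → ℤ → ℝ} {D : ℝ} (ha : ∀ m k, 0 ≤ a m k)
    (h : ∀ m, ∀ T : Finset ℤ, ∑ k ∈ T, (1 + |(k : ℝ)|) ^ 2 * a m k ^ 2 ≤ D)
    (h0 : ∀ k, Tendsto (fun m => a m k) atTop (𝓝 0)) :
    Tendsto (fun m => ∑' k, a m k) atTop (𝓝 0) := by
  have hD : 0 ≤ D := by simpa using h 0 ∅
  rw [Metric.tendsto_atTop]
  intro δ hδ
  set ε := δ / (2 * (D + 1)) with hε
  have hε0 : 0 < ε := by positivity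
  have hεD : ε * D ≤ δ / 2 := by
    rw [hε, div_mul_eq_mul_div, div_le_div_iff₀ (by positivity) (by positivity)]
    nlinarith
  have hdom : Tendsto (fun m => ∑' k, min (a m k) (ε⁻¹ * rho k)) atTop (𝓝 (∑' _ : ℤ, (0 : ℝ))) := by
    refine tendsto_tsum_of_dominated_convergence (summable_rho.mul_left ε⁻¹) (fun k => ?_)
      (Eventually.of_forall fun m k => ?_)
    · have h1 := (h0 k).min (tendsto_const_nhds (x := ε⁻¹ * rho k))
      rwa [min_eq_left (by have := rho_pos k; positivity)] at h1
    · have := rho_pos k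
      rw [Real.norm_of_nonneg (le_min (ha m k) (by positivity))]
      exact min_le_right _ _
  rw [tsum_zero, Metric.tendsto_atTop] at hdom
  obtain ⟨N, hN⟩ := hdom (δ / 2) (by positivity)
  refine ⟨N, fun m hm => ?_⟩
  have h1 := hN m hm
  rw [Real.dist_eq, sub_zero] at h1 ⊢
  rw [abs_of_nonneg (tsum_nonneg (ha m))]
  have hsmin : Summable (fun k => min (a m k) (ε⁻¹ * rho k)) :=
    Summable.of_nonneg_of_le (fun k => le_min (ha m k) (by have := rho_pos k; positivity))
      (fun k => min_le_right _ _) (summable_rho.mul_left ε⁻¹)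
  have hle : ∑' k, a m k ≤ ε * D + ∑' k, min (a m k) (ε⁻¹ * rho k) := by
    refine Real.tsum_le_of_sum_le (ha m) fun T => ?_
    calc ∑ k ∈ T, a m k ≤ ∑ k ∈ T, (ε * ((1 + |(k : ℝ)|) ^ 2 * a m k ^ 2)
          + min (a m k) (ε⁻¹ * rho k)) := by
          refine Finset.sum_le_sum fun k _ => ?_
          rcases le_total (a m k) (ε⁻¹ * rho k) with hh | hh
          · rw [min_eq_left hh]
            have : 0 ≤ ε * ((1 + |(k : ℝ)|) ^ 2 * a m k ^ 2) := by positivity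
            linarith
          · rw [min_eq_right hh]; exact amgm hε0 k
      _ ≤ _ := by
        rw [Finset.sum_add_distrib, ← Finset.mul_sum]
        refine add_le_add (mul_le_mul_of_nonneg_left (h m T) hε0.le) ?_
        exact hsmin.sum_le_tsum _ fun k _ => le_min (ha m k) (by have := rho_pos k; positivity)
  have := le_abs_self (∑' k, min (a m k) (ε⁻¹ * rho k))
  linarith

end Limit
end HZ

namespace HZ
set_option linter.unusedSectionVars false

section Limit2
open MeasureTheory intervalIntegral Complex Filter Topology
open scoped ComplexConjugate
variable {E : Type*} [NormedAddCommGroup E] [InnerProductSpace ℂ E] [CompleteSpace E]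
variable {F : E → ℝ} {g : E → E} {A B : E →L[ℂ] E} {L C κ b1 : ℝ} {e0 : E}

lemma norm_add_sq_le (x y : E) : ‖x + y‖ ^ 2 ≤ 2 * ‖x‖ ^ 2 + 2 * ‖y‖ ^ 2 := by
  have h := norm_add_le x y
  have h2 : ‖x + y‖ ^ 2 ≤ (‖x‖ + ‖y‖) ^ 2 := by gcongr
  nlinarith [sq_nonneg (‖x‖ - ‖y‖)]

lemma apriori (hG : Good F g A B L C κ b1 e0) {S : Finset ℤ} {X : ℤ → E}
    (hX : ∑ k ∈ S, ‖GG S g X k‖ ^ 2 ≤ 1) :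
    ∑ k ∈ S, (1 + |(k : ℝ)|) ^ 2 * ‖X k‖ ^ 2 ≤ κ ^ 2 * (2 + 2 * C ^ 2) := by
  set r : ℝ → E := fun t => g (ev S X t) - ev S (fun k => (2 : ℂ) • A (X k)) t with hr
  have hgc := hG.gc
  have hc := continuous_ev S X
  have hc2 := continuous_ev S (fun k => (2 : ℂ) • A (X k))
  have hrc : Continuous r := by fun_prop
  have hrn : ∀ t, ‖r t‖ ≤ C := by
    intro t
    have h1 : ev S (fun k => (2 : ℂ) • A (X k)) t = (2 : ℂ) • A (ev S X t) := by
      have := ev_map S X t ((2 : ℂ) • A)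
      simpa using this.symm
    simp only [hr]
    rw [h1]; exact hG.glin _
  have h1 : ∀ k ∈ S, ((2 * Real.pi * k : ℝ) : ℂ) • X k - (2 : ℂ) • A (X k)
      = GG S g X k + coef r k := by
    intro k hk
    have : coef r k = coef (fun t => g (ev S X t)) k - (2 : ℂ) • A (X k) := by
      simp only [hr]
      rw [coef_sub (x := fun t => g (ev S X t)) (by fun_prop) hc2, coef_ev _ hk]
    rw [this, GG]; abel
  have h2 : ∑ k ∈ S, ‖coef r k‖ ^ 2 ≤ C ^ 2 := by
    refine (bessel hrc S).trans ?_
    have : ∫ t in (0:ℝ)..1, ‖r t‖ ^ 2 ≤ ∫ t in (0:ℝ)..1, C ^ 2 := by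
      apply intervalIntegral.integral_mono_on zero_le_one
      · apply Continuous.intervalIntegrable; fun_prop
      · simp
      · intro t _
        have := hrn t
        gcongr
    simpa using this
  calc ∑ k ∈ S, (1 + |(k : ℝ)|) ^ 2 * ‖X k‖ ^ 2
      ≤ ∑ k ∈ S, κ ^ 2 * (2 * ‖GG S g X k‖ ^ 2 + 2 * ‖coef r k‖ ^ 2) := by
        refine Finset.sum_le_sum fun k hk => ?_
        have h3 := hG.nonres k (X k)
        rw [h1 k hk] at h3
        calc (1 + |(k : ℝ)|) ^ 2 * ‖X k‖ ^ 2 = ((1 + |(k : ℝ)|) * ‖X k‖) ^ 2 := by ring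
          _ ≤ (κ * ‖GG S g X k + coef r k‖) ^ 2 := by gcongr
          _ = κ ^ 2 * ‖GG S g X k + coef r k‖ ^ 2 := by ring
          _ ≤ _ := by
            gcongr; exact norm_add_sq_le _ _
    _ ≤ _ := by
      rw [← Finset.mul_sum, Finset.sum_add_distrib, ← Finset.mul_sum, ← Finset.mul_sum]
      gcongr
      linarith

lemma ev_congr {S : Finset ℤ} {X Y : ℤ → E} (h : ∀ k ∈ S, X k = Y k) : ev S X = ev S Y := by
  funext t
  exact Finset.sum_congr rfl fun k hk => by rw [h k hk]

lemma phi_expr (hG : Good F g A B L C κ b1 e0) (S : Finset ℤ) (X : ℤ → E) :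
    Phi S F X = 1 / 2 * ∑ k ∈ S, (inner ℂ (GG S g X k) (X k)).re
      + ∫ t in (0:ℝ)..1, (1 / 2 * (inner ℂ (g (ev S X t)) (ev S X t)).re - F (ev S X t)) := by
  have hgc := hG.gc
  have hFc := hG.Fc
  have hc := continuous_ev S X
  rw [intervalIntegral.integral_sub, intervalIntegral.integral_const_mul,
    re_inner_ev (r := fun t => g (ev S X t)) (by fun_prop)]
  · unfold Phi
    simp_rw [GG, inner_sub_left, Complex.sub_re, Finset.sum_sub_distrib, re_smul_inner, re_inner_self_]
    have : ∑ k ∈ S, 2 * Real.pi * (k : ℝ) * ‖X k‖ ^ 2 = 2 * Real.pi * ∑ k ∈ S, (k : ℝ) * ‖X k‖ ^ 2 := by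
      rw [Finset.mul_sum]; exact Finset.sum_congr rfl fun k _ => by ring
    rw [this]; ring
  · apply Continuous.intervalIntegrable
    exact continuous_const.mul (cont_re_inner (by fun_prop) hc)
  · apply Continuous.intervalIntegrable; fun_prop

lemma dom_conv {G : Type*} [NormedAddCommGroup G] [NormedSpace ℝ G] [ProperSpace E]
    {ψ : ℝ → E → G} (hψ : Continuous (Function.uncurry ψ)) {x : ℕ → ℝ → E} {y : ℝ → E} {M : ℝ}
    (hx : ∀ m, Continuous (x m)) (hM : ∀ m t, ‖x m t‖ ≤ M)
    (hy : ∀ t, Tendsto (fun m => x m t) atTop (𝓝 (y t))) :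
    Tendsto (fun m => ∫ t in (0:ℝ)..1, ψ t (x m t)) atTop (𝓝 (∫ t in (0:ℝ)..1, ψ t (y t))) := by
  obtain ⟨K, hK⟩ := ((isCompact_Icc (a := (0:ℝ)) (b := 1)).prod
    (isCompact_closedBall (0 : E) M)).exists_bound_of_continuousOn hψ.continuousOn
  refine intervalIntegral.tendsto_integral_filter_of_dominated_convergence (fun _ => K)
    (Eventually.of_forall fun m => ?_) (Eventually.of_forall fun m => Eventually.of_forall fun t ht => ?_)
    (by simp) (Eventually.of_forall fun t _ => ?_)
  · exact Continuous.aestronglyMeasurable (hψ.comp (continuous_id.prodMk (hx m)))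
  · rw [uIoc_of_le zero_le_one] at ht
    exact hK (t, x m t) ⟨⟨ht.1.le, ht.2⟩, by simpa using hM m t⟩
  · exact (hψ.tendsto (t, y t)).comp (tendsto_const_nhds.prodMk_nhds (hy t))

theorem exists_orbit [FiniteDimensional ℂ E] (hG : Good F g A B L C κ b1 e0) :
    ∃ x : ℝ → E, (∀ t, HasDerivAt x (I • g (x t)) t) ∧ (∀ t, x (t + 1) = x t) ∧
      0 < ∫ t in (0:ℝ)..1, (1 / 2 * (inner ℂ (g (x t)) (x t)).re - F (x t)) := by
  classical
  have : ProperSpace E := FiniteDimensional.proper ℂ E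
  have hgc := hG.gc
  have hFc := hG.Fc
  obtain ⟨β, hβ, hgal⟩ := galerkin hG
  have hgal2 : ∀ m : ℕ, ∃ X : ℤ → E, β ≤ Phi (SS (m + 1)) F X ∧
      ∑ k ∈ SS (m + 1), ‖GG (SS (m + 1)) g X k‖ ^ 2 ≤ 1 / ((m : ℝ) + 1) ∧
      ∀ k, k ∉ SS (m + 1) → X k = 0 := by
    intro m
    obtain ⟨X, h1, h2⟩ := hgal (m + 1) (by omega) (1 / ((m : ℝ) + 1)) (by positivity)
    set Z : ℤ → E := fun k => if k ∈ SS (m + 1) then X k else 0 with hZ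
    have hZX : ∀ k ∈ SS (m + 1), Z k = X k := fun k hk => by simp only [hZ, if_pos hk]
    have hev := ev_congr hZX
    refine ⟨Z, ?_, ?_, fun k hk => by simp only [hZ, if_neg hk]⟩
    · have : Phi (SS (m + 1)) F Z = Phi (SS (m + 1)) F X := by
        unfold Phi
        rw [hev]
        congr 2
        exact Finset.sum_congr rfl fun k hk => by rw [hZX k hk]
      rw [this]; exact h1
    · refine le_trans (le_of_eq (Finset.sum_congr rfl fun k hk => ?_)) h2
      unfold GG
      rw [hev, hZX k hk]
  choose X hX1 hX2 hX3 using hgal2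
  set D := κ ^ 2 * (2 + 2 * C ^ 2) with hD
  have hXD : ∀ m, ∀ T : Finset ℤ, ∑ k ∈ T, (1 + |(k : ℝ)|) ^ 2 * ‖X m k‖ ^ 2 ≤ D := by
    intro m T
    have h1 := apriori hG ((hX2 m).trans (by
      rw [div_le_one (by positivity)]; linarith [Nat.cast_nonneg (α := ℝ) m]))
    refine le_trans ?_ h1
    calc ∑ k ∈ T, (1 + |(k : ℝ)|) ^ 2 * ‖X m k‖ ^ 2
        ≤ ∑ k ∈ T ∪ SS (m + 1), (1 + |(k : ℝ)|) ^ 2 * ‖X m k‖ ^ 2 :=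
          Finset.sum_le_sum_of_subset_of_nonneg Finset.subset_union_left fun k _ _ => by positivity
      _ = _ := by
          symm
          apply Finset.sum_subset Finset.subset_union_right
          intro k _ hk
          rw [hX3 m k hk]; simp
  have hXk : ∀ m k, ‖X m k‖ ^ 2 ≤ D := by
    intro m k
    have h1 := hXD m {k}
    rw [Finset.sum_singleton] at h1
    refine le_trans ?_ h1
    apply le_mul_of_one_le_left (by positivity)
    apply one_le_pow₀
    linarith [abs_nonneg (k : ℝ)]
  have hD0 : 0 ≤ D := (sq_nonneg _).trans (hXk 0 0)
  -- subsequence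
  obtain ⟨Y, -, φ, hφ, hlim⟩ := (isCompact_univ_pi (fun _ : ℤ => isCompact_closedBall (0 : E) (Real.sqrt D))).tendsto_subseq
    (x := X) (fun m => by
      intro k _
      rw [mem_closedBall_zero_iff]
      exact Real.le_sqrt_of_sq_le (hXk m k))
  have hlimk : ∀ k, Tendsto (fun m => X (φ m) k) atTop (𝓝 (Y k)) := fun k =>
    (tendsto_pi_nhds.1 hlim) k
  have hYD : ∀ T : Finset ℤ, ∑ k ∈ T, (1 + |(k : ℝ)|) ^ 2 * ‖Y k‖ ^ 2 ≤ D := by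
    intro T
    refine le_of_tendsto (tendsto_finsetSum T fun k _ =>
      ((hlimk k).norm.pow 2).const_mul ((1 + |(k : ℝ)|) ^ 2)) (Eventually.of_forall fun m => hXD (φ m) T)
  have hYs := sum_bound (a := fun k => ‖Y k‖) (fun k => norm_nonneg _) hYD
  have hXs := fun m => sum_bound (a := fun k => ‖X (φ m) k‖) (fun k => norm_nonneg _) (hXD (φ m))
  set τ := ∑' k, rho k
  have hAD : ∀ m, ∀ T : Finset ℤ, ∑ k ∈ T, (1 + |(k : ℝ)|) ^ 2 * ‖X (φ m) k - Y k‖ ^ 2 ≤ 4 * D := by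
    intro m T
    calc _ ≤ ∑ k ∈ T, (2 * ((1 + |(k : ℝ)|) ^ 2 * ‖X (φ m) k‖ ^ 2) + 2 * ((1 + |(k : ℝ)|) ^ 2 * ‖Y k‖ ^ 2)) := by
          refine Finset.sum_le_sum fun k _ => ?_
          have h1 := norm_add_sq_le (X (φ m) k) (-Y k)
          rw [← sub_eq_add_neg, norm_neg] at h1
          have h2 := mul_le_mul_of_nonneg_left h1 (sq_nonneg (1 + |(k : ℝ)|))
          linarith
      _ ≤ _ := by
        rw [Finset.sum_add_distrib, ← Finset.mul_sum, ← Finset.mul_sum]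
        have := hXD (φ m) T
        have := hYD T
        linarith
  have hA0 := tsum_tendsto_zero (a := fun m k => ‖X (φ m) k - Y k‖) (fun _ _ => norm_nonneg _) hAD
    (fun k => by
      have := ((hlimk k).sub_const (Y k)).norm
      simpa using this)
  have hAs := fun m => (sum_bound (a := fun k => ‖X (φ m) k - Y k‖) (fun k => norm_nonneg _) (hAD m)).1
  set y : ℝ → E := fun t => ∑' k, ee k t • Y k with hy
  set xm : ℕ → ℝ → E := fun m => ev (SS (φ m + 1)) (X (φ m)) with hxm
  have hne : ∀ (k : ℤ) (t : ℝ) (v : E), ‖ee k t • v‖ = ‖v‖ := fun k t v => by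
    rw [norm_smul, norm_ee, one_mul]
  have hsY : ∀ t, Summable (fun k => ee k t • Y k) := fun t =>
    Summable.of_norm (by simp only [hne]; exact hYs.1)
  have hsX : ∀ m t, Summable (fun k => ee k t • X (φ m) k) := fun m t =>
    Summable.of_norm (by simp only [hne]; exact (hXs m).1)
  have hxmt : ∀ m t, xm m t = ∑' k, ee k t • X (φ m) k := by
    intro m t
    simp only [hxm, ev]
    rw [tsum_eq_sum]
    intro k hk
    rw [hX3 _ _ hk, smul_zero]
  have hdist : ∀ m t, ‖xm m t - y t‖ ≤ ∑' k, ‖X (φ m) k - Y k‖ := by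
    intro m t
    rw [hxmt]
    simp only [hy]
    rw [← (hsX m t).tsum_sub (hsY t)]
    simp_rw [← smul_sub]
    have h1 := norm_tsum_le_tsum_norm (f := fun k => ee k t • (X (φ m) k - Y k))
      (by simp only [hne]; exact hAs m)
    simpa only [hne] using h1
  have hconv : ∀ t, Tendsto (fun m => xm m t) atTop (𝓝 (y t)) := by
    intro t
    rw [tendsto_iff_norm_sub_tendsto_zero]
    exact squeeze_zero (fun _ => norm_nonneg _) (fun m => hdist m t) hA0
  have hxc : ∀ m, Continuous (xm m) := fun m => continuous_ev _ _
  have hxb : ∀ m t, ‖xm m t‖ ≤ D + τ := by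
    intro m t
    rw [hxmt]
    have h1 := norm_tsum_le_tsum_norm (f := fun k => ee k t • X (φ m) k)
      (by simp only [hne]; exact (hXs m).1)
    simp only [hne] at h1
    exact h1.trans (hXs m).2
  have hyc : Continuous y := by
    refine continuous_tsum (fun k => by fun_prop) hYs.1 (fun k t => by rw [hne])
  have hyp : ∀ t, y (t + 1) = y t := fun t => by simp only [hy, ee_add_one]
  have hmem : ∀ k : ℤ, ∀ᶠ m in atTop, k ∈ SS (φ m + 1) := by
    intro k
    filter_upwards [eventually_ge_atTop k.natAbs] with m hm
    have := hφ.id_le m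
    simp only [id] at this
    simp only [SS, Finset.mem_Icc]
    omega
  have hcY : ∀ k, coef y k = Y k := by
    intro k
    have h1 := dom_conv (ψ := fun t w => ee (-k) t • w) (by fun_prop) hxc hxb hconv
    refine tendsto_nhds_unique h1 ((hlimk k).congr' ?_)
    filter_upwards [hmem k] with m hm
    exact (coef_ev (X (φ m)) hm).symm
  have hone : Tendsto (fun m => 1 / ((φ m : ℝ) + 1)) atTop (𝓝 0) :=
    tendsto_one_div_add_atTop_nhds_zero_nat.comp hφ.tendsto_atTop
  have hcg : ∀ k : ℤ, ((2 * Real.pi * k : ℝ) : ℂ) • coef y k = coef (fun t => g (y t)) k := by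
    intro k
    have h1 := dom_conv (ψ := fun t w => ee (-k) t • g w) (by fun_prop) hxc hxb hconv
    have h2 := ((hlimk k).const_smul (((2 * Real.pi * k : ℝ) : ℂ))).sub h1
    have h3 : Tendsto (fun m => GG (SS (φ m + 1)) g (X (φ m)) k) atTop (𝓝 0) := by
      rw [tendsto_zero_iff_norm_tendsto_zero]
      have h4 : Tendsto (fun m => ‖GG (SS (φ m + 1)) g (X (φ m)) k‖ ^ 2) atTop (𝓝 0) := by
        refine squeeze_zero' (Eventually.of_forall fun _ => by positivity) ?_ hone
        filter_upwards [hmem k] with m hm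
        refine le_trans ?_ (hX2 (φ m))
        exact Finset.single_le_sum (f := fun k => ‖GG (SS (φ m + 1)) g (X (φ m)) k‖ ^ 2)
          (fun _ _ => by positivity) hm
      have h5 := h4.sqrt
      simpa [Real.sqrt_sq (norm_nonneg _)] using h5
    have h6 := tendsto_nhds_unique h2 h3
    rw [hcY]
    exact sub_eq_zero.1 h6
  refine ⟨y, ode_of_coef hyc hyp (by fun_prop) (fun t => by simp only [hyp]) hcg, hyp, ?_⟩
  have hact := dom_conv (ψ := fun _ w => 1 / 2 * (inner ℂ (g w) w).re - F w)
    (by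
      refine Continuous.sub (continuous_const.mul (Complex.continuous_re.comp ?_)) (by fun_prop)
      fun_prop) hxc hxb hconv
  have hGX : Tendsto (fun m => 1 / 2 * ∑ k ∈ SS (φ m + 1),
      (inner ℂ (GG (SS (φ m + 1)) g (X (φ m)) k) (X (φ m) k)).re) atTop (𝓝 0) := by
    have hb : Tendsto (fun m => Real.sqrt (1 / ((φ m : ℝ) + 1)) * Real.sqrt D) atTop (𝓝 0) := by
      have := hone.sqrt.mul_const (Real.sqrt D)
      simpa using this
    refine squeeze_zero_norm (fun m => ?_) hb
    set S := SS (φ m + 1)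
    have h1 : |∑ k ∈ S, (inner ℂ (GG S g (X (φ m)) k) (X (φ m) k)).re|
        ≤ ∑ k ∈ S, ‖GG S g (X (φ m)) k‖ * ‖X (φ m) k‖ := by
      refine (Finset.abs_sum_le_sum_abs _ _).trans (Finset.sum_le_sum fun k _ => ?_)
      exact (Complex.abs_re_le_norm _).trans (norm_inner_le_norm _ _)
    have h2 := Finset.sum_mul_sq_le_sq_mul_sq S (fun k => ‖GG S g (X (φ m)) k‖) (fun k => ‖X (φ m) k‖)
    have h3 : ∑ k ∈ S, ‖X (φ m) k‖ ^ 2 ≤ D := by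
      refine le_trans (Finset.sum_le_sum fun k _ => ?_) (hXD (φ m) S)
      apply le_mul_of_one_le_left (by positivity)
      apply one_le_pow₀
      linarith [abs_nonneg (k : ℝ)]
    have h4 : (∑ k ∈ S, ‖GG S g (X (φ m)) k‖ * ‖X (φ m) k‖) ^ 2 ≤ 1 / ((φ m : ℝ) + 1) * D := by
      refine h2.trans ?_
      gcongr
      exact hX2 (φ m)
    have h5 := Real.abs_le_sqrt h4
    rw [Real.sqrt_mul (by positivity)] at h5
    have h6 := (le_abs_self _).trans h5
    rw [Real.norm_eq_abs, abs_mul, abs_of_nonneg (by norm_num : (0:ℝ) ≤ 1 / 2)]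
    have := abs_nonneg (∑ k ∈ S, (inner ℂ (GG S g (X (φ m)) k) (X (φ m) k)).re)
    linarith
  have hsum := hGX.add hact
  rw [zero_add] at hsum
  refine lt_of_lt_of_le hβ (ge_of_tendsto hsum (Eventually.of_forall fun m => ?_))
  have := hX1 (φ m)
  rw [phi_expr hG] at this
  exact this

end Limit2
end HZ

namespace HZ
set_option linter.unusedSectionVars false

section Eta
open MeasureTheory intervalIntegral

lemma exists_eta {a : ℝ} (ha : 0 < a) : ∃ η η' : ℝ → ℝ, ContDiff ℝ 2 η ∧
    (∀ s, HasDerivAt η (η' s) s) ∧ (∀ s, 0 ≤ η s) ∧ (∀ s ≤ 0, η s = 0 ∧ η' s = 0) ∧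
    (∀ s, 0 < s → 0 < η s) ∧ (∃ c, ∀ s, a ≤ s → η s = s - c) ∧ (∀ s, 0 ≤ η' s ∧ η' s ≤ 1) ∧
    (∀ s, s * η' s - η s ≤ a) := by
  set f : ℝ → ℝ := fun s => Real.smoothTransition (s / a) with hf
  have hfs : ContDiff ℝ 2 f := Real.smoothTransition.contDiff.comp (contDiff_id.div_const a)
  have hfc : Continuous f := hfs.continuous
  have hd : ∀ s, HasDerivAt (fun s => ∫ u in (0:ℝ)..s, f u) (f s) s := fun s =>
    integral_hasDerivAt_right (hfc.intervalIntegrable _ _)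
      (hfc.stronglyMeasurableAtFilter _ _) hfc.continuousAt
  have hf0 : ∀ s ≤ 0, f s = 0 := fun s hs =>
    Real.smoothTransition.zero_of_nonpos (div_nonpos_of_nonpos_of_nonneg hs ha.le)
  have hf1 : ∀ s, a ≤ s → f s = 1 := fun s hs =>
    Real.smoothTransition.one_of_one_le (by rwa [le_div_iff₀ ha, one_mul])
  have hfn : ∀ s, 0 ≤ f s := fun s => Real.smoothTransition.nonneg _
  have hfl : ∀ s, f s ≤ 1 := fun s => Real.smoothTransition.le_one _
  have hη0 : ∀ s ≤ 0, (∫ u in (0:ℝ)..s, f u) = 0 := by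
    intro s hs
    rw [integral_symm, neg_eq_zero]
    rw [integral_congr (g := fun _ => (0:ℝ))]
    · simp
    · intro u hu
      rw [uIcc_of_le hs] at hu
      exact hf0 u hu.2
  have hηpos : ∀ s, 0 < s → 0 < ∫ u in (0:ℝ)..s, f u := by
    intro s hs
    refine intervalIntegral_pos_of_pos_on (hfc.intervalIntegrable _ _) ?_ hs
    intro x hx
    exact Real.smoothTransition.pos_of_pos (div_pos hx.1 ha)
  have hηn : ∀ s, 0 ≤ ∫ u in (0:ℝ)..s, f u := by
    intro s
    rcases le_or_gt s 0 with h | h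
    · rw [hη0 s h]
    · exact (hηpos s h).le
  have hηa : ∀ s, a ≤ s → (∫ u in (0:ℝ)..s, f u) = s - (a - ∫ u in (0:ℝ)..a, f u) := by
    intro s hs
    rw [← integral_add_adjacent_intervals (hfc.intervalIntegrable 0 a) (hfc.intervalIntegrable a s)]
    have : (∫ u in a..s, f u) = s - a := by
      rw [integral_congr (g := fun _ => (1:ℝ))]
      · simp
      · intro u hu
        rw [uIcc_of_le hs] at hu
        exact hf1 u hu.1
    rw [this]; ring
  refine ⟨fun s => ∫ u in (0:ℝ)..s, f u, f, ?_, hd, hηn, fun s hs => ⟨hη0 s hs, hf0 s hs⟩, hηpos,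
    ⟨_, hηa⟩, fun s => ⟨hfn s, hfl s⟩, ?_⟩
  · have : (2 : WithTop ℕ∞) = 1 + 1 := by norm_num
    rw [this, contDiff_succ_iff_deriv]
    refine ⟨fun s => (hd s).differentiableAt, by simp, ?_⟩
    have : deriv (fun s => ∫ u in (0:ℝ)..s, f u) = f := by
      ext s; exact (hd s).deriv
    rw [this]
    exact hfs.of_le (by norm_num)
  · intro s
    rcases le_or_gt a s with h | h
    · simp only []
      rw [hηa s h, hf1 s h]
      have := hηn a
      linarith
    · rcases le_or_gt s 0 with h0 | h0
      · simp only []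
        rw [hf0 s h0, hη0 s h0]; linarith
      · have := hηn s
        have := hfl s
        nlinarith
end Eta

section Quad
open Complex
variable {E : Type*} [NormedAddCommGroup E] [InnerProductSpace ℂ E] [CompleteSpace E]

/-- the positive operator with eigenvalue one on `e0` and `lam` on its complement -/
def QQ (lam : ℝ) (e0 : E) : E →L[ℂ] E :=
  (((1 - lam : ℝ) : ℂ) • (innerSL ℂ e0).smulRight e0) + ((lam : ℝ) : ℂ) • ContinuousLinearMap.id ℂ E

lemma QQ_apply (lam : ℝ) (e0 w : E) :
    QQ lam e0 w = ((1 - lam : ℝ) : ℂ) • (inner ℂ e0 w • e0) + ((lam : ℝ) : ℂ) • w := by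
  simp [QQ]

/-- the quadratic form -/
def qq (lam : ℝ) (e0 w : E) : ℝ := (1 - lam) * ‖inner ℂ e0 w‖ ^ 2 + lam * ‖w‖ ^ 2

lemma QQ_inner (lam : ℝ) (e0 w v : E) : (inner ℂ (QQ lam e0 w) v).re
    = (1 - lam) * (inner ℂ w e0 * inner ℂ e0 v).re + lam * (inner ℂ w v).re := by
  rw [QQ_apply, inner_add_left, Complex.add_re, re_smul_inner, re_smul_inner, inner_smul_left,
    inner_conj_symm]

lemma QQ_self (lam : ℝ) (e0 w : E) : (inner ℂ (QQ lam e0 w) w).re = qq lam e0 w := by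
  have h : (inner ℂ w e0 * inner ℂ e0 w).re = ‖inner ℂ w e0 * inner ℂ e0 w‖ :=
    inner_mul_symm_re_eq_norm (𝕜 := ℂ) w e0
  rw [QQ_inner, qq, re_inner_self_, h, norm_mul, norm_inner_symm w e0]; ring

lemma QQ_symm (lam : ℝ) (e0 w v : E) :
    (inner ℂ (QQ lam e0 w) v).re = (inner ℂ (QQ lam e0 v) w).re := by
  rw [QQ_inner, QQ_inner]
  have h1 : (inner ℂ v e0 * inner ℂ e0 w).re = (inner ℂ w e0 * inner ℂ e0 v).re := by
    rw [← inner_conj_symm v e0, ← inner_conj_symm e0 w, ← map_mul, Complex.conj_re, mul_comm]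
  have h2 : (inner ℂ v w).re = (inner ℂ w v).re := by
    rw [← inner_conj_symm v w, Complex.conj_re]
  rw [h1, h2]

lemma qq_add (lam : ℝ) (e0 w v : E) : qq lam e0 (w + v)
    = qq lam e0 w + 2 * (inner ℂ (QQ lam e0 w) v).re + qq lam e0 v := by
  rw [← QQ_self, ← QQ_self, ← QQ_self, map_add, inner_add_left, inner_add_right, inner_add_right]
  simp only [Complex.add_re]
  rw [QQ_symm lam e0 v w]; ring

lemma qq_smul (lam : ℝ) (e0 w : E) (t : ℝ) : qq lam e0 ((t : ℂ) • w) = t ^ 2 * qq lam e0 w := by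
  simp only [qq, inner_smul_right, norm_mul, norm_smul, Complex.norm_real, Real.norm_eq_abs, mul_pow,
    sq_abs]
  ring

lemma qq_low {lam : ℝ} {e0 : E} (h1 : lam ≤ 1) (w : E) : lam * ‖w‖ ^ 2 ≤ qq lam e0 w := by
  have : 0 ≤ (1 - lam) * ‖inner ℂ e0 w‖ ^ 2 := by
    have : 0 ≤ 1 - lam := by linarith
    positivity
  rw [qq]; linarith

lemma qq_up {lam : ℝ} {e0 : E} (h1 : lam ≤ 1) (he : ‖e0‖ = 1) (w : E) : qq lam e0 w ≤ ‖w‖ ^ 2 := by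
  have h : ‖inner ℂ e0 w‖ ^ 2 ≤ ‖w‖ ^ 2 := by
    have := norm_inner_le_norm (𝕜 := ℂ) e0 w
    rw [he, one_mul] at this
    gcongr
  rw [qq]; nlinarith

lemma qq_shift {lam : ℝ} {e0 : E} (h0 : 0 ≤ lam) (h1 : lam ≤ 1) {τ : ℝ} (hτ : 0 < τ) (w p : E) :
    qq lam e0 w ≤ (1 + τ) * qq lam e0 (w + p) + (1 + 1 / τ) * qq lam e0 p := by
  have hn : ∀ v, 0 ≤ qq lam e0 v := fun v => le_trans (by positivity) (qq_low h1 v)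
  have h2 := hn (((τ : ℝ) : ℂ) • (w + p) + p)
  rw [qq_add, qq_smul, map_smul, re_smul_inner] at h2
  have h3 : qq lam e0 w = qq lam e0 (w + p) - 2 * (inner ℂ (QQ lam e0 (w + p)) p).re
      + qq lam e0 p := by
    have h4 := qq_add lam e0 w p
    rw [h4, map_add, inner_add_left, Complex.add_re, QQ_self]; ring
  rw [h3]
  have h5 : 0 ≤ (τ ^ 2 * qq lam e0 (w + p) + 2 * (τ * (inner ℂ (QQ lam e0 (w + p)) p).re) + qq lam e0 p) / τ := by
    positivity
  have h6 : (τ ^ 2 * qq lam e0 (w + p) + 2 * (τ * (inner ℂ (QQ lam e0 (w + p)) p).re) + qq lam e0 p) / τ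
    = τ * qq lam e0 (w + p) + 2 * (inner ℂ (QQ lam e0 (w + p)) p).re + 1 / τ * qq lam e0 p := by
    field_simp
  rw [h6] at h5
  linarith

lemma arith_nonres {β δ : ℝ} (hβ : 0 < β) (hδ : 0 < δ) (h : ∀ k : ℤ, δ ≤ |2 * Real.pi * k - β|) (k : ℤ) :
    (1 + |(k : ℝ)|) ≤ ((1 + β) / δ + 1) * |2 * Real.pi * k - β| := by
  have h1 := h k
  have h2 : |2 * Real.pi * k| ≤ |2 * Real.pi * k - β| + β := by
    have := abs_add_le (2 * Real.pi * k - β) β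
    rwa [sub_add_cancel, abs_of_pos hβ] at this
  rw [abs_mul, abs_of_pos Real.two_pi_pos] at h2
  have h3 : |(k : ℝ)| ≤ 2 * Real.pi * |(k : ℝ)| := by
    nlinarith [abs_nonneg (k : ℝ), Real.pi_gt_three]
  have h4 : 1 + β ≤ (1 + β) / δ * |2 * Real.pi * k - β| := by
    rw [div_mul_eq_mul_div, le_div_iff₀ hδ]
    gcongr
  linarith

lemma gap {β : ℝ} (m : ℤ) {δ : ℝ} (h1 : 2 * Real.pi * m + δ ≤ β)
    (h2 : β ≤ 2 * Real.pi * (m + 1) - δ) (k : ℤ) : δ ≤ |2 * Real.pi * k - β| := by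
  rcases le_or_gt k m with h | h
  · have : (k : ℝ) ≤ m := by exact_mod_cast h
    have : 2 * Real.pi * k ≤ 2 * Real.pi * m := by gcongr
    rw [abs_sub_comm]
    exact le_trans (by linarith) (le_abs_self _)
  · have : (m : ℝ) + 1 ≤ k := by exact_mod_cast h
    have : 2 * Real.pi * (m + 1) ≤ 2 * Real.pi * k := by gcongr
    exact le_trans (by linarith) (le_abs_self _)

lemma QQ_nonres {lam b : ℝ} {e0 : E} (he : ‖e0‖ = 1) (hb : Real.pi < b) (hb2 : b ≤ 3 / 2 * Real.pi)
    (hl : 0 < lam) (hbl : b * lam ≤ Real.pi / 2) : ∃ κ : ℝ, 0 < κ ∧ ∀ (k : ℤ) (w : E),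
    (1 + |(k : ℝ)|) * ‖w‖ ≤
    κ * ‖((2 * Real.pi * k : ℝ) : ℂ) • w - (2 : ℂ) • (((b : ℝ) : ℂ) • QQ lam e0) w‖ := by
  have hpi := Real.pi_pos
  have hb0 : 0 < b := by linarith
  have hbl0 : 0 < b * lam := by positivity
  obtain ⟨κ1, hκ1, H1⟩ : ∃ κ1 : ℝ, 0 < κ1 ∧ ∀ k : ℤ, 1 + |(k : ℝ)| ≤ κ1 * |2 * Real.pi * k - 2 * b| := by
    have hδ : 0 < 2 * (b - Real.pi) := by linarith
    refine ⟨_, ?_, arith_nonres (β := 2 * b) (by linarith) hδ (gap 1 ?_ ?_)⟩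
    · positivity
    · push_cast; linarith
    · push_cast; linarith
  obtain ⟨κ2, hκ2, H2⟩ : ∃ κ2 : ℝ, 0 < κ2 ∧
      ∀ k : ℤ, 1 + |(k : ℝ)| ≤ κ2 * |2 * Real.pi * k - 2 * (b * lam)| := by
    have hδ : 0 < 2 * (b * lam) := by linarith
    refine ⟨_, ?_, arith_nonres (β := 2 * (b * lam)) (by linarith) hδ (gap 0 ?_ ?_)⟩
    · positivity
    · push_cast; linarith
    · push_cast; linarith
  refine ⟨κ1 + κ2, by positivity, fun k w => ?_⟩
  set c0 : ℂ := inner ℂ e0 w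
  set v : E := w - c0 • e0 with hv
  have hee : inner ℂ e0 e0 = (1 : ℂ) := by
    rw [inner_self_eq_norm_sq_to_K, he]; simp
  have hperp : inner ℂ e0 v = 0 := by
    rw [hv, inner_sub_right, inner_smul_right, hee, mul_one, sub_self]
  have hw : w = c0 • e0 + v := by rw [hv]; abel
  set α1 : ℝ := 2 * Real.pi * k - 2 * b
  set α2 : ℝ := 2 * Real.pi * k - 2 * (b * lam)
  have hT : ((2 * Real.pi * k : ℝ) : ℂ) • w - (2 : ℂ) • (((b : ℝ) : ℂ) • QQ lam e0) w
      = ((α1 : ℂ) * c0) • e0 + (α2 : ℂ) • v := by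
    rw [smul_apply, QQ_apply, hv]
    simp only [α1, α2]
    push_cast
    module
  have pyth : ∀ c1 c2 : ℂ, ‖c1 • e0 + c2 • v‖ ^ 2 = ‖c1‖ ^ 2 + ‖c2‖ ^ 2 * ‖v‖ ^ 2 := by
    intro c1 c2
    have : inner ℂ (c1 • e0) (c2 • v) = (0 : ℂ) := by
      rw [inner_smul_left, inner_smul_right, hperp]; simp
    have h := norm_add_sq_eq_norm_sq_add_norm_sq_of_inner_eq_zero (𝕜 := ℂ) (c1 • e0) (c2 • v) this
    rw [norm_smul, norm_smul, he] at h
    nlinarith [h]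
  refine le_of_sq_le_sq ?_ (by positivity)
  rw [mul_pow, mul_pow, hT, pyth]
  have h1 : ‖w‖ ^ 2 = ‖c0‖ ^ 2 + ‖v‖ ^ 2 := by
    have := pyth c0 1
    rw [one_smul, ← hw] at this
    simpa using this
  rw [h1, norm_mul, Complex.norm_real, Complex.norm_real, Real.norm_eq_abs, Real.norm_eq_abs]
  have e1 : (1 + |(k : ℝ)|) ^ 2 ≤ (κ1 + κ2) ^ 2 * |α1| ^ 2 := by
    rw [← mul_pow]
    refine pow_le_pow_left₀ (by positivity) ((H1 k).trans ?_) 2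
    gcongr; linarith
  have e2 : (1 + |(k : ℝ)|) ^ 2 ≤ (κ1 + κ2) ^ 2 * |α2| ^ 2 := by
    rw [← mul_pow]
    refine pow_le_pow_left₀ (by positivity) ((H2 k).trans ?_) 2
    gcongr; linarith
  have e3 := mul_le_mul_of_nonneg_right e1 (sq_nonneg ‖c0‖)
  have e4 := mul_le_mul_of_nonneg_right e2 (sq_nonneg ‖v‖)
  nlinarith [e3, e4]
end Quad
end HZ

namespace HZ
set_option linter.unusedSectionVars false

section Grd
open Complex Filter Topology
variable {E : Type*} [NormedAddCommGroup E] [InnerProductSpace ℂ E] [CompleteSpace E]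

/-- real gradient with respect to the real part of the hermitian product -/
def grd (f : E → ℝ) (w : E) : E :=
  letI := InnerProductSpace.rclikeToReal ℂ E
  (InnerProductSpace.toDual ℝ E).symm (fderiv ℝ f w)

lemma grd_inner (f : E → ℝ) (w v : E) : (inner ℂ (grd f w) v).re = fderiv ℝ f w v := by
  let _ := InnerProductSpace.rclikeToReal ℂ E
  exact InnerProductSpace.toDual_symm_apply (𝕜 := ℝ) (E := E) (x := v) (y := fderiv ℝ f w)

lemma norm_grd (f : E → ℝ) (w : E) : ‖grd f w‖ = ‖fderiv ℝ f w‖ := by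
  let _ := InnerProductSpace.rclikeToReal ℂ E
  exact LinearIsometryEquiv.norm_map _ _

lemma ext_re_inner {u u' : E} (h : ∀ v, (inner ℂ u v).re = (inner ℂ u' v).re) : u = u' := by
  have h1 := h (u - u')
  rw [← sub_eq_zero, ← Complex.sub_re, ← inner_sub_left, re_inner_self_] at h1
  rw [← sub_eq_zero, ← norm_eq_zero]
  exact pow_eq_zero_iff (two_ne_zero) |>.1 h1

lemma grd_eq {f : E → ℝ} {w u : E} (h : ∀ v, (inner ℂ u v).re = fderiv ℝ f w v) : grd f w = u :=
  ext_re_inner fun v => by rw [grd_inner, h]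

lemma grd_cont {f : E → ℝ} (hf : ContDiff ℝ 2 f) : Continuous (grd f) := by
  let _ := InnerProductSpace.rclikeToReal ℂ E
  exact (InnerProductSpace.toDual ℝ E).symm.continuous.comp (hf.continuous_fderiv (by norm_num))

lemma qq_contDiff (lam : ℝ) (e0 : E) {n : WithTop ℕ∞} : ContDiff ℝ n (qq lam e0) := by
  unfold qq
  have h1 : ContDiff ℝ n (fun w : E => inner ℂ e0 w) :=
    ((innerSL ℂ e0).restrictScalars ℝ).contDiff
  have h2 : ContDiff ℝ n (fun w : E => ‖w‖ ^ 2) := contDiff_norm_sq ℂ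
  have h3 : ContDiff ℝ n (fun w : E => ‖inner ℂ e0 w‖ ^ 2) := (contDiff_norm_sq ℂ).comp h1
  exact (contDiff_const.mul h3).add (contDiff_const.mul h2)

lemma qq_fderiv (lam : ℝ) (e0 w v : E) :
    fderiv ℝ (qq lam e0) w v = 2 * (inner ℂ (QQ lam e0 w) v).re := by
  have h1 : HasFDerivAt (qq lam e0) (fderiv ℝ (qq lam e0) w) (w + (0:ℝ) • v) := by
    rw [zero_smul, add_zero]
    exact ((qq_contDiff lam e0 (n := 1)).differentiable (by norm_num) w).hasFDerivAt
  have h2 : HasDerivAt (fun t : ℝ => w + t • v) v 0 := by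
    simpa using ((hasDerivAt_id (0:ℝ)).smul_const v).const_add w
  have h3 := h1.comp_hasDerivAt (0:ℝ) h2
  have h4 : (qq lam e0 ∘ fun t : ℝ => w + t • v) = fun t : ℝ => qq lam e0 w
      + t * (2 * (inner ℂ (QQ lam e0 w) v).re) + t ^ 2 * qq lam e0 v := by
    ext t
    have : t • v = (t : ℂ) • v := (Complex.coe_smul t v).symm
    simp only [Function.comp]
    rw [this, qq_add, re_inner_smul, qq_smul]; ring
  rw [h4] at h3
  have h5 : HasDerivAt (fun t : ℝ => qq lam e0 w
      + t * (2 * (inner ℂ (QQ lam e0 w) v).re) + t ^ 2 * qq lam e0 v)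
      (2 * (inner ℂ (QQ lam e0 w) v).re) 0 := by
    have := (((hasDerivAt_id (0:ℝ)).mul_const (2 * (inner ℂ (QQ lam e0 w) v).re)).const_add
      (qq lam e0 w)).add (((hasDerivAt_id (0:ℝ)).pow 2).mul_const (qq lam e0 v))
    refine (this.congr_deriv ?_)
    simp
  exact h3.unique h5

/-- C² function constant outside a compact set: Lipschitz derivative, quadratic Taylor bound -/
lemma taylor_compact [FiniteDimensional ℂ E] {R : E → ℝ} (hR : ContDiff ℝ 2 R) {K : Set E}
    (hK : IsCompact K) {c0 : ℝ}
    (hc : ∀ w, w ∉ K → R w = c0) : ∃ D : ℝ, 0 ≤ D ∧ (∀ w, |R w| ≤ D) ∧ (∀ w, ‖fderiv ℝ R w‖ ≤ D) ∧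
    ∀ a v, |R (a + v) - R a - fderiv ℝ R a v| ≤ D * ‖v‖ ^ 2 := by
  set S : E → ℝ := fun w => R w - c0 with hS
  have hSc : HasCompactSupport S := by
    refine HasCompactSupport.intro hK fun w hw => ?_
    simp [hS, hc w hw]
  have hdS : ∀ w, fderiv ℝ S w = fderiv ℝ R w := fun w => by
    simp only [hS]; rw [fderiv_sub_const]
  have hS2 : ContDiff ℝ 2 S := hR.sub contDiff_const
  have hd1 : ContDiff ℝ 1 (fderiv ℝ S) := hS2.fderiv_right (by norm_num)
  have hdc : HasCompactSupport (fderiv ℝ S) := hSc.fderiv ℝ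
  obtain ⟨Kl, hKl⟩ := hd1.lipschitzWith_of_hasCompactSupport hdc (by norm_num)
  obtain ⟨D1, hD1⟩ := hdc.exists_bound_of_continuous hd1.continuous
  obtain ⟨D2, hD2⟩ := hSc.exists_bound_of_continuous hS2.continuous
  refine ⟨|D1| + (|D2| + |c0|) + Kl, by positivity, fun w => ?_, fun w => ?_, fun a v => ?_⟩
  · have h1 := hD2 w
    simp only [hS, Real.norm_eq_abs] at h1
    have h2 : |R w| ≤ |R w - c0| + |c0| := by
      have := abs_add_le (R w - c0) c0
      rwa [sub_add_cancel] at this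
    have := le_abs_self D2
    have := abs_nonneg D1
    have := Kl.2
    simp only [NNReal.val_eq_coe] at this
    linarith
  · rw [← hdS]
    have := hD1 w
    have := le_abs_self D1
    have := abs_nonneg D2
    have := abs_nonneg c0
    have := Kl.2
    simp only [NNReal.val_eq_coe] at this
    linarith
  · have h := (convex_closedBall a ‖v‖).norm_image_sub_le_of_norm_fderiv_le' (𝕜 := ℝ) (f := R)
      (C := Kl * ‖v‖) (x := a) (y := a + v) (φ := fderiv ℝ R a)
      (fun x _ => hR.differentiable (by norm_num) x) (fun x hx => by
        rw [← hdS, ← hdS]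
        refine (hKl.norm_sub_le x a).trans ?_
        rw [Metric.mem_closedBall, dist_eq_norm] at hx
        gcongr) (by simp) (by simp)
    rw [add_sub_cancel_left, Real.norm_eq_abs] at h
    refine h.trans ?_
    have : (Kl : ℝ) * ‖v‖ * ‖v‖ = Kl * ‖v‖ ^ 2 := by ring
    rw [this]
    gcongr
    have := abs_nonneg D1
    have := abs_nonneg D2
    have := abs_nonneg c0
    linarith
end Grd
end HZ

namespace HZ
set_option linter.unusedSectionVars false

section OrbQ
open Complex Filter Topology MeasureTheory intervalIntegral
variable {E : Type*} [NormedAddCommGroup E] [InnerProductSpace ℂ E] [CompleteSpace E]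

lemma grd_quad {Fb R : E → ℝ} {b lam : ℝ} {e0 : E} (hF : ∀ w, Fb w = b * qq lam e0 w + R w)
    (hR : ContDiff ℝ 2 R) (w : E) :
    grd Fb w = (2 : ℂ) • (((b : ℝ) : ℂ) • QQ lam e0) w + grd R w := by
  refine grd_eq fun v => ?_
  have h1 : HasFDerivAt (qq lam e0) (fderiv ℝ (qq lam e0) w) w :=
    ((qq_contDiff lam e0 (n := 1)).differentiable (by norm_num) w).hasFDerivAt
  have h2 : HasFDerivAt R (fderiv ℝ R w) w := (hR.differentiable (by norm_num) w).hasFDerivAt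
  have h3 := (h1.const_mul b).add h2
  have h4 : Fb = (fun w => b * qq lam e0 w) + R := by ext w; simp [hF]
  rw [h4, h3.fderiv, inner_add_left, Complex.add_re, grd_inner]
  simp only [add_apply, smul_apply, smul_eq_mul, qq_fderiv]
  have h5 := re_smul_inner 2 ((b : ℂ) • QQ lam e0 w) v
  rw [re_smul_inner b] at h5
  push_cast at h5
  rw [h5]; ring

lemma good_quad [FiniteDimensional ℂ E] {Fb R : E → ℝ} {b lam : ℝ} {e0 p : E}
    (hF : ∀ w, Fb w = b * qq lam e0 w + R w)
    (hR : ContDiff ℝ 2 R) {K : Set E} (hK : IsCompact K) {c0 : ℝ} (hc : ∀ w, w ∉ K → R w = c0)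
    (he : ‖e0‖ = 1) (hb : Real.pi < b) (hb2 : b ≤ 3 / 2 * Real.pi)
    (hl : 0 < lam) (hl1 : lam ≤ 1) (hbl : b * lam ≤ Real.pi / 2) (F0 : ∀ w, 0 ≤ Fb w)
    (hp : ∀ᶠ w in 𝓝 p, Fb w = 0) :
    ∃ A B L C κ b1, Good (fun w => Fb (w + p)) (fun w => grd Fb (w + p)) A B L C κ b1 e0 := by
  have hpi := Real.pi_pos
  obtain ⟨D, hD0, hD1, hD2, hD3⟩ := taylor_compact hR hK hc
  obtain ⟨κ, hκ, hκ2⟩ := QQ_nonres he hb hb2 hl hbl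
  obtain ⟨ρ, hρ, hball⟩ := Metric.eventually_nhds_iff.1 hp
  have hqn : ∀ v, 0 ≤ qq lam e0 v := fun v => le_trans (by positivity) (qq_low hl1 v)
  have hFc : ContDiff ℝ 2 Fb := by
    have : Fb = fun w => b * qq lam e0 w + R w := funext hF
    rw [this]
    exact (contDiff_const.mul (qq_contDiff lam e0)).add hR
  set b' : ℝ := (Real.pi + b) / 2 with hb'
  have hb'1 : Real.pi < b' := by linarith
  have hb'2 : b' < b := by linarith
  have hb'0 : 0 < b' := by linarith
  set τ : ℝ := b / b' - 1 with hτ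
  have hτ0 : 0 < τ := by
    rw [hτ, sub_pos, lt_div_iff₀ hb'0]; linarith
  set A : E →L[ℂ] E := ((b : ℝ) : ℂ) • QQ lam e0
  set C1 : ℝ := 2 * b / ρ ^ 2 + (2 * b * ‖p‖ ^ 2 + D) / ρ ^ 4
  set C2 : ℝ := b' * (1 + 1 / τ) * qq lam e0 p
  set C3 : ℝ := ‖(2 : ℂ) • A p‖
  have hb0 : 0 < b := by linarith
  have hC1 : 0 ≤ C1 := by positivity
  have hC2 : 0 ≤ C2 := by have := hqn p; positivity
  have hC3 : 0 ≤ C3 := norm_nonneg _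
  refine ⟨A, ((b' : ℝ) : ℂ) • QQ lam e0, 2 * D, C1 + (C2 + (C3 + (D + 1))), κ, b' * lam, ?_⟩
  constructor
  · exact hFc.continuous.comp (by fun_prop)
  · exact (grd_cont hFc).comp (by fun_prop)
  · exact fun w => F0 _
  · intro a v
    have h1 := hD3 (a + p) v
    have h2 := neg_abs_le (R (a + p + v) - R (a + p) - fderiv ℝ R (a + p) v)
    have e1 : a + v + p = a + p + v := by abel
    simp only [e1]
    rw [hF, hF, grd_inner, qq_add lam e0 (a + p) v]
    have h4 : fderiv ℝ Fb (a + p) v = 2 * b * (inner ℂ (QQ lam e0 (a + p)) v).re + fderiv ℝ R (a + p) v := by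
      rw [← grd_inner, grd_quad hF hR, inner_add_left, Complex.add_re, grd_inner]
      have h5 := re_smul_inner 2 ((b : ℂ) • QQ lam e0 (a + p)) v
      rw [re_smul_inner b] at h5
      push_cast at h5
      rw [smul_apply, h5]; ring
    rw [h4]
    have := mul_nonneg hb0.le (hqn v)
    nlinarith
  · intro w
    rcases lt_or_ge ‖w‖ ρ with h | h
    · have : Fb (w + p) = 0 := hball (by simpa using h)
      simp only [this]; positivity
    · have h1 : Fb (w + p) ≤ 2 * b * ‖w‖ ^ 2 + (2 * b * ‖p‖ ^ 2 + D) := by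
        rw [hF]
        have h2 := qq_up hl1 he (w + p)
        have h3 := norm_add_sq_le w p
        have h4 := le_abs_self (R (w + p))
        have h5 := hD1 (w + p)
        have : b * qq lam e0 (w + p) ≤ b * (2 * ‖w‖ ^ 2 + 2 * ‖p‖ ^ 2) := by
          gcongr; linarith
        linarith
      have hw2 : ρ ^ 2 ≤ ‖w‖ ^ 2 := by gcongr
      have hw4 : ρ ^ 4 ≤ ‖w‖ ^ 4 := by gcongr
      have h6 : 2 * b * ‖w‖ ^ 2 ≤ 2 * b / ρ ^ 2 * ‖w‖ ^ 4 := by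
        rw [div_mul_eq_mul_div, le_div_iff₀ (by positivity)]
        have : ‖w‖ ^ 4 = ‖w‖ ^ 2 * ‖w‖ ^ 2 := by ring
        rw [this, ← mul_assoc]
        gcongr
      have h7 : 2 * b * ‖p‖ ^ 2 + D ≤ (2 * b * ‖p‖ ^ 2 + D) / ρ ^ 4 * ‖w‖ ^ 4 := by
        rw [div_mul_eq_mul_div, le_div_iff₀ (by positivity)]
        gcongr
      have h8 : C1 * ‖w‖ ^ 4 ≤ (C1 + (C2 + (C3 + (D + 1)))) * ‖w‖ ^ 4 := by
        gcongr; linarith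
      have h9 : C1 * ‖w‖ ^ 4 = 2 * b / ρ ^ 2 * ‖w‖ ^ 4 + (2 * b * ‖p‖ ^ 2 + D) / ρ ^ 4 * ‖w‖ ^ 4 := by
        simp only [C1]; ring
      linarith
  · positivity
  · positivity
  · intro w
    rw [smul_apply, re_smul_inner, QQ_self, hF]
    have h1 := mul_le_mul_of_nonneg_left (qq_shift (e0 := e0) hl.le hl1 hτ0 w p) hb'0.le
    have h2 : b' * (1 + τ) = b := by rw [hτ]; field_simp; ring
    have h3 : b' * ((1 + τ) * qq lam e0 (w + p) + (1 + 1 / τ) * qq lam e0 p)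
        = b * qq lam e0 (w + p) + C2 := by
      rw [← h2]; simp only [C2]; ring
    have h4 := neg_abs_le (R (w + p))
    have h5 := hD1 (w + p)
    linarith
  · intro w
    rw [smul_apply, re_smul_inner, QQ_self, mul_assoc]
    have := qq_low (e0 := e0) hl1 w
    gcongr
  · positivity
  · exact he
  · rw [smul_apply, re_smul_inner, QQ_self, qq, inner_self_eq_norm_sq_to_K, he]
    simpa using hb'1
  · intro w
    have h1 : grd Fb (w + p) - (2 : ℂ) • A w = (2 : ℂ) • A p + grd R (w + p) := by
      rw [grd_quad hF hR, map_add, smul_add]; abel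
    rw [h1]
    have h2 := norm_add_le ((2 : ℂ) • A p) (grd R (w + p))
    rw [norm_grd] at h2
    have := hD2 (w + p)
    linarith
  · exact hκ2
  · exact hκ

theorem orbit_quad [FiniteDimensional ℂ E] {Fb R : E → ℝ} {b lam : ℝ} {e0 p : E}
    (hF : ∀ w, Fb w = b * qq lam e0 w + R w)
    (hR : ContDiff ℝ 2 R) {K : Set E} (hK : IsCompact K) {c0 : ℝ} (hc : ∀ w, w ∉ K → R w = c0)
    (he : ‖e0‖ = 1) (hb : Real.pi < b) (hb2 : b ≤ 3 / 2 * Real.pi)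
    (hl : 0 < lam) (hl1 : lam ≤ 1) (hbl : b * lam ≤ Real.pi / 2) (F0 : ∀ w, 0 ≤ Fb w)
    (hp : ∀ᶠ w in 𝓝 p, Fb w = 0) :
    ∃ z : ℝ → E, (∀ t, HasDerivAt z (I • grd Fb (z t)) t) ∧ (∀ t, z (t + 1) = z t) ∧
      0 < ∫ t in (0:ℝ)..1, (1 / 2 * (inner ℂ (grd Fb (z t)) (z t)).re - Fb (z t)) := by
  obtain ⟨A, B, L, C, κ, b1, hG⟩ := good_quad hF hR hK hc he hb hb2 hl hl1 hbl F0 hp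
  obtain ⟨x, hx1, hx2, hx3⟩ := exists_orbit hG
  have hxc : Continuous x := continuous_iff_continuousAt.2 fun t => (hx1 t).continuousAt
  have hgc : Continuous (fun t => grd Fb (x t + p)) := hG.gc.comp hxc
  refine ⟨fun t => x t + p, fun t => (hx1 t).add_const p, fun t => by simp [hx2], ?_⟩
  have h0 : (∫ t in (0:ℝ)..1, I • grd Fb (x t + p)) = 0 := by
    rw [integral_eq_sub_of_hasDerivAt (f := x) (fun t _ => hx1 t)
      ((hgc.const_smul I).intervalIntegrable _ _)]
    have := hx2 0
    rw [zero_add] at this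
    rw [this, sub_self]
  have h1 : (∫ t in (0:ℝ)..1, grd Fb (x t + p)) = 0 := by
    rw [intervalIntegral.integral_smul] at h0
    exact (smul_eq_zero.1 h0).resolve_left I_ne_zero
  have h2 : (∫ t in (0:ℝ)..1, (inner ℂ (grd Fb (x t + p)) p).re) = 0 := by
    have : ∀ t, (inner ℂ (grd Fb (x t + p)) p).re
        = ((Complex.reCLM.comp ((innerSL ℂ p).restrictScalars ℝ)) (grd Fb (x t + p))) := by
      intro t
      simp only [ContinuousLinearMap.comp_apply, ContinuousLinearMap.coe_restrictScalars',
        innerSL_apply_apply, Complex.reCLM_apply]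
      rw [← inner_conj_symm, Complex.conj_re]
    simp only [this]
    rw [ContinuousLinearMap.intervalIntegral_comp_comm _ (hgc.intervalIntegrable _ _), h1, map_zero]
  have e1 : ∀ t, (1 / 2 * (inner ℂ (grd Fb (x t + p)) (x t + p)).re - Fb (x t + p))
      = (1 / 2 * (inner ℂ (grd Fb (x t + p)) (x t)).re - Fb (x t + p))
        + 1 / 2 * (inner ℂ (grd Fb (x t + p)) p).re := by
    intro t
    rw [inner_add_right, Complex.add_re]; ring
  simp only [e1]
  have hFc : Continuous (fun t => Fb (x t + p)) := hG.Fc.comp hxc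
  have c1 := cont_re_inner hgc hxc
  have c2 := cont_re_inner hgc (continuous_const (y := p))
  have c3 : Continuous (fun t => 1 / 2 * (inner ℂ (grd Fb (x t + p)) (x t)).re - Fb (x t + p)) :=
    (continuous_const.mul c1).sub hFc
  have c4 : Continuous (fun t => 1 / 2 * (inner ℂ (grd Fb (x t + p)) p).re) :=
    continuous_const.mul c2
  rw [intervalIntegral.integral_add (c3.intervalIntegrable _ _) (c4.intervalIntegrable _ _), intervalIntegral.integral_const_mul, h2,
    mul_zero, add_zero]
  exact hx3
end OrbQ
end HZ

namespace HZ
set_option linter.unusedSectionVars false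

section HZthm
open Complex Filter Topology MeasureTheory intervalIntegral
variable {E : Type*} [NormedAddCommGroup E] [InnerProductSpace ℂ E] [CompleteSpace E]

lemma exists_lam {e0 : E} {r2 : ℝ} {K : Set E} (hK : IsCompact K) (hKne : K.Nonempty)
    (hKr : ∀ w ∈ K, ‖inner ℂ e0 w‖ ^ 2 < r2) :
    ∃ lam : ℝ, 0 < lam ∧ lam ≤ 1 / 3 ∧ ∀ w ∈ K, qq lam e0 w < r2 := by
  have c1 : Continuous (fun w : E => ‖inner ℂ e0 w‖ ^ 2) := by fun_prop
  have c2 : Continuous (fun w : E => ‖w‖ ^ 2) := by fun_prop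
  obtain ⟨w0, hw0, hmax⟩ := hK.exists_isMaxOn hKne c1.continuousOn
  obtain ⟨w1, hw1, hmax1⟩ := hK.exists_isMaxOn hKne c2.continuousOn
  have hm := hKr w0 hw0
  set m := ‖inner ℂ e0 w0‖ ^ 2
  set D := ‖w1‖ ^ 2
  have hD : 0 ≤ D := by positivity
  have hr : 0 < r2 - m := by linarith
  refine ⟨min (1 / 3) ((r2 - m) / (2 * (D + 1))), by positivity, min_le_left _ _, fun w hw => ?_⟩
  set lam := min (1 / 3) ((r2 - m) / (2 * (D + 1)))
  have hl0 : 0 < lam := by positivity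
  have hl2 : lam ≤ (r2 - m) / (2 * (D + 1)) := min_le_right _ _
  rw [le_div_iff₀ (by positivity)] at hl2
  have h1 : ‖inner ℂ e0 w‖ ^ 2 ≤ m := hmax hw
  have h2 : ‖w‖ ^ 2 ≤ D := hmax1 hw
  have h3 : 0 ≤ ‖inner ℂ e0 w‖ ^ 2 := by positivity
  rw [qq]
  nlinarith [mul_nonneg hl0.le h3, mul_le_mul_of_nonneg_left h2 hl0.le]

theorem hz [FiniteDimensional ℂ E] {F : E → ℝ} (hF : ContDiff ℝ 2 F) {M r2 : ℝ} {e0 p : E}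
    (he : ‖e0‖ = 1) (hr : 0 < r2)
    (h0 : ∀ w, 0 ≤ F w ∧ F w ≤ M) (hp : ∀ᶠ w in 𝓝 p, F w = 0) {K : Set E} (hK : IsCompact K)
    (hKM : ∀ w, w ∉ K → F w = M) (hKr : ∀ w ∈ K, ‖inner ℂ e0 w‖ ^ 2 < r2)
    (hM : Real.pi * r2 < M) :
    ∃ z : ℝ → E, (∀ t, HasDerivAt z (I • grd F (z t)) t) ∧ (∀ t, z (t + 1) = z t) ∧
      ∃ t, z t ≠ z 0 := by
  have hpi := Real.pi_pos
  have hMpos : 0 < M := lt_trans (by positivity) hM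
  have hpK : p ∈ K := by
    by_contra h
    have h1 := hKM p h
    rw [hp.self_of_nhds] at h1
    linarith
  obtain ⟨lam, hl0, hl3, hlK⟩ := exists_lam hK ⟨p, hpK⟩ hKr
  have hl1 : lam ≤ 1 := by linarith
  set b : ℝ := min (3 / 2 * Real.pi) ((Real.pi + M / r2) / 2) with hbdef
  have hMr : Real.pi < M / r2 := by rwa [lt_div_iff₀ hr]
  have hb1 : Real.pi < b := lt_min (by linarith) (by linarith)
  have hb2 : b ≤ 3 / 2 * Real.pi := min_le_left _ _
  have hb3 : b < M / r2 := lt_of_le_of_lt (min_le_right _ _) (by linarith)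
  have hb0 : 0 < b := by linarith
  have hbr : b * r2 < M := by rwa [lt_div_iff₀ hr] at hb3
  have hbl : b * lam ≤ Real.pi / 2 := by nlinarith
  set a : ℝ := M / b - r2
  have ha : 0 < a := by
    simp only [a]; rw [sub_pos, lt_div_iff₀ hb0]; linarith
  have hab : b * (r2 + a) = M := by simp only [a]; field_simp; ring
  obtain ⟨η, η', hη2, hηd, hηn, hη0, hηp, ⟨c, hηc⟩, hη'1, hηa⟩ := exists_eta ha
  set q : E → ℝ := qq lam e0 with hq
  have hqn : ∀ v, 0 ≤ q v := fun v => le_trans (by positivity) (qq_low hl1 v)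
  set Fb : E → ℝ := fun w => F w + b * η (q w - r2) with hFb
  have hqc : ContDiff ℝ 2 q := qq_contDiff lam e0
  have hFbc : ContDiff ℝ 2 Fb :=
    hF.add (contDiff_const.mul (hη2.comp (hqc.sub contDiff_const)))
  set R : E → ℝ := fun w => Fb w - b * q w with hR
  have hRc : ContDiff ℝ 2 R := hFbc.sub (contDiff_const.mul hqc)
  -- derivative
  have hder : ∀ w v, fderiv ℝ Fb w v = fderiv ℝ F w v
      + b * (η' (q w - r2) * (2 * (inner ℂ (QQ lam e0 w) v).re)) := by
    intro w v
    have h1 : HasFDerivAt q (fderiv ℝ q w) w := (hqc.differentiable (by norm_num) w).hasFDerivAt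
    have h2 : HasFDerivAt F (fderiv ℝ F w) w := (hF.differentiable (by norm_num) w).hasFDerivAt
    have h3 := (hηd (q w - r2)).comp_hasFDerivAt w (h1.sub_const r2)
    have h4 := h2.add (h3.const_mul b)
    have h5 : fderiv ℝ Fb w = _ := h4.fderiv
    rw [h5]
    simp only [add_apply, smul_apply, smul_eq_mul, hq, qq_fderiv]
  have hFb0 : ∀ w, 0 ≤ Fb w := fun w => add_nonneg (h0 w).1 (mul_nonneg hb0.le (hηn _))
  have hFbp : ∀ᶠ w in 𝓝 p, Fb w = 0 := by
    have h1 : ∀ᶠ w in 𝓝 p, q w < r2 :=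
      (hqc.continuous.continuousAt).eventually_lt continuousAt_const (hlK p hpK)
    filter_upwards [hp, h1] with w hw1 hw2
    simp only [hFb]
    rw [hw1, (hη0 _ (by linarith)).1]; ring
  have hK2 : IsCompact (K ∪ {w | q w ≤ r2 + a}) := by
    refine hK.union ?_
    have hfd : ProperSpace E := FiniteDimensional.proper ℂ E
    refine Metric.isCompact_of_isClosed_isBounded
      (isClosed_le hqc.continuous continuous_const) ?_
    refine (Metric.isBounded_closedBall (x := (0:E)) (r := (r2 + a) / lam + 1)).subset ?_
    intro w hw
    have hw' : q w ≤ r2 + a := hw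
    rw [mem_closedBall_zero_iff]
    have h1 := qq_low (e0 := e0) hl1 w
    have h2 : ‖w‖ ^ 2 ≤ (r2 + a) / lam := by
      rw [le_div_iff₀ hl0]; linarith
    nlinarith [sq_nonneg (‖w‖ - 1)]
  have hRconst : ∀ w, w ∉ (K ∪ {w | q w ≤ r2 + a}) → R w = M - b * (r2 + c) := by
    intro w hw
    have h1 : w ∉ K := fun h => hw (Or.inl h)
    have h2 : r2 + a < q w := by
      by_contra h
      exact hw (Or.inr (not_lt.1 h))
    simp only [hR, hFb]
    rw [hKM w h1, hηc _ (by linarith)]; ring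
  obtain ⟨z, hz1, hz2, hz3⟩ := orbit_quad (Fb := Fb) (R := R) (b := b) (lam := lam) (e0 := e0) (p := p)
    (fun w => by simp only [hR, hq]; ring) hRc hK2 hRconst he hb1 hb2 hl0 hl1 hbl hFb0 hFbp
  have hzc : Continuous z := continuous_iff_continuousAt.2 fun t => (hz1 t).continuousAt
  -- conservation
  have hcons : ∀ t, Fb (z t) = Fb (z 0) := by
    have hd : ∀ t, HasDerivAt (fun t => Fb (z t)) 0 t := by
      intro t
      have h1 : HasFDerivAt Fb (fderiv ℝ Fb (z t)) (z t) :=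
        (hFbc.differentiable (by norm_num) _).hasFDerivAt
      have h2 := h1.comp_hasDerivAt t (hz1 t)
      have h3 : fderiv ℝ Fb (z t) (I • grd Fb (z t)) = 0 := by
        rw [← grd_inner, inner_smul_right, inner_self_eq_norm_sq_to_K]
        simp [← Complex.ofReal_pow]
      rw [h3] at h2
      exact h2
    intro t
    exact is_const_of_deriv_eq_zero (fun t => (hd t).differentiableAt) (fun t => (hd t).deriv) t 0
  rcases le_or_gt (Fb (z 0)) M with hle | hgt
  · -- low level : an orbit of F
    have hgr : ∀ t, grd Fb (z t) = grd F (z t) := by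
      intro t
      have hq2 : q (z t) ≤ r2 := by
        by_contra h
        push Not at h
        have h1 : z t ∉ K := fun hk => by linarith [hlK _ hk]
        have h2 := hcons t
        simp only [hFb] at h2 hle
        rw [hKM _ h1] at h2
        have := mul_pos hb0 (hηp (q (z t) - r2) (by linarith))
        linarith
      refine grd_eq fun v => ?_
      rw [hder, (hη0 _ (by linarith : q (z t) - r2 ≤ 0)).2, grd_inner]; ring
    refine ⟨z, fun t => by rw [← hgr]; exact hz1 t, hz2, ?_⟩
    by_contra hne
    push Not at hne
    have hzz : z = fun _ => z 0 := funext hne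
    have hg0 : ∀ t, grd Fb (z t) = 0 := by
      intro t
      have h1 := hz1 t
      rw [hzz] at h1
      have h2 := h1.unique (hasDerivAt_const t (z 0))
      have h3 := (smul_eq_zero.1 h2).resolve_left I_ne_zero
      rw [hne t]; exact h3
    have : (∫ t in (0:ℝ)..1, (1 / 2 * (inner ℂ (grd Fb (z t)) (z t)).re - Fb (z t))) = - Fb (z 0) := by
      simp only [hg0, inner_zero_left, hcons]
      simp
    rw [this] at hz3
    linarith [hFb0 (z 0)]
  · exfalso
    have hneg : ∀ t, (1 / 2 * (inner ℂ (grd Fb (z t)) (z t)).re - Fb (z t)) ≤ 0 := by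
      intro t
      have h1 : Fb (z t) > M := by rw [hcons]; exact hgt
      have h2 : 0 < q (z t) - r2 := by
        by_contra h
        push Not at h
        simp only [hFb] at h1
        rw [(hη0 _ h).1] at h1
        linarith [(h0 (z t)).2]
      have h3 : z t ∉ K := fun hk => by linarith [hlK _ hk]
      have h4 : fderiv ℝ F (z t) = 0 := by
        have h5 : F =ᶠ[𝓝 (z t)] fun _ => M := by
          filter_upwards [hK.isClosed.isOpen_compl.mem_nhds h3] with w hw
          exact hKM w hw
        rw [h5.fderiv_eq]; simp
      rw [grd_inner, hder, h4, QQ_self]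
      simp only [hFb]
      rw [hKM _ h3]
      have h6 := hηa (q (z t) - r2)
      have h7 := (hη'1 (q (z t) - r2)).2
      have h8 := (hη'1 (q (z t) - r2)).1
      have h9 : b * (η' (q (z t) - r2) * q (z t) - η (q (z t) - r2)) ≤ b * (r2 + a) := by
        refine mul_le_mul_of_nonneg_left ?_ hb0.le
        nlinarith
      have h10 : qq lam e0 (z t) = q (z t) := rfl
      rw [h10, ContinuousLinearMap.zero_apply]
      linarith
    have := integral_nonneg (μ := volume) (a := (0:ℝ)) (b := 1) zero_le_one
      (f := fun t => -(1 / 2 * (inner ℂ (grd Fb (z t)) (z t)).re - Fb (z t)))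
      (fun t _ => by linarith [hneg t])
    rw [intervalIntegral.integral_neg] at this
    linarith
end HZthm
end HZ

namespace HZ
set_option linter.unusedSectionVars false

section Iface
open Complex Filter Topology
open scoped ComplexConjugate

lemma hz_abs {E : Type*} [NormedAddCommGroup E] [InnerProductSpace ℂ E] [CompleteSpace E]
    [FiniteDimensional ℂ E] {d : ℕ} (P : Option (Fin d) → E →L[ℂ] ℂ)
    (hP : ∀ u v : E, inner ℂ u v = ∑ o, conj (P o u) * P o v)
    (G : (Option (Fin d) → ℂ) → E) (hG : Continuous G) (hPG : ∀ f o, P o (G f) = f o)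
    {F : Phase d × ℂ → ℝ} (hF : ContDiff ℝ 2 F) {M r2 : ℝ} (hr : 0 < r2)
    (h0 : ∀ w, 0 ≤ F w ∧ F w ≤ M) {p : Phase d × ℂ} (hp : ∀ᶠ w in 𝓝 p, F w = 0)
    {K : Set (Phase d × ℂ)} (hK : IsCompact K)
    (hKM : ∀ w, w ∉ K → F w = M) (hKr : ∀ w ∈ K, ‖w.2‖ ^ 2 < r2)
    (hM : Real.pi * r2 < M) :
    ∃ (x x' : ℝ → Phase d) (ζ ζ' : ℝ → ℂ), (∀ t, HasDerivAt x (x' t) t) ∧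
      (∀ t, HasDerivAt ζ (ζ' t) t) ∧ (∀ t, x (t + 1) = x t) ∧ (∀ t, ζ (t + 1) = ζ t) ∧
      (∃ t, x t ≠ x 0 ∨ ζ t ≠ ζ 0) ∧
      ∀ t v η, fderiv ℝ F (x t, ζ t) (v, η) = omega0 (x' t) v + (conj (-I * ζ' t) * η).re := by
  have hPinj : ∀ u v : E, (∀ o, P o u = P o v) → u = v := by
    intro u v h
    have h1 : inner ℂ (u - v) (u - v) = (0 : ℂ) := by
      rw [hP]; refine Finset.sum_eq_zero fun o _ => ?_
      rw [map_sub, h o]; simp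
    exact sub_eq_zero.1 (inner_self_eq_zero.1 h1)
  set Pr : Option (Fin d) → E →L[ℝ] ℂ := fun o => (P o).restrictScalars ℝ with hPr
  set Ψ : E →L[ℝ] Phase d × ℂ :=
    ((ContinuousLinearMap.pi fun i => Complex.imCLM.comp (Pr (some i))).prod
      (ContinuousLinearMap.pi fun i => Complex.reCLM.comp (Pr (some i)))).prod (Pr none) with hΨ
  have hΨ1 : ∀ w i, (Ψ w).1.1 i = (P (some i) w).im := fun w i => rfl
  have hΨ2 : ∀ w i, (Ψ w).1.2 i = (P (some i) w).re := fun w i => rfl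
  have hΨ3 : ∀ w, (Ψ w).2 = P none w := fun w => rfl
  set Θ : Phase d × ℂ → E := fun y => G (fun o => o.elim y.2 (fun i => (y.1.2 i : ℂ) + (y.1.1 i : ℂ) * I))
  have hΘc : Continuous Θ := by
    refine hG.comp (continuous_pi fun o => ?_)
    cases o with
    | none => exact continuous_snd
    | some i => simp only [Option.elim]; fun_prop
  have hΨΘ : ∀ y, Ψ (Θ y) = y := by
    intro y
    refine Prod.ext (Prod.ext (funext fun i => ?_) (funext fun i => ?_)) ?_
    · rw [hΨ1, hPG]; simp
    · rw [hΨ2, hPG]; simp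
    · rw [hΨ3, hPG]; simp
  have hΨinj : ∀ u v, Ψ u = Ψ v → u = v := by
    intro u v h
    refine hPinj u v fun o => ?_
    cases o with
    | none => rw [← hΨ3, ← hΨ3, h]
    | some i =>
      refine Complex.ext ?_ ?_
      · rw [← hΨ2, ← hΨ2, h]
      · rw [← hΨ1, ← hΨ1, h]
  have hΘΨ : ∀ w, Θ (Ψ w) = w := fun w => hΨinj _ _ (hΨΘ _)
  set e0 : E := G (Pi.single none 1)
  have he0 : ∀ w, inner ℂ e0 w = P none w := by
    intro w
    rw [hP, Finset.sum_eq_single none]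
    · rw [hPG]; simp
    · intro o _ ho
      rw [hPG, Pi.single_eq_of_ne ho]; simp
    · simp
  have hen : ‖e0‖ = 1 := by
    have h1 := re_inner_self_ e0
    rw [he0, hPG] at h1
    simp at h1
    nlinarith [norm_nonneg e0]
  obtain ⟨z, hz1, hz2, t1, ht1⟩ := hz (F := fun w => F (Ψ w)) (e0 := e0) (p := Θ p) (K := Θ '' K)
    (M := M) (r2 := r2) (hF.comp Ψ.contDiff) hen hr (fun w => h0 _) (by
      have : Tendsto Ψ (𝓝 (Θ p)) (𝓝 p) := by
        have := Ψ.continuous.tendsto (Θ p)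
        rwa [hΨΘ] at this
      exact this.eventually hp) (hK.image hΘc) (fun w hw => hKM _ fun h => hw ⟨_, h, hΘΨ w⟩)
      (by
        rintro _ ⟨y, hy, rfl⟩
        rw [he0, ← hΨ3, hΨΘ]; exact hKr y hy) hM
  set z' : ℝ → E := fun t => I • grd (fun w => F (Ψ w)) (z t) with hz'
  have hd : ∀ t, HasDerivAt (fun t => Ψ (z t)) (Ψ (z' t)) t := fun t =>
    Ψ.hasFDerivAt.comp_hasDerivAt t (hz1 t)
  refine ⟨fun t => (Ψ (z t)).1, fun t => (Ψ (z' t)).1, fun t => (Ψ (z t)).2, fun t => (Ψ (z' t)).2,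
    fun t => (hd t).fst, fun t => (hd t).snd,
    fun t => by simp only [hz2], fun t => by simp only [hz2], ⟨t1, ?_⟩, fun t v η => ?_⟩
  · by_contra h
    push Not at h
    exact ht1 (hΨinj _ _ (Prod.ext h.1 h.2))
  · have h1 : fderiv ℝ (fun w => F (Ψ w)) (z t) (Θ (v, η)) = fderiv ℝ F (Ψ (z t)) (v, η) := by
      have h2 : HasFDerivAt F (fderiv ℝ F (Ψ (z t))) (Ψ (z t)) :=
        (hF.differentiable (by norm_num) _).hasFDerivAt
      have h3 : HasFDerivAt (fun w => F (Ψ w)) _ (z t) := h2.comp (z t) Ψ.hasFDerivAt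
      rw [h3.fderiv, ContinuousLinearMap.comp_apply, hΨΘ]
    have h4 : grd (fun w => F (Ψ w)) (z t) = (-I) • z' t := by
      simp only [hz']
      rw [smul_smul]; simp
    have h5 : fderiv ℝ F (Ψ (z t)) (v, η) = (inner ℂ ((-I) • z' t) (Θ (v, η))).re := by
      rw [← h4, grd_inner, h1]
    change fderiv ℝ F (Ψ (z t)) (v, η) = _
    rw [h5, hP, Fintype.sum_option, Complex.add_re, add_comm, Complex.re_sum, omega0]
    congr 1
    · refine Finset.sum_congr rfl fun i _ => ?_
      rw [hΨ1, hΨ2, hPG, map_smul]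
      simp
    · simp only []
      rw [hΨ3, hPG, map_smul]; simp

theorem hz_phase {d : ℕ}
    {F : Phase d × ℂ → ℝ} (hF : ContDiff ℝ 2 F) {M r2 : ℝ} (hr : 0 < r2)
    (h0 : ∀ w, 0 ≤ F w ∧ F w ≤ M) {p : Phase d × ℂ} (hp : ∀ᶠ w in 𝓝 p, F w = 0)
    {K : Set (Phase d × ℂ)} (hK : IsCompact K)
    (hKM : ∀ w, w ∉ K → F w = M) (hKr : ∀ w ∈ K, ‖w.2‖ ^ 2 < r2)
    (hM : Real.pi * r2 < M) :
    ∃ (x x' : ℝ → Phase d) (ζ ζ' : ℝ → ℂ), (∀ t, HasDerivAt x (x' t) t) ∧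
      (∀ t, HasDerivAt ζ (ζ' t) t) ∧ (∀ t, x (t + 1) = x t) ∧ (∀ t, ζ (t + 1) = ζ t) ∧
      (∃ t, x t ≠ x 0 ∨ ζ t ≠ ζ 0) ∧
      ∀ t v η, fderiv ℝ F (x t, ζ t) (v, η) = omega0 (x' t) v + (conj (-I * ζ' t) * η).re := by
  refine hz_abs (E := EuclideanSpace ℂ (Option (Fin d))) (fun o => EuclideanSpace.proj o) ?_
    (fun f => WithLp.toLp 2 f) (PiLp.continuous_toLp 2 _) ?_ hF hr h0 hp hK hKM hKr hM
  · intro u v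
    rw [PiLp.inner_apply]
    refine Finset.sum_congr rfl fun o _ => ?_
    simp [mul_comm]
  · intro f o
    simp
end Iface
end HZ

namespace HZ
set_option linter.unusedSectionVars false

section Omega
open Filter Topology
variable {d : ℕ}

lemma two_le_top : (2 : WithTop ℕ∞) ≤ ((⊤ : ℕ∞) : WithTop ℕ∞) := by
  have : ((2 : ℕ∞) : WithTop ℕ∞) ≤ ((⊤ : ℕ∞) : WithTop ℕ∞) := WithTop.coe_le_coe.2 le_top
  exact this

lemma omega0_sub_left (u u' v : Phase d) : omega0 (u - u') v = omega0 u v - omega0 u' v := by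
  simp only [omega0, ← Finset.sum_sub_distrib]
  refine Finset.sum_congr rfl fun i _ => ?_
  simp; ring

lemma omega0_add_left (u u' v : Phase d) : omega0 (u + u') v = omega0 u v + omega0 u' v := by
  simp only [omega0, ← Finset.sum_add_distrib]
  refine Finset.sum_congr rfl fun i _ => ?_
  simp; ring

lemma omega0_smul_left (c : ℝ) (u v : Phase d) : omega0 (c • u) v = c * omega0 u v := by
  simp only [omega0, Finset.mul_sum]
  refine Finset.sum_congr rfl fun i _ => ?_
  simp; ring

lemma omega0_symm (u v : Phase d) : omega0 u v = - omega0 v u := by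
  simp only [omega0, ← Finset.sum_neg_distrib]
  refine Finset.sum_congr rfl fun i _ => ?_
  ring

lemma omega0_self (u : Phase d) : omega0 u u = 0 := by
  have := omega0_symm u u
  linarith

lemma omega0_nondeg {u : Phase d} (h : ∀ v, omega0 u v = 0) : u = 0 := by
  refine Prod.ext (funext fun i => ?_) (funext fun i => ?_)
  · have := h (0, Pi.single i 1)
    simpa [omega0, Pi.single_apply] using this
  · have := h (Pi.single i 1, 0)
    simpa [omega0, Pi.single_apply] using this

lemma omega0_hamVF (H : Phase d → ℝ) (x v : Phase d) : omega0 (hamVF H x) v = fderiv ℝ H x v := by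
  have hv : v = ∑ i, (v.2 i • ((0, Pi.single i 1) : Phase d) + v.1 i • ((Pi.single i 1, 0) : Phase d)) := by
    refine Prod.ext (funext fun j => ?_) (funext fun j => ?_)
    · simp [Prod.fst_sum, Finset.sum_apply, Pi.single_apply]
    · simp [Prod.snd_sum, Finset.sum_apply, Pi.single_apply]
  conv_rhs => rw [hv]
  rw [map_sum, omega0]
  refine Finset.sum_congr rfl fun i _ => ?_
  rw [map_add, map_smul, map_smul]
  simp [hamVF]; ring

lemma omega0_hasDerivAt {a b : ℝ → Phase d} {a' b' : Phase d} {t : ℝ} (ha : HasDerivAt a a' t)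
    (hb : HasDerivAt b b' t) :
    HasDerivAt (fun s => omega0 (a s) (b s)) (omega0 a' (b t) + omega0 (a t) b') t := by
  have ha1 := hasDerivAt_pi.1 ha.fst
  have ha2 := hasDerivAt_pi.1 ha.snd
  have hb1 := hasDerivAt_pi.1 hb.fst
  have hb2 := hasDerivAt_pi.1 hb.snd
  have h := HasDerivAt.fun_sum (u := Finset.univ) (fun i _ =>
    ((ha1 i).mul (hb2 i)).sub ((ha2 i).mul (hb1 i)))
  refine h.congr_deriv ?_
  rw [omega0, omega0, ← Finset.sum_add_distrib]
  refine Finset.sum_congr rfl fun i _ => ?_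
  ring

variable {N : Set (Phase d)} {H₁ : Phase d → ℝ} {φ : ℝ → Phase d → Phase d}

lemma hamVF_differentiableAt {H : Phase d → ℝ} {y : Phase d} (h : ContDiffAt ℝ 2 H y) :
    DifferentiableAt ℝ (hamVF H) y := by
  have h1 : DifferentiableAt ℝ (fderiv ℝ H) y :=
    (h.fderiv_right (m := 1) (by norm_num)).differentiableAt (by norm_num)
  unfold hamVF
  refine DifferentiableAt.prodMk (differentiableAt_pi.2 fun i => ?_) (differentiableAt_pi.2 fun i => ?_)
  · exact h1.clm_apply (differentiableAt_const _)
  · exact (h1.clm_apply (differentiableAt_const _)).neg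

lemma omega0_fderiv_hamVF {H : Phase d → ℝ} {y : Phase d} (h : ContDiffAt ℝ 2 H y) (u v : Phase d) :
    omega0 (fderiv ℝ (hamVF H) y u) v = fderiv ℝ (fderiv ℝ H) y u v := by
  have h1 : DifferentiableAt ℝ (fderiv ℝ H) y :=
    (h.fderiv_right (m := 1) (by norm_num)).differentiableAt (by norm_num)
  have h2 := hamVF_differentiableAt h
  have hl : HasDerivAt (fun t : ℝ => y + t • u) u 0 := by
    simpa using ((hasDerivAt_id (0:ℝ)).smul_const u).const_add y
  have e0 : y + (0:ℝ) • u = y := by simp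
  have h3 : HasDerivAt (fun t : ℝ => hamVF H (y + t • u)) (fderiv ℝ (hamVF H) y u) 0 := by
    have h : HasFDerivAt (hamVF H) (fderiv ℝ (hamVF H) y) (y + (0:ℝ) • u) := by
      rw [e0]; exact h2.hasFDerivAt
    exact h.comp_hasDerivAt (0:ℝ) hl
  have h4 : HasDerivAt (fun t : ℝ => fderiv ℝ H (y + t • u)) (fderiv ℝ (fderiv ℝ H) y u) 0 := by
    have h : HasFDerivAt (fderiv ℝ H) (fderiv ℝ (fderiv ℝ H) y) (y + (0:ℝ) • u) := by
      rw [e0]; exact h1.hasFDerivAt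
    exact h.comp_hasDerivAt (0:ℝ) hl
  have h5 := omega0_hasDerivAt h3 (hasDerivAt_const (0:ℝ) v)
  have h6 := h4.clm_apply (hasDerivAt_const (0:ℝ) v)
  simp only [omega0_hamVF] at h5
  have h7 := h5.unique h6
  simp only [map_zero, add_zero] at h7
  exact h7

lemma phi_contDiffAt (hN : IsOpen N) (hφ : FreeHamCircleAction N H₁ φ) {x : Phase d} (hx : x ∈ N) (s : ℝ)
    {n : ℕ} :
    ContDiffAt ℝ n (fun p : ℝ × Phase d => φ p.1 p.2) (s, x) := by
  have h := hφ.1.contDiffAt ((isOpen_univ.prod hN).mem_nhds (⟨mem_univ s, hx⟩ : (s, x) ∈ univ ×ˢ N))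
  exact h.of_le (by exact_mod_cast le_top)

/-- space derivative of the flow -/
def Dp (φ : ℝ → Phase d → Phase d) (s : ℝ) (x : Phase d) : Phase d →L[ℝ] Phase d :=
  (fderiv ℝ (fun p : ℝ × Phase d => φ p.1 p.2) (s, x)).comp (ContinuousLinearMap.inr ℝ ℝ (Phase d))

lemma Dp_apply (s : ℝ) (x v : Phase d) : Dp φ s x v = fderiv ℝ (fun p : ℝ × Phase d => φ p.1 p.2) (s, x) (0, v) :=
  rfl

lemma phi_hasFDerivAt (hN : IsOpen N) (hφ : FreeHamCircleAction N H₁ φ) {x : Phase d} (hx : x ∈ N) (s : ℝ) :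
    HasFDerivAt (fun p : ℝ × Phase d => φ p.1 p.2) (fderiv ℝ (fun p : ℝ × Phase d => φ p.1 p.2) (s, x)) (s, x) :=
  ((phi_contDiffAt hN hφ hx s (n := 1)).differentiableAt (by norm_num)).hasFDerivAt

lemma fderiv_phi (hN : IsOpen N) (hφ : FreeHamCircleAction N H₁ φ) {x : Phase d} (hx : x ∈ N) (s σ : ℝ)
    (v : Phase d) : fderiv ℝ (fun p : ℝ × Phase d => φ p.1 p.2) (s, x) (σ, v)
      = σ • hamVF H₁ (φ s x) + Dp φ s x v := by
  have h1 : fderiv ℝ (fun p : ℝ × Phase d => φ p.1 p.2) (s, x) (1, 0) = hamVF H₁ (φ s x) := by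
    have h2 : HasDerivAt (fun τ : ℝ => (τ, x)) ((1 : ℝ), (0 : Phase d)) s :=
      (hasDerivAt_id s).prodMk (hasDerivAt_const s x)
    have h3 := (phi_hasFDerivAt hN hφ hx s).comp_hasDerivAt s h2
    exact h3.unique (hφ.2.2.2.2.2.1 s x hx)
  have h4 : ((σ, v) : ℝ × Phase d) = σ • ((1, 0) : ℝ × Phase d) + (0, v) := by simp
  rw [h4, map_add, map_smul, h1, Dp_apply]

/-- derivative of the flow along a curve -/
lemma phi_curve (hN : IsOpen N) (hφ : FreeHamCircleAction N H₁ φ) {σ : ℝ → ℝ} {x : ℝ → Phase d} {σ' : ℝ}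
    {x' : Phase d} {t : ℝ} (hx : x t ∈ N) (hσ : HasDerivAt σ σ' t) (hxd : HasDerivAt x x' t) :
    HasDerivAt (fun τ => φ (σ τ) (x τ)) (σ' • hamVF H₁ (φ (σ t) (x t)) + Dp φ (σ t) (x t) x') t := by
  rw [← fderiv_phi hN hφ hx]
  exact HasFDerivAt.comp_hasDerivAt (f := fun τ => (σ τ, x τ)) t (phi_hasFDerivAt hN hφ hx (σ t)) (hσ.prodMk hxd)

lemma H1_inv (hN : IsOpen N) (hH₁ : ContDiffOn ℝ (⊤ : ℕ∞) H₁ N) (hφ : FreeHamCircleAction N H₁ φ)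
    {x : Phase d} (hx : x ∈ N) (s : ℝ) : H₁ (φ s x) = H₁ x := by
  have hd : ∀ t, HasDerivAt (fun t => H₁ (φ t x)) 0 t := by
    intro t
    have hmem := hφ.2.1 t x hx
    have h1 : HasFDerivAt H₁ (fderiv ℝ H₁ (φ t x)) (φ t x) :=
      ((hH₁.contDiffAt (hN.mem_nhds hmem)).differentiableAt (by simp)).hasFDerivAt
    have h2 := h1.comp_hasDerivAt t (hφ.2.2.2.2.2.1 t x hx)
    rw [← omega0_hamVF, omega0_self] at h2
    exact h2
  have := is_const_of_deriv_eq_zero (fun t => (hd t).differentiableAt) (fun t => (hd t).deriv) s 0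
  simp only [hφ.2.2.1 x hx] at this
  exact this

/-- the flow preserves its generator -/
lemma Dp_hamVF (hN : IsOpen N) (hφ : FreeHamCircleAction N H₁ φ) {x : Phase d} (hx : x ∈ N) (s : ℝ) :
    Dp φ s x (hamVF H₁ x) = hamVF H₁ (φ s x) := by
  have h0 : φ 0 x = x := hφ.2.2.1 x hx
  have h1 : HasDerivAt (fun τ => φ τ x) (hamVF H₁ x) 0 := by
    have := hφ.2.2.2.2.2.1 0 x hx
    rwa [h0] at this
  have h2 := phi_curve (σ := fun _ => s) hN hφ (by rw [h0]; exact hx) (hasDerivAt_const (0:ℝ) s) h1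
  simp only [h0, zero_smul, zero_add] at h2
  have h3 : (fun τ => φ s (φ τ x)) = fun τ => φ (s + τ) x := by
    ext1 τ; exact hφ.2.2.2.1 s τ x hx
  rw [h3] at h2
  have h4 : HasDerivAt (fun τ => φ (s + τ) x) (hamVF H₁ (φ s x)) 0 := by
    have h5 := hφ.2.2.2.2.2.1 (s + 0) x hx
    have h6 := h5.comp_const_add s 0
    rwa [add_zero] at h6
  exact h2.unique h4

lemma Dp_surj (hN : IsOpen N) (hφ : FreeHamCircleAction N H₁ φ) {x : Phase d} (hx : x ∈ N) (s : ℝ)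
    (v : Phase d) : ∃ u, Dp φ s x u = v := by
  have hy : φ s x ∈ N := hφ.2.1 s x hx
  have e1 : φ (-s) (φ s x) = x := by
    rw [hφ.2.2.2.1 (-s) s x hx, neg_add_cancel, hφ.2.2.1 x hx]
  have hl : HasDerivAt (fun t : ℝ => φ s x + t • v) v 0 := by
    simpa using ((hasDerivAt_id (0:ℝ)).smul_const v).const_add (φ s x)
  have e0 : φ s x + (0:ℝ) • v = φ s x := by simp
  have h1 := phi_curve (σ := fun _ => -s) hN hφ (by rw [e0]; exact hy) (hasDerivAt_const (0:ℝ) (-s)) hl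
  have h2 := phi_curve (σ := fun _ => s) hN hφ (by simp only [e0, e1]; exact hx) (hasDerivAt_const (0:ℝ) s) h1
  simp only [zero_smul, add_zero, zero_add, e1] at h2
  refine ⟨_, h2.unique ?_⟩
  refine hl.congr_of_eventuallyEq ?_
  have h3 : ∀ᶠ t in 𝓝 (0:ℝ), φ s x + t • v ∈ N := by
    refine hl.continuousAt.eventually_mem ?_
    rw [e0]; exact hN.mem_nhds hy
  filter_upwards [h3] with t ht
  rw [hφ.2.2.2.1 s (-s) _ ht, add_neg_cancel, hφ.2.2.1 _ ht]

set_option maxHeartbeats 1000000 in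
lemma Dp_hasDerivAt (hN : IsOpen N) (hH₁ : ContDiffOn ℝ (⊤ : ℕ∞) H₁ N) (hφ : FreeHamCircleAction N H₁ φ)
    {x : Phase d} (hx : x ∈ N) (s : ℝ) (u : Phase d) :
    HasDerivAt (fun s => Dp φ s x u) (fderiv ℝ (hamVF H₁) (φ s x) (Dp φ s x u)) s := by
  set Φ : ℝ × Phase d → Phase d := fun p => φ p.1 p.2 with hΦ
  have hc : ContDiffAt ℝ 2 Φ (s, x) := phi_contDiffAt hN hφ hx s (n := 2)
  have hsym : IsSymmSndFDerivAt ℝ Φ (s, x) := hc.isSymmSndFDerivAt (by simp)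
  have hdd : HasFDerivAt (fderiv ℝ Φ) (fderiv ℝ (fderiv ℝ Φ) (s, x)) (s, x) :=
    ((hc.fderiv_right (m := 1) (by norm_num)).differentiableAt (by norm_num)).hasFDerivAt
  have h2 : HasDerivAt (fun τ : ℝ => (τ, x)) ((1 : ℝ), (0 : Phase d)) s :=
    (hasDerivAt_id s).prodMk (hasDerivAt_const s x)
  have h3 := (hdd.comp_hasDerivAt s h2).clm_apply (hasDerivAt_const s ((0 : ℝ), u))
  have h4 : HasDerivAt (fun s => Dp φ s x u) (fderiv ℝ (fderiv ℝ Φ) (s, x) (1, 0) (0, u)) s := by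
    refine h3.congr_deriv ?_
    simp
  refine h4.congr_deriv ?_
  rw [hsym.eq]
  have hl : HasDerivAt (fun t : ℝ => (s, x + t • u)) ((0 : ℝ), u) 0 := by
    refine (hasDerivAt_const (0:ℝ) s).prodMk ?_
    simpa using ((hasDerivAt_id (0:ℝ)).smul_const u).const_add x
  have e0 : x + (0:ℝ) • u = x := by simp
  have h5 : HasDerivAt (fun t : ℝ => fderiv ℝ Φ (s, x + t • u) (1, 0))
      (fderiv ℝ (fderiv ℝ Φ) (s, x) (0, u) (1, 0)) 0 := by
    have h6 : HasDerivAt (fun t : ℝ => fderiv ℝ Φ (s, x + t • u)) (fderiv ℝ (fderiv ℝ Φ) (s, x) (0, u)) 0 := by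
      have h : HasFDerivAt (fderiv ℝ Φ) (fderiv ℝ (fderiv ℝ Φ) (s, x)) (s, x + (0:ℝ) • u) := by
        rw [e0]; exact hdd
      exact h.comp_hasDerivAt (0:ℝ) hl
    refine (h6.clm_apply (hasDerivAt_const (0:ℝ) ((1 : ℝ), (0 : Phase d)))).congr_deriv ?_
    simp
  have hN' : ∀ᶠ t in 𝓝 (0:ℝ), x + t • u ∈ N := by
    have : ContinuousAt (fun t : ℝ => x + t • u) 0 := by fun_prop
    refine this.eventually_mem ?_
    rw [e0]; exact hN.mem_nhds hx
  have h7 : HasDerivAt (fun t : ℝ => hamVF H₁ (φ s (x + t • u)))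
      (fderiv ℝ (hamVF H₁) (φ s x) (Dp φ s x u)) 0 := by
    have h8 : HasDerivAt (fun t : ℝ => φ s (x + t • u)) (Dp φ s x u) 0 := by
      have := phi_curve (σ := fun _ => s) hN hφ (by rw [e0]; exact hx) (hasDerivAt_const (0:ℝ) s) hl.snd
      simpa only [zero_smul, add_zero, zero_add] using this
    have h9 : ContDiffAt ℝ 2 H₁ (φ s x) :=
      (hH₁.contDiffAt (hN.mem_nhds (hφ.2.1 s x hx))).of_le two_le_top
    have h10 : HasFDerivAt (hamVF H₁) (fderiv ℝ (hamVF H₁) (φ s x)) (φ s (x + (0:ℝ) • u)) := by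
      rw [e0]; exact (hamVF_differentiableAt h9).hasFDerivAt
    exact h10.comp_hasDerivAt (0:ℝ) h8
  refine h5.unique (h7.congr_of_eventuallyEq ?_)
  filter_upwards [hN'] with t ht
  rw [fderiv_phi hN hφ ht]
  simp

/-- the flow is symplectic -/
lemma Dp_symp (hN : IsOpen N) (hH₁ : ContDiffOn ℝ (⊤ : ℕ∞) H₁ N) (hφ : FreeHamCircleAction N H₁ φ)
    {x : Phase d} (hx : x ∈ N) (s : ℝ) (u v : Phase d) :
    omega0 (Dp φ s x u) (Dp φ s x v) = omega0 u v := by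
  have hd : ∀ s, HasDerivAt (fun s => omega0 (Dp φ s x u) (Dp φ s x v)) 0 s := by
    intro s
    refine (omega0_hasDerivAt (Dp_hasDerivAt hN hH₁ hφ hx s u) (Dp_hasDerivAt hN hH₁ hφ hx s v)).congr_deriv ?_
    have h9 : ContDiffAt ℝ 2 H₁ (φ s x) :=
      (hH₁.contDiffAt (hN.mem_nhds (hφ.2.1 s x hx))).of_le two_le_top
    have hsym : IsSymmSndFDerivAt ℝ H₁ (φ s x) := h9.isSymmSndFDerivAt (by simp)
    rw [omega0_symm (Dp φ s x u), omega0_fderiv_hamVF h9, omega0_fderiv_hamVF h9, hsym.eq]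
    ring
  have h0 : ∀ u, Dp φ 0 x u = u := by
    intro u
    have hl : HasDerivAt (fun t : ℝ => x + t • u) u 0 := by
      simpa using ((hasDerivAt_id (0:ℝ)).smul_const u).const_add x
    have e0 : x + (0:ℝ) • u = x := by simp
    have h1 := phi_curve (σ := fun _ => 0) hN hφ (by rw [e0]; exact hx) (hasDerivAt_const (0:ℝ) 0) hl
    simp only [zero_smul, add_zero, zero_add] at h1
    refine h1.unique (hl.congr_of_eventuallyEq ?_)
    have h3 : ∀ᶠ t in 𝓝 (0:ℝ), x + t • u ∈ N := by
      refine hl.continuousAt.eventually_mem ?_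
      rw [e0]; exact hN.mem_nhds hx
    filter_upwards [h3] with t ht
    exact hφ.2.2.1 _ ht
  have := is_const_of_deriv_eq_zero (fun t => (hd t).differentiableAt) (fun t => (hd t).deriv) s 0
  simp only [h0] at this
  exact this
end Omega
end HZ

namespace HZ
set_option linter.unusedSectionVars false

section Step
open intervalIntegral

lemma exists_step : ∃ p p' : ℝ → ℝ, ContDiff ℝ 2 p ∧ (∀ s, HasDerivAt p (p' s) s) ∧
    (∀ s ≤ 0, p s = 0) ∧ (∀ s, 1 ≤ s → p s = 1) ∧ (∀ s, 0 ≤ p' s ∧ p' s ≤ 2) := by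
  set f : ℝ → ℝ := fun s => Real.smoothTransition (4 * s) * Real.smoothTransition (4 * (1 - s)) with hf
  have hfs : ContDiff ℝ 2 f := by
    refine ContDiff.mul (Real.smoothTransition.contDiff.comp ?_) (Real.smoothTransition.contDiff.comp ?_)
    · fun_prop
    · fun_prop
  have hfc : Continuous f := hfs.continuous
  have hd : ∀ s, HasDerivAt (fun s => ∫ u in (0:ℝ)..s, f u) (f s) s := fun s =>
    integral_hasDerivAt_right (hfc.intervalIntegrable _ _)
      (hfc.stronglyMeasurableAtFilter _ _) hfc.continuousAt
  have hf0 : ∀ s ≤ 0, f s = 0 := fun s hs => by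
    simp only [hf]
    rw [Real.smoothTransition.zero_of_nonpos (by linarith), zero_mul]
  have hf1 : ∀ s, 1 ≤ s → f s = 0 := fun s hs => by
    simp only [hf]
    rw [Real.smoothTransition.zero_of_nonpos (x := 4 * (1 - s)) (by linarith), mul_zero]
  have hfm : ∀ s, 1/4 ≤ s → s ≤ 3/4 → f s = 1 := fun s hs hs' => by
    simp only [hf]
    rw [Real.smoothTransition.one_of_one_le (by linarith), Real.smoothTransition.one_of_one_le (by linarith), mul_one]
  have hfn : ∀ s, 0 ≤ f s := fun s =>
    mul_nonneg (Real.smoothTransition.nonneg _) (Real.smoothTransition.nonneg _)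
  have hfl : ∀ s, f s ≤ 1 := fun s =>
    mul_le_one₀ (Real.smoothTransition.le_one _) (Real.smoothTransition.nonneg _) (Real.smoothTransition.le_one _)
  have hη0 : ∀ s ≤ 0, (∫ u in (0:ℝ)..s, f u) = 0 := by
    intro s hs
    rw [integral_symm, neg_eq_zero]
    rw [integral_congr (g := fun _ => (0:ℝ))]
    · simp
    · intro u hu
      rw [uIcc_of_le hs] at hu
      exact hf0 u hu.2
  have hη1 : ∀ s, 1 ≤ s → (∫ u in (0:ℝ)..s, f u) = ∫ u in (0:ℝ)..1, f u := by
    intro s hs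
    rw [← integral_add_adjacent_intervals (hfc.intervalIntegrable 0 1) (hfc.intervalIntegrable 1 s)]
    have : (∫ u in (1:ℝ)..s, f u) = 0 := by
      rw [integral_congr (g := fun _ => (0:ℝ))]
      · simp
      · intro u hu
        rw [uIcc_of_le hs] at hu
        exact hf1 u hu.1
    rw [this]; ring
  have hI : 1/2 ≤ ∫ u in (0:ℝ)..1, f u := by
    rw [← integral_add_adjacent_intervals (hfc.intervalIntegrable 0 (1/4)) (hfc.intervalIntegrable (1/4) 1),
      ← integral_add_adjacent_intervals (hfc.intervalIntegrable (1/4) (3/4)) (hfc.intervalIntegrable (3/4) 1)]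
    have h1 : 0 ≤ ∫ u in (0:ℝ)..(1/4), f u := integral_nonneg (by norm_num) fun u _ => hfn u
    have h2 : 0 ≤ ∫ u in (3/4:ℝ)..1, f u := integral_nonneg (by norm_num) fun u _ => hfn u
    have h3 : (∫ u in (1/4:ℝ)..(3/4), f u) = 1/2 := by
      rw [integral_congr (g := fun _ => (1:ℝ))]
      · simp; norm_num
      · intro u hu
        rw [uIcc_of_le (by norm_num)] at hu
        exact hfm u hu.1 hu.2
    linarith
  set I := ∫ u in (0:ℝ)..1, f u
  have hIpos : 0 < I := by linarith
  have hc : ContDiff ℝ 2 fun s => ∫ u in (0:ℝ)..s, f u := by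
    have : (2 : WithTop ℕ∞) = 1 + 1 := by norm_num
    rw [this, contDiff_succ_iff_deriv]
    refine ⟨fun s => (hd s).differentiableAt, by simp, ?_⟩
    have : deriv (fun s => ∫ u in (0:ℝ)..s, f u) = f := by
      ext s; exact (hd s).deriv
    rw [this]
    exact hfs.of_le (by norm_num)
  refine ⟨fun s => (∫ u in (0:ℝ)..s, f u) / I, fun s => f s / I, hc.div_const I,
    fun s => (hd s).div_const I, fun s hs => ?_, fun s hs => ?_, fun s => ⟨div_nonneg (hfn s) hIpos.le, ?_⟩⟩
  · show _ / _ = _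
    rw [hη0 s hs, zero_div]
  · show _ / _ = _
    rw [hη1 s hs, div_self hIpos.ne']
  · rw [div_le_iff₀ hIpos]
    linarith [hfl s]

lemma exists_chi (j0 : ℝ) {w : ℝ} (hw : 0 < w) : ∃ χ χ' : ℝ → ℝ, ContDiff ℝ 2 χ ∧
    (∀ s, HasDerivAt χ (χ' s) s) ∧ (∀ s, 0 ≤ χ s ∧ χ s ≤ 1) ∧ (∀ s ≤ j0, χ s = 0) ∧
    (∀ s, j0 + w ≤ s → χ s = 0) ∧ (∀ s, |s - (j0 + w/2)| ≤ w / 20 → χ s = 1) ∧ (∀ s, |χ' s| ≤ 5 / w) := by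
  obtain ⟨p, p', hp, hpd, hp0, hp1, hp'⟩ := exists_step
  have hmono : Monotone p := monotone_of_deriv_nonneg (fun s => (hpd s).differentiableAt)
    (fun s => by rw [(hpd s).deriv]; exact (hp' s).1)
  have hpn : ∀ s, 0 ≤ p s := fun s => by
    rcases le_total s 0 with h | h
    · rw [hp0 s h]
    · rw [← hp0 0 le_rfl]; exact hmono h
  have hpl : ∀ s, p s ≤ 1 := fun s => by
    rcases le_total s 1 with h | h
    · rw [← hp1 1 le_rfl]; exact hmono h
    · rw [hp1 s h]
  set r : ℝ := 9 / 20 * w with hr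
  have hrpos : 0 < r := by positivity
  set u1 : ℝ → ℝ := fun s => (s - j0) / r with hu1
  set u2 : ℝ → ℝ := fun s => (s - (j0 + 11/20 * w)) / r with hu2
  have h1c : ContDiff ℝ 2 u1 := by fun_prop
  have h2c : ContDiff ℝ 2 u2 := by fun_prop
  have h1d : ∀ s, HasDerivAt u1 (1 / r) s := fun s => ((hasDerivAt_id s).sub_const _).div_const r
  have h2d : ∀ s, HasDerivAt u2 (1 / r) s := fun s => ((hasDerivAt_id s).sub_const _).div_const r
  have hor : ∀ s, p (u2 s) = 0 ∨ p (u1 s) = 1 := fun s => by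
    rcases le_total s (j0 + 11/20 * w) with h | h
    · left; exact hp0 _ (div_nonpos_of_nonpos_of_nonneg (by linarith) hrpos.le)
    · right; refine hp1 _ ?_
      rw [hu1, le_div_iff₀ hrpos]; rw [hr]; linarith
  have hor' : ∀ s, u2 s ≤ u1 s := fun s => by
    simp only [hu1, hu2]
    gcongr; linarith
  refine ⟨fun s => p (u1 s) - p (u2 s), fun s => p' (u1 s) * (1 / r) - p' (u2 s) * (1 / r),
    (hp.comp h1c).sub (hp.comp h2c), fun s => ((hpd _).comp s (h1d s)).sub ((hpd _).comp s (h2d s)),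
    fun s => ⟨sub_nonneg.2 (hmono (hor' s)), ?_⟩, fun s hs => ?_, fun s hs => ?_, fun s hs => ?_, fun s => ?_⟩
  · linarith [hpn (u2 s), hpl (u1 s)]
  · show p (u1 s) - p (u2 s) = 0
    rw [hp0 (u1 s) (div_nonpos_of_nonpos_of_nonneg (by linarith) hrpos.le),
      hp0 (u2 s) (div_nonpos_of_nonpos_of_nonneg (by linarith) hrpos.le), sub_zero]
  · show p (u1 s) - p (u2 s) = 0
    rw [hp1 (u1 s) (by rw [hu1, le_div_iff₀ hrpos]; rw [hr]; linarith),
      hp1 (u2 s) (by rw [hu2, le_div_iff₀ hrpos]; rw [hr]; linarith), sub_self]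
  · rw [abs_le] at hs
    show p (u1 s) - p (u2 s) = 1
    rw [hp1 (u1 s) (by rw [hu1, le_div_iff₀ hrpos]; rw [hr]; linarith),
      hp0 (u2 s) (div_nonpos_of_nonpos_of_nonneg (by linarith) hrpos.le), sub_zero]
  · have e : p' (u1 s) * (1 / r) - p' (u2 s) * (1 / r) = (p' (u1 s) - p' (u2 s)) / r := by ring
    have h5 : 5 / w = (9/4) / r := by rw [hr]; field_simp; norm_num
    show |p' (u1 s) * (1 / r) - p' (u2 s) * (1 / r)| ≤ 5 / w
    rw [e, h5, abs_div, abs_of_pos hrpos]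
    gcongr
    rw [abs_le]
    constructor <;> linarith [(hp' (u1 s)).1, (hp' (u1 s)).2, (hp' (u2 s)).1, (hp' (u2 s)).2]
end Step
end HZ

namespace HZ
set_option linter.unusedSectionVars false

section Red
open Filter Topology ComplexConjugate
variable {d : ℕ}

/-- The data of the reduction. -/
structure Red (N : Set (Phase d)) (H₁ : Phase d → ℝ) (φ : ℝ → Phase d → Phase d) (H : Phase d → ℝ) (k : ℕ)
    (K : Set (Phase d)) (m a b : ℝ) : Prop where
  hN : IsOpen N
  hH₁ : ContDiffOn ℝ (⊤ : ℕ∞) H₁ N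
  hφ : FreeHamCircleAction N H₁ φ
  hk : 10 < k
  hH : ContDiff ℝ 2 H
  h0 : ∀ x, 0 ≤ H x ∧ H x ≤ m
  hK : IsCompact K
  hKN : K ⊆ N
  hKm : ∀ x, x ∉ K → H x = m
  hinv : ∀ x ∈ N, H (φ (1 / k) x) = H x
  hab : ∀ x ∈ K, a ≤ H₁ x ∧ H₁ x ≤ b

variable {N : Set (Phase d)} {H₁ : Phase d → ℝ} {φ : ℝ → Phase d → Phase d} {H : Phase d → ℝ} {k : ℕ}
    {K : Set (Phase d)} {m a b : ℝ}

lemma Red.kpos (R : Red N H₁ φ H k K m a b) : (0 : ℝ) < k := by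
  have := R.hk
  exact_mod_cast (by omega : 0 < k)

lemma Red.inv_nat (R : Red N H₁ φ H k K m a b) {x : Phase d} (hx : x ∈ N) (j : ℕ) :
    H (φ (j / k) x) = H x := by
  induction j with
  | zero => simp [R.hφ.2.2.1 x hx]
  | succ j ih =>
    have e := R.hinv _ (R.hφ.2.1 (j / k) x hx)
    rw [R.hφ.2.2.2.1 _ _ x hx] at e
    rw [← ih, ← e]
    congr 2
    push_cast; ring

lemma Red.inv_int (R : Red N H₁ φ H k K m a b) {x : Phase d} (hx : x ∈ N) (j : ℤ) :
    H (φ (j / k) x) = H x := by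
  obtain ⟨n, rfl | rfl⟩ := j.eq_nat_or_neg
  · rw [Int.cast_natCast]; exact R.inv_nat hx n
  · rw [← R.inv_nat (R.hφ.2.1 _ x hx) n, R.hφ.2.2.2.1 _ _ x hx]
    have : ((n : ℝ) / k + ((-(n : ℤ) : ℤ) : ℝ) / k) = 0 := by push_cast; ring
    rw [this, R.hφ.2.2.1 x hx]

/-- The induced function on the product. -/
def Hh (φ : ℝ → Phase d → Phase d) (H : Phase d → ℝ) (k : ℕ) (w : Phase d × ℂ) : ℝ :=
  H (φ (-(Complex.arg w.2 / (2 * Real.pi * k))) w.1)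

lemma Red.Hh_eq (R : Red N H₁ φ H k K m a b) {x : Phase d} (hx : x ∈ N) {ζ : ℂ} (hζ : ζ ≠ 0) {α : ℝ}
    (hα : ζ = ‖ζ‖ * Complex.exp (α * Complex.I)) :
    Hh φ H k (x, ζ) = H (φ (-(α / (2 * Real.pi * k))) x) := by
  have h1 : (‖ζ‖ : ℂ) * Complex.exp (Complex.arg ζ * Complex.I) = ‖ζ‖ * Complex.exp (α * Complex.I) := by
    rw [← hα]; exact Complex.norm_mul_exp_arg_mul_I ζ
  have h2 := mul_left_cancel₀ (by simpa using hζ : (‖ζ‖ : ℂ) ≠ 0) h1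
  obtain ⟨n, hn⟩ := Complex.exp_eq_exp_iff_exists_int.1 h2
  have h3 : Complex.arg ζ = α + n * (2 * Real.pi) := by
    have := congrArg Complex.im hn
    simpa using this
  have hk := R.kpos
  have h4 : -(α / (2 * Real.pi * k)) = (n : ℝ) / k + (-(Complex.arg ζ / (2 * Real.pi * k))) := by
    rw [h3]; field_simp; ring
  rw [Hh, h4, ← R.hφ.2.2.2.1 _ _ x hx, R.inv_int (R.hφ.2.1 _ x hx)]

/-- local branch of the argument -/
def br (α : ℝ) (ζ0 ζ : ℂ) : ℝ := α + (Complex.log (ζ / ζ0)).im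

lemma br_self (α : ℝ) {ζ0 : ℂ} (h : ζ0 ≠ 0) : br α ζ0 ζ0 = α := by
  simp [br, div_self h]

lemma br_lift {α : ℝ} {ζ0 ζ : ℂ} (h0 : ζ0 ≠ 0) (h : ζ ≠ 0) (hα : ζ0 = ‖ζ0‖ * Complex.exp (α * Complex.I)) :
    ζ = ‖ζ‖ * Complex.exp (br α ζ0 ζ * Complex.I) := by
  have h1 := Complex.norm_mul_exp_arg_mul_I (ζ / ζ0)
  rw [br, Complex.log_im]
  push_cast
  rw [add_mul, Complex.exp_add]
  have h2 : ζ = ζ0 * (ζ / ζ0) := by field_simp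
  have h3 : (‖ζ0‖ : ℂ) ≠ 0 := by simpa using h0
  calc ζ = ζ0 * (ζ / ζ0) := h2
    _ = (‖ζ0‖ * Complex.exp (α * Complex.I)) * (‖ζ / ζ0‖ * Complex.exp (Complex.arg (ζ / ζ0) * Complex.I)) := by
      rw [← hα, h1]
    _ = _ := by
      rw [norm_div]; push_cast; field_simp

lemma br_contDiffAt (α : ℝ) {ζ0 : ℂ} (h0 : ζ0 ≠ 0) : ContDiffAt ℝ 2 (br α ζ0) ζ0 := by
  unfold br
  refine contDiffAt_const.add ?_
  have h1 : ContDiffAt ℝ 2 (fun ζ : ℂ => Complex.log (ζ / ζ0)) ζ0 := by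
    have h2 : ContDiffAt ℂ 2 (fun ζ : ℂ => Complex.log (ζ / ζ0)) ζ0 := by
      have h3 : ContDiffAt ℂ 2 Complex.log (ζ0 / ζ0) := Complex.contDiffAt_log (by simp [div_self h0])
      exact ContDiffAt.comp (f := fun ζ : ℂ => ζ / ζ0) ζ0 h3 (contDiffAt_id.div_const ζ0)
    exact h2.restrict_scalars ℝ
  exact Complex.imCLM.contDiff.contDiffAt.comp ζ0 h1

lemma br_hasDerivAt (α : ℝ) {ζ : ℝ → ℂ} {ζ' : ℂ} {t : ℝ} (h0 : ζ t ≠ 0) (h : HasDerivAt ζ ζ' t) :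
    HasDerivAt (fun s => br α (ζ t) (ζ s)) (ζ' / ζ t).im t := by
  unfold br
  refine HasDerivAt.const_add α ?_
  have h1 : HasDerivAt (fun s => Complex.log (ζ s / ζ t)) (ζ' / ζ t) t := by
    have h2 := (h.div_const (ζ t)).clog_real (by simp [div_self h0])
    refine h2.congr_deriv ?_
    rw [div_self h0, div_one]
  exact (Complex.imCLM.hasFDerivAt (x := Complex.log (ζ t / ζ t))).comp_hasDerivAt t h1

lemma Red.Hh_ev (R : Red N H₁ φ H k K m a b) {x : Phase d} (hx : x ∈ N) {ζ : ℂ} (hζ : ζ ≠ 0) {α : ℝ}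
    (hα : ζ = ‖ζ‖ * Complex.exp (α * Complex.I)) :
    Hh φ H k =ᶠ[𝓝 (x, ζ)] fun w => H (φ (-(br α ζ w.2 / (2 * Real.pi * k))) w.1) := by
  have h1 : ∀ᶠ w : Phase d × ℂ in 𝓝 (x, ζ), w ∈ N ×ˢ {0}ᶜ :=
    (R.hN.prod isOpen_compl_singleton).mem_nhds ⟨hx, hζ⟩
  filter_upwards [h1] with w hw
  exact R.Hh_eq hw.1 hw.2 (br_lift hζ hw.2 hα)

lemma Red.Hh_contDiffAt (R : Red N H₁ φ H k K m a b) {x : Phase d} (hx : x ∈ N) {ζ : ℂ} (hζ : ζ ≠ 0) :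
    ContDiffAt ℝ 2 (Hh φ H k) (x, ζ) := by
  refine ContDiffAt.congr_of_eventuallyEq ?_
    (R.Hh_ev hx hζ (Complex.norm_mul_exp_arg_mul_I ζ).symm)
  refine R.hH.contDiffAt.comp _ ?_
  set α := Complex.arg ζ
  have h1 : ContDiffAt ℝ 2 (fun w : Phase d × ℂ => (-(br α ζ w.2 / (2 * Real.pi * k)), w.1)) (x, ζ) := by
    refine ContDiffAt.prodMk (ContDiffAt.neg (ContDiffAt.div_const ?_ _)) contDiffAt_fst
    exact ContDiffAt.comp (f := Prod.snd) (x, ζ) (br_contDiffAt α hζ) contDiffAt_snd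
  exact ContDiffAt.comp (f := fun w : Phase d × ℂ => (-(br α ζ w.2 / (2 * Real.pi * k)), w.1)) (x, ζ)
    (phi_contDiffAt (n := 2) R.hN R.hφ hx _) h1

lemma Red.Hh_fderiv (R : Red N H₁ φ H k K m a b) {x : Phase d} (hx : x ∈ N) {ζ : ℂ} (hζ : ζ ≠ 0) {α : ℝ}
    (hα : ζ = ‖ζ‖ * Complex.exp (α * Complex.I)) (v : Phase d) (η : ℂ) :
    fderiv ℝ (Hh φ H k) (x, ζ) (v, η) = fderiv ℝ H (φ (-(α / (2 * Real.pi * k))) x)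
      ((-((η / ζ).im / (2 * Real.pi * k))) • hamVF H₁ (φ (-(α / (2 * Real.pi * k))) x)
        + Dp φ (-(α / (2 * Real.pi * k))) x v) := by
  have hl1 : HasDerivAt (fun t : ℝ => x + t • v) v 0 := by
    simpa using ((hasDerivAt_id (0:ℝ)).smul_const v).const_add x
  have hl2 : HasDerivAt (fun t : ℝ => ζ + t • η) η 0 := by
    simpa using ((hasDerivAt_id (0:ℝ)).smul_const η).const_add ζ
  have e1 : x + (0:ℝ) • v = x := by simp
  have e2 : ζ + (0:ℝ) • η = ζ := by simp
  have h1 : HasFDerivAt (Hh φ H k) (fderiv ℝ (Hh φ H k) (x, ζ)) (x + (0:ℝ) • v, ζ + (0:ℝ) • η) := by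
    rw [e1, e2]; exact ((R.Hh_contDiffAt hx hζ).differentiableAt (by norm_num)).hasFDerivAt
  have h2 := h1.comp_hasDerivAt (0:ℝ) (hl1.prodMk hl2)
  have h3 : HasDerivAt (fun t : ℝ => br α ζ (ζ + t • η)) (η / ζ).im 0 := by
    have := br_hasDerivAt α (by rw [e2]; exact hζ) hl2
    simpa only [e2] using this
  have h4 := phi_curve R.hN R.hφ (by rw [e1]; exact hx) (h3.div_const (2 * Real.pi * k)).neg hl1
  have h5 : HasFDerivAt H (fderiv ℝ H (φ (-(α / (2 * Real.pi * k))) x))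
      (φ (-(br α ζ (ζ + (0:ℝ) • η) / (2 * Real.pi * k))) (x + (0:ℝ) • v)) := by
    rw [e1, e2, br_self α hζ]
    exact (R.hH.differentiable (by norm_num)).differentiableAt.hasFDerivAt
  have h6 := h5.comp_hasDerivAt (0:ℝ) h4
  have h7 : HasDerivAt (fun t : ℝ => Hh φ H k (x + t • v, ζ + t • η)) _ 0 := h6.congr_of_eventuallyEq (by
    have hc : ContinuousAt (fun t : ℝ => (x + t • v, ζ + t • η)) 0 := (hl1.prodMk hl2).continuousAt
    have hev := R.Hh_ev hx hζ hα
    rw [← e1, ← e2] at hev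
    have := hc.eventually hev
    simp only [e2] at this
    exact this)
  have h8 := h2.unique h7
  rw [h8]
  simp only [Pi.neg_apply, e1, e2, br_self α hζ]
end Red
end HZ

namespace HZ
set_option linter.unusedSectionVars false

section Red
open Filter Topology ComplexConjugate
variable {d : ℕ}
variable {N : Set (Phase d)} {H₁ : Phase d → ℝ} {φ : ℝ → Phase d → Phase d} {H : Phase d → ℝ} {k : ℕ}
    {K : Set (Phase d)} {m a b : ℝ}

/-- The total moment map. -/
def Jf (H₁ : Phase d → ℝ) (k : ℕ) (w : Phase d × ℂ) : ℝ := Real.pi * ‖w.2‖ ^ 2 + H₁ w.1 / k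

open Classical in
/-- The Hamiltonian on the product. -/
def Ff (N : Set (Phase d)) (H₁ : Phase d → ℝ) (φ : ℝ → Phase d → Phase d) (H : Phase d → ℝ) (k : ℕ) (M : ℝ)
    (χ : ℝ → ℝ) (w : Phase d × ℂ) : ℝ :=
  if w.1 ∈ N ∧ w.2 ≠ 0 then M - (M - Hh φ H k w / (2 * k)) * χ (Jf H₁ k w) else M

/-- Conditions on the cut-off function. -/
structure Cut (k : ℕ) (m a b M : ℝ) (χ χ' : ℝ → ℝ) : Prop where
  hM : 2 * k * M = m
  hMpos : 0 < M
  hba : (b - a) / k < M / 3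
  hχ : ContDiff ℝ 2 χ
  hχd : ∀ s, HasDerivAt χ (χ' s) s
  hχ01 : ∀ s, 0 ≤ χ s ∧ χ s ≤ 1
  hχl : ∀ s ≤ b / k + M / 12, χ s = 0
  hχr : ∀ s, b / k + M / 12 + M / 2 ≤ s → χ s = 0
  hχ1 : ∀ s, |s - (b / k + M / 12 + M / 2 / 2)| ≤ M / 2 / 20 → χ s = 1
  hχ5 : ∀ s, |χ' s| ≤ 5 / (M / 2)

variable {M : ℝ} {χ χ' : ℝ → ℝ}

lemma Jf_contDiffAt (R : Red N H₁ φ H k K m a b) {w : Phase d × ℂ} (hx : w.1 ∈ N) :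
    ContDiffAt ℝ 2 (Jf H₁ k) w := by
  unfold Jf
  refine ContDiffAt.add (contDiffAt_const.mul ?_) (ContDiffAt.div_const ?_ _)
  · exact (contDiff_snd.norm_sq ℝ).contDiffAt
  · exact ContDiffAt.comp (f := Prod.fst) w
      ((R.hH₁.contDiffAt (R.hN.mem_nhds hx)).of_le two_le_top) contDiffAt_fst

lemma Jf_hasDerivAt (R : Red N H₁ φ H k K m a b) {x : ℝ → Phase d} {ζ : ℝ → ℂ} {x' : Phase d} {ζ' : ℂ} {t : ℝ}
    (hx : x t ∈ N) (hxd : HasDerivAt x x' t) (hζ : HasDerivAt ζ ζ' t) :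
    HasDerivAt (fun s => Jf H₁ k (x s, ζ s))
      (2 * Real.pi * (conj (ζ t) * ζ').re + fderiv ℝ H₁ (x t) x' / k) t := by
  have h1 : HasFDerivAt H₁ (fderiv ℝ H₁ (x t)) (x t) :=
    ((R.hH₁.contDiffAt (R.hN.mem_nhds hx)).differentiableAt (by simp)).hasFDerivAt
  have h2 := ((h1.comp_hasDerivAt t hxd).div_const (k : ℝ))
  have h3 := (hζ.norm_sq.const_mul Real.pi).add h2
  refine h3.congr_deriv ?_
  rw [Complex.inner]
  ring_nf

lemma Ff_of_mem {w : Phase d × ℂ} (hx : w.1 ∈ N) (hζ : w.2 ≠ 0) :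
    Ff N H₁ φ H k M χ w = M - (M - Hh φ H k w / (2 * k)) * χ (Jf H₁ k w) := if_pos ⟨hx, hζ⟩

lemma Ff_supp (R : Red N H₁ φ H k K m a b) (Q : Cut k m a b M χ χ') {w : Phase d × ℂ}
    (h : Ff N H₁ φ H k M χ w ≠ M) : w.1 ∈ N ∧ w.2 ≠ 0 ∧
      φ (-(Complex.arg w.2 / (2 * Real.pi * k))) w.1 ∈ K ∧ Hh φ H k w < m ∧ 0 < χ (Jf H₁ k w) ∧
      M / 12 ≤ Real.pi * ‖w.2‖ ^ 2 ∧ Real.pi * ‖w.2‖ ^ 2 ≤ M / 12 + M / 2 + (b - a) / k := by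
  have hk := R.kpos
  by_cases hc : w.1 ∈ N ∧ w.2 ≠ 0
  · obtain ⟨hx, hζ⟩ := hc
    rw [Ff_of_mem hx hζ] at h
    have h1 : χ (Jf H₁ k w) ≠ 0 := fun h0 => h (by rw [h0]; ring)
    have h2 : Hh φ H k w ≠ m := fun h0 => h (by rw [h0, ← Q.hM]; field_simp; ring)
    have h3 : φ (-(Complex.arg w.2 / (2 * Real.pi * k))) w.1 ∈ K := by
      by_contra hK
      exact h2 (R.hKm _ hK)
    have h4 := R.hab _ h3
    rw [H1_inv R.hN R.hH₁ R.hφ hx] at h4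
    have h5 : b / k + M / 12 < Jf H₁ k w := by
      by_contra hle
      exact h1 (Q.hχl _ (not_lt.1 hle))
    have h6 : Jf H₁ k w < b / k + M / 12 + M / 2 := by
      by_contra hle
      exact h1 (Q.hχr _ (not_lt.1 hle))
    have h7 : a / k ≤ H₁ w.1 / k := by gcongr; exact h4.1
    have h8 : H₁ w.1 / k ≤ b / k := by gcongr; exact h4.2
    rw [Jf] at h5 h6
    refine ⟨hx, hζ, h3, lt_of_le_of_ne (R.h0 _).2 h2, lt_of_le_of_ne (Q.hχ01 _).1 (Ne.symm h1), by linarith, ?_⟩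
    rw [sub_div]; linarith
  · exact absurd (if_neg hc) h

/-- The compact set carrying the Hamiltonian. -/
def KK (φ : ℝ → Phase d → Phase d) (K : Set (Phase d)) (k : ℕ) (a b M : ℝ) : Set (Phase d × ℂ) :=
  ((fun p : ℝ × Phase d => φ p.1 p.2) '' (Icc (-1) 1 ×ˢ K)) ×ˢ
    {ζ : ℂ | M / 12 ≤ Real.pi * ‖ζ‖ ^ 2 ∧ Real.pi * ‖ζ‖ ^ 2 ≤ M / 12 + M / 2 + (b - a) / k}

lemma KK_compact (R : Red N H₁ φ H k K m a b) : IsCompact (KK φ K k a b M) := by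
  refine IsCompact.prod ?_ ?_
  · refine (isCompact_Icc.prod R.hK).image_of_continuousOn ?_
    exact R.hφ.1.continuousOn.mono (prod_mono (subset_univ _) R.hKN)
  · refine Metric.isCompact_of_isClosed_isBounded ?_ ?_
    · have h1 : Continuous fun ζ : ℂ => Real.pi * ‖ζ‖ ^ 2 := by fun_prop
      exact (isClosed_le continuous_const h1).inter (isClosed_le h1 continuous_const)
    · refine isBounded_iff_forall_norm_le.2 ⟨1 + (M / 12 + M / 2 + (b - a) / k), fun ζ hζ => ?_⟩
      have h1 := hζ.2
      have h2 := Real.pi_gt_three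
      nlinarith [sq_nonneg (‖ζ‖ - 1), sq_nonneg ‖ζ‖, norm_nonneg ζ]

lemma KK_mem (R : Red N H₁ φ H k K m a b) (Q : Cut k m a b M χ χ') {w : Phase d × ℂ} (h : w ∈ KK φ K k a b M) :
    w.1 ∈ N ∧ w.2 ≠ 0 := by
  obtain ⟨⟨p, hp, hpe⟩, h1, h2⟩ := h
  refine ⟨?_, fun h0 => ?_⟩
  · rw [← hpe]; exact R.hφ.2.1 _ _ (R.hKN hp.2)
  · rw [h0] at h1
    have := Q.hMpos
    norm_num at h1
    linarith

lemma Ff_off (R : Red N H₁ φ H k K m a b) (Q : Cut k m a b M χ χ') {w : Phase d × ℂ}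
    (hw : w ∉ KK φ K k a b M) : Ff N H₁ φ H k M χ w = M := by
  by_contra h
  obtain ⟨hx, hζ, hK, -, -, h1, h2⟩ := Ff_supp R Q h
  refine hw ⟨⟨(Complex.arg w.2 / (2 * Real.pi * k), φ (-(Complex.arg w.2 / (2 * Real.pi * k))) w.1),
    ⟨?_, hK⟩, ?_⟩, h1, h2⟩
  · have h3 := Complex.abs_arg_le_pi w.2
    have h4 : (1:ℝ) ≤ k := by have := R.hk; exact_mod_cast (by omega : 1 ≤ k)
    have h5 := Real.pi_pos
    have h6 : |Complex.arg w.2 / (2 * Real.pi * k)| ≤ 1 := by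
      rw [abs_div, abs_of_pos (by positivity : 0 < 2 * Real.pi * (k:ℝ)), div_le_one (by positivity)]
      nlinarith
    exact abs_le.1 h6
  · show φ (Complex.arg w.2 / (2 * Real.pi * k)) (φ (-(Complex.arg w.2 / (2 * Real.pi * k))) w.1) = w.1
    rw [R.hφ.2.2.2.1 _ _ _ hx, add_neg_cancel, R.hφ.2.2.1 _ hx]

lemma Ff_ev (R : Red N H₁ φ H k K m a b) {w : Phase d × ℂ} (hx : w.1 ∈ N) (hζ : w.2 ≠ 0) :
    Ff N H₁ φ H k M χ =ᶠ[𝓝 w] fun w => M - (M - Hh φ H k w / (2 * k)) * χ (Jf H₁ k w) := by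
  have h1 : ∀ᶠ w : Phase d × ℂ in 𝓝 w, w ∈ N ×ˢ {0}ᶜ :=
    (R.hN.prod isOpen_compl_singleton).mem_nhds ⟨hx, hζ⟩
  filter_upwards [h1] with w hw
  exact Ff_of_mem hw.1 hw.2

lemma Ff_contDiff (R : Red N H₁ φ H k K m a b) (Q : Cut k m a b M χ χ') :
    ContDiff ℝ 2 (Ff N H₁ φ H k M χ) := by
  rw [contDiff_iff_contDiffAt]
  intro w
  by_cases hw : w ∈ KK φ K k a b M
  · obtain ⟨hx, hζ⟩ := KK_mem R Q hw
    refine ContDiffAt.congr_of_eventuallyEq ?_ (Ff_ev R hx hζ)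
    refine contDiffAt_const.sub (ContDiffAt.mul (contDiffAt_const.sub (ContDiffAt.div_const ?_ _)) ?_)
    · exact R.Hh_contDiffAt hx hζ
    · exact ContDiffAt.comp w Q.hχ.contDiffAt (Jf_contDiffAt R hx)
  · refine ContDiffAt.congr_of_eventuallyEq (contDiffAt_const (c := M)) ?_
    filter_upwards [(KK_compact R).isClosed.isOpen_compl.mem_nhds hw] with z hz
    exact Ff_off R Q hz

lemma Ff_bd (R : Red N H₁ φ H k K m a b) (Q : Cut k m a b M χ χ') (w : Phase d × ℂ) :
    0 ≤ Ff N H₁ φ H k M χ w ∧ Ff N H₁ φ H k M χ w ≤ M := by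
  have hk := R.kpos
  have hM := Q.hMpos
  by_cases h : Ff N H₁ φ H k M χ w = M
  · rw [h]; exact ⟨hM.le, le_rfl⟩
  · obtain ⟨hx, hζ, -⟩ := Ff_supp R Q h
    rw [Ff_of_mem hx hζ]
    have h1 : 0 ≤ Hh φ H k w / (2 * k) := div_nonneg (R.h0 _).1 (by positivity)
    have h2 : Hh φ H k w / (2 * k) ≤ M := by
      rw [div_le_iff₀ (by positivity)]
      have := (R.h0 (φ (-(Complex.arg w.2 / (2 * Real.pi * k))) w.1)).2
      rw [Hh]; linarith [Q.hM]
    have h3 := Q.hχ01 (Jf H₁ k w)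
    constructor <;> nlinarith

lemma Ff_zero (R : Red N H₁ φ H k K m a b) (Q : Cut k m a b M χ χ') {V : Set (Phase d)} (hV : IsOpen V)
    {y : Phase d} (hy : y ∈ V) (hHV : ∀ x ∈ V, H x = 0) :
    ∃ p, ∀ᶠ w in 𝓝 p, Ff N H₁ φ H k M χ w = 0 := by
  have hk := R.kpos
  have hM := Q.hMpos
  have hyK : y ∈ K := by
    by_contra h
    have h1 := R.hKm y h
    rw [hHV y hy, ← Q.hM] at h1
    have : 0 < 2 * k * M := by positivity
    linarith
  have hyN := R.hKN hyK
  have hb : H₁ y / k ≤ b / k := by gcongr; exact (R.hab y hyK).2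
  set s := (b / k + M / 12 + M / 2 / 2 - H₁ y / k) / Real.pi with hs
  have hspos : 0 < s := div_pos (by linarith) Real.pi_pos
  have hζ0 : 0 < Real.sqrt s := Real.sqrt_pos.2 hspos
  set ζ0 : ℂ := (Real.sqrt s : ℂ) with hζ0d
  have hne : ζ0 ≠ 0 := by simpa [hζ0d] using hζ0.ne'
  have hJ : Jf H₁ k (y, ζ0) = b / k + M / 12 + M / 2 / 2 := by
    rw [Jf, hζ0d]
    simp only [Complex.norm_real, Real.norm_eq_abs, sq_abs]
    rw [Real.sq_sqrt hspos.le, hs]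
    field_simp; ring
  refine ⟨(y, ζ0), ?_⟩
  have h1 : ∀ᶠ w in 𝓝 (y, ζ0), Jf H₁ k w ∈ Metric.ball (b / k + M / 12 + M / 2 / 2) (M / 2 / 20) := by
    refine (Jf_contDiffAt R (w := (y, ζ0)) hyN).continuousAt.eventually_mem ?_
    rw [hJ]; exact Metric.ball_mem_nhds _ (by positivity)
  have h2 : ∀ᶠ w : Phase d × ℂ in 𝓝 (y, ζ0), φ (-(Complex.arg w.2 / (2 * Real.pi * k))) w.1 ∈ V := by
    have h3 : ContinuousAt (fun w : Phase d × ℂ => (-(Complex.arg w.2 / (2 * Real.pi * k)), w.1)) (y, ζ0) := by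
      refine ContinuousAt.prodMk (ContinuousAt.neg (ContinuousAt.div_const ?_ _)) continuousAt_fst
      have h5 : ContinuousAt Complex.arg ζ0 :=
        Complex.continuousAt_arg (Complex.ofReal_mem_slitPlane.2 hζ0)
      exact ContinuousAt.comp (f := Prod.snd) (x := (y, ζ0)) h5 continuousAt_snd
    have harg : Complex.arg ζ0 = 0 := Complex.arg_ofReal_of_nonneg hζ0.le
    have h4 : ContinuousAt (fun w : Phase d × ℂ => φ (-(Complex.arg w.2 / (2 * Real.pi * k))) w.1) (y, ζ0) :=
      ContinuousAt.comp (g := fun p : ℝ × Phase d => φ p.1 p.2)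
        (f := fun w : Phase d × ℂ => (-(Complex.arg w.2 / (2 * Real.pi * k)), w.1))
        (phi_contDiffAt (n := 0) R.hN R.hφ hyN _).continuousAt h3
    refine h4.eventually_mem ?_
    simp only [harg, zero_div, neg_zero, R.hφ.2.2.1 y hyN]
    exact hV.mem_nhds hy
  filter_upwards [h1, h2, Ff_ev (M := M) (χ := χ) R (w := (y, ζ0)) hyN hne] with w hw1 hw2 hw3
  rw [hw3, Hh, hHV _ hw2, Q.hχ1 _ (le_of_lt (by simpa [Real.dist_eq] using hw1))]
  ring

/-- derivative of the Hamiltonian -/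
lemma Ff_fderiv (R : Red N H₁ φ H k K m a b) (Q : Cut k m a b M χ χ') {x : Phase d} (hx : x ∈ N) {ζ : ℂ}
    (hζ : ζ ≠ 0) (v : Phase d) (η : ℂ) :
    fderiv ℝ (Ff N H₁ φ H k M χ) (x, ζ) (v, η) =
      χ (Jf H₁ k (x, ζ)) / (2 * k) * fderiv ℝ (Hh φ H k) (x, ζ) (v, η) +
      (-(M - Hh φ H k (x, ζ) / (2 * k)) * χ' (Jf H₁ k (x, ζ))) *
        (2 * Real.pi * (conj ζ * η).re + fderiv ℝ H₁ x v / k) := by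
  have hl1 : HasDerivAt (fun t : ℝ => x + t • v) v 0 := by
    simpa using ((hasDerivAt_id (0:ℝ)).smul_const v).const_add x
  have hl2 : HasDerivAt (fun t : ℝ => ζ + t • η) η 0 := by
    simpa using ((hasDerivAt_id (0:ℝ)).smul_const η).const_add ζ
  have e1 : x + (0:ℝ) • v = x := by simp
  have e2 : ζ + (0:ℝ) • η = ζ := by simp
  have h0 : HasFDerivAt (Ff N H₁ φ H k M χ) (fderiv ℝ (Ff N H₁ φ H k M χ) (x, ζ))
      (x + (0:ℝ) • v, ζ + (0:ℝ) • η) := by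
    rw [e1, e2]; exact ((Ff_contDiff R Q).differentiable (by norm_num)).differentiableAt.hasFDerivAt
  have h0' := h0.comp_hasDerivAt (0:ℝ) (hl1.prodMk hl2)
  have h1 : HasFDerivAt (Hh φ H k) (fderiv ℝ (Hh φ H k) (x, ζ)) (x + (0:ℝ) • v, ζ + (0:ℝ) • η) := by
    rw [e1, e2]; exact ((R.Hh_contDiffAt hx hζ).differentiableAt (by norm_num)).hasFDerivAt
  have h2 := h1.comp_hasDerivAt (0:ℝ) (hl1.prodMk hl2)
  have h3 := Jf_hasDerivAt R (by rw [e1]; exact hx) hl1 hl2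
  have h4 := (Q.hχd _).comp (0:ℝ) h3
  have h5 := (((h2.div_const (2 * (k:ℝ))).const_sub M).mul h4).const_sub M
  have h6 := h5.congr_of_eventuallyEq (f₁ := fun t : ℝ => Ff N H₁ φ H k M χ (x + t • v, ζ + t • η)) (by
    have hc : ContinuousAt (fun t : ℝ => (x + t • v, ζ + t • η)) 0 := (hl1.prodMk hl2).continuousAt
    have hev := Ff_ev (M := M) (χ := χ) R (w := (x, ζ)) hx hζ
    rw [← e1, ← e2] at hev
    have := hc.eventually hev
    simp only [e1, e2] at this
    exact this)
  have h7 := h0'.unique h6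
  rw [h7]
  simp only [Function.comp, e1, e2]
  ring
end Red
end HZ

namespace HZ
set_option linter.unusedSectionVars false

section Red
open Filter Topology ComplexConjugate
variable {d : ℕ}
variable {N : Set (Phase d)} {H₁ : Phase d → ℝ} {φ : ℝ → Phase d → Phase d} {H : Phase d → ℝ} {k : ℕ}
    {K : Set (Phase d)} {m a b : ℝ} {M : ℝ} {χ χ' : ℝ → ℝ}

/-- angular speed -/
def nu (H₁ : Phase d → ℝ) (φ : ℝ → Phase d → Phase d) (H : Phase d → ℝ) (k : ℕ) (M : ℝ)
    (χ' : ℝ → ℝ) (w : Phase d × ℂ) : ℝ := -(M - Hh φ H k w / (2 * k)) * χ' (Jf H₁ k w)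

lemma eqs (R : Red N H₁ φ H k K m a b) (Q : Cut k m a b M χ χ') {x : Phase d} (hx : x ∈ N) {ζ : ℂ}
    (hζ : ζ ≠ 0) {x' : Phase d} {ζ' : ℂ}
    (hE : ∀ v η, fderiv ℝ (Ff N H₁ φ H k M χ) (x, ζ) (v, η) = omega0 x' v + (conj (-Complex.I * ζ') * η).re) :
    (ζ' / ζ).im = 2 * Real.pi * nu H₁ φ H k M χ' (x, ζ) ∧
    2 * Real.pi * (conj ζ * ζ').re + fderiv ℝ H₁ x x' / k = 0 ∧
    ∀ α : ℝ, ζ = ‖ζ‖ * Complex.exp (α * Complex.I) →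
      (-(nu H₁ φ H k M χ' (x, ζ) / k)) • hamVF H₁ (φ (-(α / (2 * Real.pi * k))) x)
        + Dp φ (-(α / (2 * Real.pi * k))) x x'
        = (χ (Jf H₁ k (x, ζ)) / (2 * k)) • hamVF H (φ (-(α / (2 * Real.pi * k))) x) := by
  have hk := R.kpos
  have hpi := Real.pi_pos
  set ν := nu H₁ φ H k M χ' (x, ζ) with hν
  set X := χ (Jf H₁ k (x, ζ)) / (2 * k) with hX
  have hns : Complex.normSq ζ ≠ 0 := by simpa using hζ
  have hE' : ∀ α : ℝ, ζ = ‖ζ‖ * Complex.exp (α * Complex.I) → ∀ v η,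
      X * fderiv ℝ H (φ (-(α / (2 * Real.pi * k))) x)
      ((-((η / ζ).im / (2 * Real.pi * k))) • hamVF H₁ (φ (-(α / (2 * Real.pi * k))) x)
        + Dp φ (-(α / (2 * Real.pi * k))) x v) + ν * (2 * Real.pi * (conj ζ * η).re + fderiv ℝ H₁ x v / k)
        = omega0 x' v + (conj (-Complex.I * ζ') * η).re := by
    intro α hα v η
    rw [← hE, Ff_fderiv R Q hx hζ, R.Hh_fderiv hx hζ hα, hν, nu, hX]
  have harg := (Complex.norm_mul_exp_arg_mul_I ζ).symm
  have om0 : omega0 x' 0 = 0 := by simp [omega0]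
  refine ⟨?_, ?_, ?_⟩
  · have h1 := hE' _ harg 0 ζ
    rw [div_self hζ, om0] at h1
    simp only [Complex.one_im, zero_div, neg_zero, zero_smul, map_zero, mul_zero, add_zero, zero_add] at h1
    rw [Complex.div_im]
    simp only [Complex.normSq_apply] at *
    simp at h1
    rw [← sub_div, div_eq_iff hns]
    linarith
  · have h1 := hE' _ harg 0 (Complex.I * ζ)
    have h2 := hE' _ harg (hamVF H₁ x) 0
    rw [Dp_hamVF R.hN R.hφ hx] at h2
    set Y := hamVF H₁ (φ (-(Complex.arg ζ / (2 * Real.pi * k))) x)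
    set D := fderiv ℝ H (φ (-(Complex.arg ζ / (2 * Real.pi * k))) x)
    rw [mul_div_assoc, div_self hζ, om0] at h1
    have h3 : fderiv ℝ H₁ x (hamVF H₁ x) = 0 := by rw [← omega0_hamVF, omega0_self]
    have h4 : fderiv ℝ H₁ x x' = - omega0 x' (hamVF H₁ x) := by rw [← omega0_hamVF, omega0_symm]
    rw [h3] at h2
    simp only [zero_div, Complex.zero_im, neg_zero, zero_smul, zero_add, mul_zero, Complex.zero_re, add_zero] at h2
    rw [h4, ← h2]
    simp only [mul_one, Complex.I_im, map_zero, add_zero, map_smul, smul_eq_mul, zero_div, zero_add] at h1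
    have h5 : (conj ζ * (Complex.I * ζ)).re = 0 := by simp; ring
    have h6 : (conj (-Complex.I * ζ') * (Complex.I * ζ)).re = -(conj ζ * ζ').re := by simp; ring
    rw [h5, h6] at h1
    have h7 : (conj ζ * ζ').re = X * ((1 / (2 * Real.pi * k)) * D Y) := by linarith
    rw [h7]; field_simp; ring
  · intro α hα
    have h1 := hE' α hα
    set σ := -(α / (2 * Real.pi * k))
    rw [← sub_eq_zero]
    refine omega0_nondeg fun v => ?_
    obtain ⟨u, rfl⟩ := Dp_surj R.hN R.hφ hx σ v
    have h2 := h1 u 0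
    simp only [zero_div, Complex.zero_im, neg_zero, zero_smul, zero_add, mul_zero, Complex.zero_re, add_zero] at h2
    rw [omega0_sub_left, omega0_add_left, omega0_smul_left, omega0_smul_left, Dp_symp R.hN R.hH₁ R.hφ hx,
      ← h2, omega0_hamVF H, ← Dp_hamVF R.hN R.hφ hx, Dp_symp R.hN R.hH₁ R.hφ hx, omega0_hamVF]
    ring

/-- polar form of a curve with constant angular speed -/
lemma polar {ζ ζ' : ℝ → ℂ} (hd : ∀ t, HasDerivAt ζ (ζ' t) t) (h0 : ∀ t, ζ t ≠ 0) {β : ℝ}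
    (hβ : ∀ t, (ζ' t / ζ t).im = β) (t : ℝ) :
    ζ t = ‖ζ t‖ * Complex.exp ((Complex.arg (ζ 0) + β * t : ℝ) * Complex.I) := by
  set A := Complex.arg (ζ 0)
  set g : ℝ → ℝ := fun t => Real.log (‖ζ t‖ ^ 2) / 2 with hg
  have hpos : ∀ t, 0 < ‖ζ t‖ := fun t => norm_pos_iff.2 (h0 t)
  have hge : ∀ t, Real.exp (g t) = ‖ζ t‖ := fun t => by
    rw [hg]; simp only [Real.log_pow]
    rw [show ((2:ℕ):ℝ) * Real.log ‖ζ t‖ / 2 = Real.log ‖ζ t‖ by push_cast; ring, Real.exp_log (hpos t)]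
  have hgd : ∀ t, HasDerivAt g (ζ' t / ζ t).re t := fun t => by
    have h1 := ((hd t).norm_sq.log (by have := hpos t; positivity)).div_const 2
    refine h1.congr_deriv ?_
    rw [Complex.inner, ← Complex.normSq_eq_norm_sq, Complex.div_re]
    have : Complex.normSq (ζ t) ≠ 0 := by simpa using h0 t
    field_simp
    simp
  have hE : ∀ t, HasDerivAt (fun t => ζ t * Complex.exp (-((g t : ℂ) + ((A + β * t : ℝ) : ℂ) * Complex.I))) 0 t := by
    intro t
    have h1 : HasDerivAt (fun t : ℝ => ((A + β * t : ℝ) : ℂ)) (β : ℂ) t := by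
      have := ((hasDerivAt_id t).const_mul β).const_add A
      simpa using this.ofReal_comp
    have h2 := ((hgd t).ofReal_comp.add (h1.mul_const Complex.I)).neg.cexp
    refine ((hd t).mul h2).congr_deriv ?_
    have h3 : (((ζ' t / ζ t).re : ℂ) + β * Complex.I) = ζ' t / ζ t := by
      rw [← hβ t]; exact Complex.re_add_im _
    rw [h3]
    have e : ζ t * (ζ' t / ζ t) = ζ' t := mul_div_cancel₀ _ (h0 t)
    simp only [Pi.neg_apply, Pi.add_apply]
    linear_combination (-(Complex.exp (-((g t : ℂ) + ((A + β * t : ℝ) : ℂ) * Complex.I)))) * e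
  have hc := is_const_of_deriv_eq_zero (fun t => (hE t).differentiableAt) (fun t => (hE t).deriv) t 0
  simp only [mul_zero, add_zero] at hc
  have hc0 : ζ 0 * Complex.exp (-((g 0 : ℂ) + (A : ℂ) * Complex.I)) = 1 := by
    rw [Complex.exp_neg, Complex.exp_add, ← Complex.ofReal_exp, hge, Complex.norm_mul_exp_arg_mul_I]
    exact mul_inv_cancel₀ (h0 0)
  rw [hc0, Complex.exp_neg, Complex.exp_add, ← Complex.ofReal_exp, hge] at hc
  have hne : (‖ζ t‖ : ℂ) * Complex.exp (((A + β * t : ℝ) : ℂ) * Complex.I) ≠ 0 :=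
    mul_ne_zero (by simpa using h0 t) (Complex.exp_ne_zero _)
  exact (mul_inv_eq_one₀ hne).1 hc
end Red
end HZ

namespace HZ
set_option linter.unusedSectionVars false

section Red
open Filter Topology ComplexConjugate
variable {d : ℕ}
variable {N : Set (Phase d)} {H₁ : Phase d → ℝ} {φ : ℝ → Phase d → Phase d} {H : Phase d → ℝ} {k : ℕ}
    {K : Set (Phase d)} {m a b : ℝ} {M : ℝ} {χ χ' : ℝ → ℝ}

lemma phi_int (hφ : FreeHamCircleAction N H₁ φ) {x : Phase d} (hx : x ∈ N) (s : ℝ) (n : ℤ) :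
    φ (s + n) x = φ s x := by
  have hp : Function.Periodic (fun t => φ t x) 1 := fun t => hφ.2.2.2.2.1 t x hx
  have := hp.int_mul n s
  simpa using this

lemma const_of_zero {E : Type*} [NormedAddCommGroup E] [NormedSpace ℝ E] {f : ℝ → E}
    (h : ∀ t, HasDerivAt f 0 t) (t : ℝ) : f t = f 0 :=
  is_const_of_deriv_eq_zero (fun t => (h t).differentiableAt) (fun t => (h t).deriv) t 0

lemma Red.orbit (R : Red N H₁ φ H k K m a b) (Q : Cut k m a b M χ χ') {V : Set (Phase d)} (hV : IsOpen V)
    {y0 : Phase d} (hy0 : y0 ∈ V) (hHV : ∀ x ∈ V, H x = 0) :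
    ∃ (γ : ℝ → Phase d) (T : ℝ), 0 < T ∧ T < 1 ∧ IsPeriodicOrbit H γ T ∧
      (∃ t t', γ t ≠ γ t') ∧ (∀ t, γ t ∈ K) := by
  have hk := R.kpos
  have hM := Q.hMpos
  have hpi := Real.pi_pos
  obtain ⟨p, hp⟩ := Ff_zero R Q hV hy0 hHV
  obtain ⟨x, x', ζ, ζ', hx, hζ, px, pζ, hne, hE⟩ := hz_phase (Ff_contDiff R Q) (M := M) (r2 := 11 / 12 * M / Real.pi)
    (by positivity) (Ff_bd R Q) hp (KK_compact R) (fun w hw => Ff_off R Q hw)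
    (fun w hw => by
      have h1 := hw.2.2
      have h2 := Q.hba
      rw [lt_div_iff₀ hpi]
      linarith)
    (by rw [mul_div_cancel₀ _ hpi.ne']; linarith)
  set F := Ff N H₁ φ H k M χ with hF
  have hFs : ContDiff ℝ 2 F := Ff_contDiff R Q
  -- conservation of energy
  have hcons : ∀ t, F (x t, ζ t) = F (x 0, ζ 0) := by
    refine const_of_zero (f := fun t => F (x t, ζ t)) fun t => ?_
    have h1 : HasFDerivAt F (fderiv ℝ F (x t, ζ t)) (x t, ζ t) :=
      (hFs.differentiable (by norm_num)).differentiableAt.hasFDerivAt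
    have h2 := h1.comp_hasDerivAt t ((hx t).prodMk (hζ t))
    refine h2.congr_deriv ?_
    rw [hE, omega0_self]
    simp; ring
  have hlt : ∀ t, F (x t, ζ t) ≠ M := by
    intro t0 ht0
    have hall : ∀ t, F (x t, ζ t) = M := fun t => by rw [hcons, ← hcons t0, ht0]
    have hD : ∀ t, fderiv ℝ F (x t, ζ t) = 0 := fun t => by
      refine IsLocalMax.fderiv_eq_zero (Filter.Eventually.of_forall fun w => ?_)
      rw [hall t]; exact (Ff_bd R Q w).2
    have hx0 : ∀ t, x' t = 0 := fun t => omega0_nondeg fun v => by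
      have := hE t v 0
      rw [hD t] at this
      simpa using this.symm
    have hζ0 : ∀ t, ζ' t = 0 := fun t => by
      have := hE t 0 (-Complex.I * ζ' t)
      rw [hD t] at this
      have om0 : omega0 (x' t) 0 = 0 := by simp [omega0]
      rw [om0, ← Complex.normSq_eq_conj_mul_self] at this
      simpa using this.symm
    obtain ⟨t, ht | ht⟩ := hne
    · exact ht (const_of_zero (fun t => by simpa only [hx0 t] using hx t) t)
    · exact ht (const_of_zero (fun t => by simpa only [hζ0 t] using hζ t) t)
  have hS := fun t => Ff_supp R Q (hlt t)
  have hxN : ∀ t, x t ∈ N := fun t => (hS t).1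
  have hζne : ∀ t, ζ t ≠ 0 := fun t => (hS t).2.1
  have hEq := fun t => eqs R Q (hxN t) (hζne t) (hE t)
  have hJ : ∀ t, Jf H₁ k (x t, ζ t) = Jf H₁ k (x 0, ζ 0) := by
    refine const_of_zero (f := fun t => Jf H₁ k (x t, ζ t)) fun t => ?_
    exact (Jf_hasDerivAt R (hxN t) (hx t) (hζ t)).congr_deriv (hEq t).2.1
  set J0 := Jf H₁ k (x 0, ζ 0)
  have hχ0 : 0 < χ J0 := (hS 0).2.2.2.2.1
  have hHh : ∀ t, Hh φ H k (x t, ζ t) = Hh φ H k (x 0, ζ 0) := by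
    intro t
    have h1 := hcons t
    rw [hF, Ff_of_mem (hxN t) (hζne t), Ff_of_mem (hxN 0) (hζne 0), hJ t] at h1
    have h2 : (M - Hh φ H k (x t, ζ t) / (2 * k)) * χ J0 = (M - Hh φ H k (x 0, ζ 0) / (2 * k)) * χ J0 := by
      linarith
    have h3 := mul_right_cancel₀ hχ0.ne' h2
    have h4 : Hh φ H k (x t, ζ t) / (2 * k) = Hh φ H k (x 0, ζ 0) / (2 * k) := by linarith
    have h5 : (2 * (k:ℝ)) ≠ 0 := by positivity
    exact (div_left_inj' h5).1 h4
  set ν := nu H₁ φ H k M χ' (x 0, ζ 0) with hν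
  have hνt : ∀ t, nu H₁ φ H k M χ' (x t, ζ t) = ν := fun t => by
    rw [hν, nu, nu, hHh t, hJ t]
  have hνk : |ν| < k := by
    have h1 : 0 ≤ Hh φ H k (x 0, ζ 0) / (2 * k) := div_nonneg (R.h0 _).1 (by positivity)
    have h2 : Hh φ H k (x 0, ζ 0) / (2 * k) ≤ M := by
      rw [div_le_iff₀ (by positivity)]
      have := (hS 0).2.2.2.1
      linarith [Q.hM]
    have h3 : |M - Hh φ H k (x 0, ζ 0) / (2 * k)| ≤ M := by rw [abs_le]; constructor <;> linarith
    have h4 : |ν| ≤ M * (5 / (M / 2)) := by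
      rw [hν, nu, abs_mul, abs_neg]
      exact mul_le_mul h3 (Q.hχ5 _) (abs_nonneg _) hM.le
    have h5 : M * (5 / (M / 2)) = 10 := by field_simp; norm_num
    have h6 : (10 : ℝ) < k := by exact_mod_cast R.hk
    linarith
  have hpol := polar hζ hζne (β := 2 * Real.pi * ν) (fun t => by rw [(hEq t).1, hνt t])
  set A := Complex.arg (ζ 0) with hA
  -- the rotation number is an integer
  obtain ⟨n, hn⟩ : ∃ n : ℤ, ν = n := by
    have h1 := hpol 1
    have h0 := hpol 0
    have h2 : ζ 1 = ζ 0 := by simpa using pζ 0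
    rw [h2] at h1
    have h3 := mul_left_cancel₀ (by simpa using hζne 0 : (‖ζ 0‖ : ℂ) ≠ 0) (h1.symm.trans h0)
    obtain ⟨n, hn⟩ := Complex.exp_eq_exp_iff_exists_int.1 h3
    refine ⟨n, ?_⟩
    have h4 := congrArg Complex.im hn
    simp at h4
    have h5 : (ν - n) * (2 * Real.pi) = 0 := by linarith
    have h6 : ν - n = 0 := by
      rcases mul_eq_zero.1 h5 with h | h
      · exact h
      · linarith
    linarith
  -- the reduced curve
  set α : ℝ → ℝ := fun t => A + 2 * Real.pi * ν * t with hα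
  set σ : ℝ → ℝ := fun t => -(α t / (2 * Real.pi * k)) with hσ
  set y : ℝ → Phase d := fun t => φ (σ t) (x t) with hy
  set κ := χ J0 / (2 * k) with hκ
  have hκpos : 0 < κ := by positivity
  have hσd : ∀ t, HasDerivAt σ (-(ν / k)) t := fun t => by
    have h1 : HasDerivAt α (2 * Real.pi * ν) t := by
      have := ((hasDerivAt_id t).const_mul (2 * Real.pi * ν)).const_add A
      rw [mul_one] at this
      exact this
    refine (h1.div_const (2 * Real.pi * k)).neg.congr_deriv ?_
    field_simp
  have hyd : ∀ t, HasDerivAt y (κ • hamVF H (y t)) t := fun t => by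
    refine (phi_curve R.hN R.hφ (hxN t) (hσd t) (hx t)).congr_deriv ?_
    have := (hEq t).2.2 (α t) (hpol t)
    rw [hνt t, hJ t] at this
    exact this
  have hyK : ∀ t, y t ∈ K := fun t => by
    by_contra h
    have h1 := R.hKm _ h
    have h2 := R.Hh_eq (hxN t) (hζne t) (hpol t)
    have h3 := (hS t).2.2.2.1
    rw [h2] at h3
    exact absurd h1 h3.ne
  have hσ1 : ∀ t s, σ (t + s) = -(n * s / k) + σ t := fun t s => by
    simp only [hσ, hα, hn]
    field_simp; ring
  have hpx : ∀ t (j : ℕ), x (t + j) = x t := fun t j => by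
    have hp : Function.Periodic x 1 := px
    have := hp.nat_mul j t
    simpa using this
  have hyk : ∀ t, y (t + k) = y t := fun t => by
    simp only [hy]
    rw [hpx, hσ1, mul_div_assoc, div_self hk.ne', mul_one, add_comm]
    have := phi_int R.hφ (hxN t) (σ t) (-n)
    simpa using this
  refine ⟨fun s => y (s / κ), k * κ, by positivity, ?_, ⟨fun t => ?_, fun t => ?_⟩, ?_, fun t => hyK _⟩
  · rw [hκ]
    have := (Q.hχ01 J0).2
    have e : k * (χ J0 / (2 * k)) = χ J0 / 2 := by field_simp
    rw [e]; linarith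
  · have h1 : HasDerivAt (fun s : ℝ => s / κ) (1 / κ) t := (hasDerivAt_id t).div_const κ
    refine ((hyd (t / κ)).scomp t h1).congr_deriv ?_
    rw [smul_smul, one_div, inv_mul_cancel₀ hκpos.ne', one_smul]
  · show y ((t + k * κ) / κ) = y (t / κ)
    rw [add_div, mul_div_assoc, div_self hκpos.ne', mul_one, hyk]
  · by_contra hcon
    push Not at hcon
    have hyc : ∀ t, y t = y 0 := fun t => by
      have := hcon (t * κ) 0
      simpa [hκpos.ne'] using this
    -- rotation number vanishes
    have h1 : φ (-(n / k : ℝ)) (y 0) = y 0 := by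
      have h2 := hyc 1
      have h3 : y 1 = φ (-(n / k : ℝ)) (y 0) := by
        simp only [hy]
        have e1 : x 1 = x 0 := by simpa using px 0
        have e2 : σ 1 = -(n / k : ℝ) + σ 0 := by simpa using hσ1 0 1
        rw [R.hφ.2.2.2.1 _ _ _ (hxN 0), e1, e2]
      rw [← h3, h2]
    obtain ⟨j, hj⟩ := R.hφ.2.2.2.2.2.2 _ _ (R.hKN (hyK 0)) h1
    have hnj : (n : ℝ) = -(j * k) := by
      have : (n : ℝ) / k = -j := by linarith
      rw [div_eq_iff hk.ne'] at this
      linarith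
    have hj0 : j = 0 := by
      by_contra hj0
      have h2 : (1 : ℝ) ≤ |(j : ℝ)| := by exact_mod_cast Int.one_le_abs hj0
      rw [hn, hnj, abs_neg, abs_mul, abs_of_pos hk] at hνk
      nlinarith
    have hn0 : (n : ℝ) = 0 := by rw [hnj, hj0]; simp
    have hσc : ∀ t, σ t = σ 0 := fun t => by
      have := hσ1 0 t
      rw [hn0] at this
      simpa using this
    have hxc : ∀ t, x t = x 0 := fun t => by
      have h2 : ∀ t, φ (-σ 0) (y t) = x t := fun t => by
        simp only [hy]
        rw [R.hφ.2.2.2.1 _ _ _ (hxN t), hσc t, neg_add_cancel, R.hφ.2.2.1 _ (hxN t)]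
      rw [← h2 t, hyc t, h2 0]
    have hζc : ∀ t, ζ t = ζ 0 := fun t => by
      have h2 := hJ t
      simp only [J0, Jf, hxc t] at h2
      have h3 : Real.pi * ‖ζ t‖ ^ 2 = Real.pi * ‖ζ 0‖ ^ 2 := by linarith
      have h4 := mul_left_cancel₀ hpi.ne' h3
      have h5 : ‖ζ t‖ = ‖ζ 0‖ := (sq_eq_sq₀ (norm_nonneg _) (norm_nonneg _)).1 h4
      have h6 := hpol t
      have h7 := hpol 0
      rw [hn, hn0] at h6 h7
      rw [h6, h7, h5]
      simp
    obtain ⟨t, ht | ht⟩ := hne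
    · exact ht (hxc t)
    · exact ht (hζc t)
end Red
end HZ

/-- Theorem 2.1 of the paper, for `(ℝ^{2d}, ω₀)`:
with `N`, `φ`, `H₁`, `U`, `c` as before and `k` a positive integer with
`√k > (4π/k)(c + √k)`, every pre-admissible `H` supported in `U` which is
invariant under the induced `ℤ_k`-action and has `max H > 2π(c + √k)`
possesses a nonconstant periodic orbit, contained in `U`, of period `< 1`. -/
theorem stmt1 {d : ℕ} (hd : 1 ≤ d) {N U : Set (Phase d)}
    (hN : IsOpen N) (hU : IsOpen U)
    (hUcl : IsCompact (closure U)) (hUN : closure U ⊆ N)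
    {H₁ : Phase d → ℝ} (hH₁ : ContDiffOn ℝ (⊤ : ℕ∞) H₁ N)
    {φ : ℝ → Phase d → Phase d} (hφ : FreeHamCircleAction N H₁ φ)
    {c : ℝ} (hc : c = sSup (H₁ '' U) - sInf (H₁ '' U))
    {k : ℕ} (hkpos : 0 < k)
    (hkineq : Real.sqrt k > (4 * Real.pi / k) * (c + Real.sqrt k))
    {H : Phase d → ℝ} {mH : ℝ} (hH : PreAdmissible H U mH)
    (hinv : ∀ x ∈ N, H (φ (1 / k) x) = H x)
    (hmH : mH > 2 * Real.pi * (c + Real.sqrt k)) :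
    ∃ (γ : ℝ → Phase d) (T : ℝ), 0 < T ∧ T < 1 ∧ IsPeriodicOrbit H γ T ∧
      (∃ t t', γ t ≠ γ t') ∧ (∀ t, γ t ∈ U) := by
  have _ := hd
  have _ := hU
  obtain ⟨hHs, hH0, ⟨V, hVo, ⟨y0, hy0⟩, hVU, hV0⟩, ⟨K, hK, hKU, hKm⟩⟩ := hH
  have hk : (0 : ℝ) < k := by exact_mod_cast hkpos
  have hcont : ContinuousOn H₁ (closure U) := hH₁.continuousOn.mono hUN
  have hcomp : IsCompact (H₁ '' closure U) := hUcl.image_of_continuousOn hcont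
  have hsub : H₁ '' U ⊆ H₁ '' closure U := image_mono subset_closure
  have hbA : BddAbove (H₁ '' U) := hcomp.bddAbove.mono hsub
  have hbB : BddBelow (H₁ '' U) := hcomp.bddBelow.mono hsub
  have hbd : ∀ x ∈ U, sInf (H₁ '' U) ≤ H₁ x ∧ H₁ x ≤ sSup (H₁ '' U) := fun x hx =>
    ⟨csInf_le hbB ⟨x, hx, rfl⟩, le_csSup hbA ⟨x, hx, rfl⟩⟩
  have hc0 : 0 ≤ c := by
    have := hbd y0 (hVU hy0)
    rw [hc]; linarith
  have hsq : 0 < Real.sqrt k := Real.sqrt_pos.2 hk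
  have hpi := Real.pi_gt_three
  have hkbig : 10 < k := by
    have h1 : 4 * Real.pi / k * Real.sqrt k ≤ 4 * Real.pi / k * (c + Real.sqrt k) := by
      gcongr; linarith
    have h2 : 4 * Real.pi / k * Real.sqrt k < 1 * Real.sqrt k := by linarith
    have h3 := lt_of_mul_lt_mul_right h2 hsq.le
    rw [div_lt_one hk] at h3
    have h4 : (10 : ℝ) < k := by linarith
    exact_mod_cast h4
  have hm6 : 6 * c < mH := by nlinarith
  have hmpos : 0 < mH := by linarith
  have hMpos : 0 < mH / (2 * k) := by positivity
  obtain ⟨χ, χ', h1, h2, h3, h4, h5, h6, h7⟩ :=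
    HZ.exists_chi (sSup (H₁ '' U) / k + mH / (2 * k) / 12) (w := mH / (2 * k) / 2) (by positivity)
  have R : HZ.Red N H₁ φ H k K mH (sInf (H₁ '' U)) (sSup (H₁ '' U)) :=
    { hN := hN, hH₁ := hH₁, hφ := hφ, hk := hkbig, hH := hHs.of_le HZ.two_le_top, h0 := hH0, hK := hK,
      hKN := fun x hx => hUN (subset_closure (hKU hx)), hKm := fun x hx => hKm x hx, hinv := hinv,
      hab := fun x hx => hbd x (hKU hx) }
  have Q : HZ.Cut k mH (sInf (H₁ '' U)) (sSup (H₁ '' U)) (mH / (2 * k)) χ χ' :=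
    { hM := by field_simp
      hMpos := hMpos
      hba := by
        rw [← hc, div_div, div_lt_div_iff₀ hk (by positivity)]
        nlinarith
      hχ := h1, hχd := h2, hχ01 := h3, hχl := h4, hχr := h5, hχ1 := h6, hχ5 := h7 }
  obtain ⟨γ, T, hT0, hT1, horb, hnc, hγ⟩ := R.orbit Q hVo hy0 hV0
  exact ⟨γ, T, hT0, hT1, horb, hnc, fun t => hKU (hγ t)⟩
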